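/- (Local energy estimate) Let $1<g_0\le g_1<\infty$, let $N\ge 1$ be an integer and let $C_0,C_1>0$; the data are $\{g_0,g_1,N,C_0,C_1\}$. Set $r=\frac{1-g_1}{g_0}$, $s=g_1+\frac{g_1}{g_0}(g_1-1)$ and $q=2+2g_1+\frac{g_1}{g_0}(g_1-1)$. Then there exist constants $c_0,c_1,c_2>0$ depending only on the data such that the following holds. Let $g:[0,\infty)\to[0,\infty)$ be continuous and nondecreasing, positive on $(0,\infty)$, and let $G(\sigma)=\int_0^\sigma g(y)\,dy$ satisfy $g_0G(\sigma)\le\sigma g(\sigma)\le g_1G(\sigma)$ for all $\sigma>0$. Let $\rho>0$, $t_0<t_1$, $K_\rho=\{x\in\mathbb R^N:\max_i|x_i|<\rho\}$ and $Q=K_\rho\times(t_0,t_1)$. Let $(u,V)$ be a locally bounded weak solution of $u_t-\operatorname{div}\mathbf A(x,t,u,Du)=0$ under the structure conditions $\mathbf A\cdot Du\ge C_0G(|Du|)$, $|\mathbf A|\le C_1g(|Du|)$, in the following sense: $u:K_\rho\times(t_0,t_1]\to\mathbb R$ is continuous (hence locally bounded); $V:Q\to\mathbb R^N$ is measurable with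 $\iint_Q G(|V|)\,dx\,dt<\infty$ and is the weak spatial gradient of $u$, i.e. $\iint_Q u\,\partial_{x_i}\varphi\,dx\,dt=-\iint_Q V_i\varphi\,dx\,dt$ for all $\varphi\in C_c^\infty(Q)$ and all $i$; and there is a measurable field $a:Q\to\mathbb R^N$ with $a\cdot V\ge C_0G(|V|)$ and $|a|\le C_1g(|V|)$ a.e. in $Q$ such that, for every Lipschitz function $\varphi$ on $\overline{K_\rho}\times[t_0,t_1]$ vanishing in a neighborhood of the parabolic boundary $(\partial K_\rho\times[t_0,t_1])\cup(\overline{K_\rho}\times\{t_0\})$ and all $t_0\le\tau_1\le\tau_2\le t_1$, $$\int_{K_\rho}u(x,\tau_2)\varphi(x,\tau_2)\,dx-\int_{K_\rho}u(x,\tau_1)\varphi(x,\tau_1)\,dx=\int_{\tau_1}^{\tau_2}\!\!\int_{K_\rho}\bigl(u\,\varphi_t-a\cdot D\varphi\bigr)\,dx\,dt,$$ where $D\varphi$ is the spatial gradient and a product $u\varphi$ at time $t_0$ is read as $0$ (there $\varphi=0$). Let $k\in\mathbb R$, let $v$ denote either $(u-k)_+=\max(u-k,0)$ or $(u-k)_-=\max(k-u,0)$,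 and let $Dv$ denote its weak spatial gradient ($Dv=V$ on $\{u>k\}$, resp. $Dv=-V$ on $\{u<k\}$, and $Dv=0$ elsewhere). Then for every Lipschitz cutoff function $\zeta:\overline{K_\rho}\times[t_0,t_1]\to[0,1]$ that vanishes in a neighborhood of the parabolic boundary and is nondecreasing in $t$, and for every $t\in[t_0,t_1]$, $$\int_{K_\rho\times\{t\}}G\!\left(\tfrac{\zeta v}{\rho}\right)^{r-1}v^{s+2}\zeta^{q}\,dx+c_0\int_{t_0}^{t_1}\!\!\int_{K_\rho}G(|Dv|)\,G\!\left(\tfrac{\zeta v}{\rho}\right)^{r-1}v^{s}\zeta^{q}\,dx\,d\tau$$ $$\le c_1\int_{t_0}^{t_1}\!\!\int_{K_\rho}G\!\left(\tfrac{\zeta v}{\rho}\right)^{r-1}v^{s+2}\zeta^{q-1}\zeta_t\,dx\,d\tau+c_2\int_{t_0}^{t_1}\!\!\int_{K_\rho}G(|D\zeta|\,\zeta v)\,G\!\left(\tfrac{\zeta v}{\rho}\right)^{r-1}v^{s}\zeta^{q-1-2g_1}\,dx\,d\tau,$$ with the convention that every integrand is taken to be $0$ at points where $\zeta v=0$. 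-/

import Mathlib

open Set MeasureTheory

/-- The antiderivative `G(σ) = ∫_0^σ g(s) ds`. -/
noncomputable def primitiveG (g : ℝ → ℝ) (σ : ℝ) : ℝ :=
  ∫ y in (0 : ℝ)..σ, g y

/-- The conditions on the structure function `g : [0,∞) → [0,∞)` (only its values on `[0,∞)`
are constrained or used). -/
structure IsStructureFunction (g0 g1 : ℝ) (g : ℝ → ℝ) : Prop where
  continuousOn : ContinuousOn g (Ici 0)
  monotoneOn : MonotoneOn g (Ici 0)
  nonneg : ∀ σ : ℝ, 0 ≤ σ → 0 ≤ g σ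
  pos : ∀ σ : ℝ, 0 < σ → 0 < g σ
  lower : ∀ σ : ℝ, 0 < σ → g0 * primitiveG g σ ≤ σ * g σ
  upper : ∀ σ : ℝ, 0 < σ → σ * g σ ≤ g1 * primitiveG g σ

/-- The open cube in `ℝ^N` of center `y` and half side-length `ρ`. -/
def cube (N : ℕ) (y : EuclideanSpace ℝ (Fin N)) (ρ : ℝ) : Set (EuclideanSpace ℝ (Fin N)) :=
  {x | ∀ i, |x i - y i| < ρ}

/-- The parabolic boundary `(∂K × [T0,T1]) ∪ (K̄ × {T0})` of the cylinder `K × (T0,T1]`. -/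
def parabolicBoundary {N : ℕ} (K : Set (EuclideanSpace ℝ (Fin N))) (T0 T1 : ℝ) :
    Set (EuclideanSpace ℝ (Fin N) × ℝ) :=
  (frontier K) ×ˢ (Icc T0 T1) ∪ (closure K) ×ˢ ({T0} : Set ℝ)

/-- `φ` is Lipschitz on `K̄ × [T0,T1]` and vanishes in a (relative) neighborhood of the parabolic
boundary. Values of `φ` outside `K̄ × [T0,T1]` play no role. -/
def IsLipschitzTest {N : ℕ} (K : Set (EuclideanSpace ℝ (Fin N))) (T0 T1 : ℝ)
    (φ : EuclideanSpace ℝ (Fin N) → ℝ → ℝ) : Prop :=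
  (∃ L, LipschitzOnWith L (fun p : EuclideanSpace ℝ (Fin N) × ℝ => φ p.1 p.2)
    (closure K ×ˢ Icc T0 T1)) ∧
  ∃ U : Set (EuclideanSpace ℝ (Fin N) × ℝ), IsOpen U ∧ parabolicBoundary K T0 T1 ⊆ U ∧
    ∀ p ∈ U ∩ closure K ×ˢ Icc T0 T1, φ p.1 p.2 = 0

/-- `(u, V)` is a (locally bounded) weak solution of `u_t - div A(x,t,u,Du) = 0` on the cylinder
`K × (T0,T1]` under the structure conditions `A·Du ≥ C0·G(|Du|)`, `|A| ≤ C1·g(|Du|)`; `V` is the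
weak spatial gradient `Du`, and `a` is the field `A(x,t,u,Du)`. The function `u` is continuous up
to and including the final time `T1`; local boundedness is part of continuity. -/
structure IsWeakSolution {N : ℕ} (C0 C1 : ℝ) (g : ℝ → ℝ)
    (K : Set (EuclideanSpace ℝ (Fin N))) (T0 T1 : ℝ)
    (u : EuclideanSpace ℝ (Fin N) → ℝ → ℝ)
    (V : EuclideanSpace ℝ (Fin N) → ℝ → EuclideanSpace ℝ (Fin N)) : Prop where
  continuousOn : ContinuousOn (fun p : EuclideanSpace ℝ (Fin N) × ℝ => u p.1 p.2)
    (K ×ˢ Ioc T0 T1)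
  grad_measurable : AEMeasurable (fun p : EuclideanSpace ℝ (Fin N) × ℝ => V p.1 p.2)
    (volume.restrict (K ×ˢ Ioo T0 T1))
  grad_integrable : IntegrableOn
    (fun p : EuclideanSpace ℝ (Fin N) × ℝ => primitiveG g ‖V p.1 p.2‖) (K ×ˢ Ioo T0 T1)
  weak_gradient : ∀ φ : EuclideanSpace ℝ (Fin N) × ℝ → ℝ, ContDiff ℝ (⊤ : ℕ∞) φ →
    HasCompactSupport φ → tsupport φ ⊆ K ×ˢ Ioo T0 T1 → ∀ i : Fin N,
      (∫ p in K ×ˢ Ioo T0 T1, u p.1 p.2 * fderiv ℝ φ p (EuclideanSpace.single i 1, 0)) =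
        -(∫ p in K ×ˢ Ioo T0 T1, V p.1 p.2 i * φ p)
  -- the term `a·Dφ` is written as the spatial derivative of `φ` applied to the vector `a`
  weak_form : ∃ a : EuclideanSpace ℝ (Fin N) → ℝ → EuclideanSpace ℝ (Fin N),
    AEMeasurable (fun p : EuclideanSpace ℝ (Fin N) × ℝ => a p.1 p.2)
      (volume.restrict (K ×ˢ Ioo T0 T1)) ∧
    (∀ᵐ p : EuclideanSpace ℝ (Fin N) × ℝ ∂(volume.restrict (K ×ˢ Ioo T0 T1)),
      C0 * primitiveG g ‖V p.1 p.2‖ ≤ inner ℝ (a p.1 p.2) (V p.1 p.2) ∧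
      ‖a p.1 p.2‖ ≤ C1 * g ‖V p.1 p.2‖) ∧
    ∀ φ : EuclideanSpace ℝ (Fin N) → ℝ → ℝ, IsLipschitzTest K T0 T1 φ →
      ∀ τ1 τ2 : ℝ, T0 ≤ τ1 → τ1 ≤ τ2 → τ2 ≤ T1 →
        (∫ x in K, u x τ2 * φ x τ2) - (∫ x in K, u x τ1 * φ x τ1) =
          ∫ t in τ1..τ2, (∫ x in K,
            (u x t * deriv (φ x) t - fderiv ℝ (fun y => φ y t) x (a x t)))

open Filter Topology

namespace IsStructureFunction

variable {g0 g1 : ℝ} {g : ℝ → ℝ}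

lemma intervalIntegrable (hg : IsStructureFunction g0 g1 g) {a b : ℝ} (ha : 0 ≤ a) (hb : 0 ≤ b) :
    IntervalIntegrable g volume a b := by
  apply ContinuousOn.intervalIntegrable
  apply hg.continuousOn.mono
  intro x hx
  exact le_trans (le_min ha hb) hx.1

lemma hasDerivAt_primitiveG (hg : IsStructureFunction g0 g1 g) {y : ℝ} (hy : 0 < y) :
    HasDerivAt (primitiveG g) (g y) y := by
  have hnhds : Ici (0 : ℝ) ∈ 𝓝 y := Ici_mem_nhds hy
  refine intervalIntegral.integral_hasDerivAt_right (hg.intervalIntegrable le_rfl hy.le) ?_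
    (hg.continuousOn.continuousAt hnhds)
  exact ⟨Ici 0, hnhds, hg.continuousOn.aestronglyMeasurable measurableSet_Ici⟩

lemma primitiveG_zero : primitiveG g 0 = 0 := by simp [primitiveG]

lemma primitiveG_mono (hg : IsStructureFunction g0 g1 g) {a b : ℝ} (ha : 0 ≤ a) (hab : a ≤ b) :
    primitiveG g a ≤ primitiveG g b := by
  have h := intervalIntegral.integral_add_adjacent_intervals
    (hg.intervalIntegrable le_rfl ha) (hg.intervalIntegrable ha (ha.trans hab))
  have h2 : 0 ≤ ∫ y in a..b, g y :=
    intervalIntegral.integral_nonneg hab fun y hy => hg.nonneg y (ha.trans hy.1)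
  unfold primitiveG
  linarith

lemma primitiveG_nonneg (hg : IsStructureFunction g0 g1 g) {a : ℝ} (ha : 0 ≤ a) :
    0 ≤ primitiveG g a := by
  simpa [primitiveG_zero] using hg.primitiveG_mono le_rfl ha

lemma primitiveG_pos (hg : IsStructureFunction g0 g1 g) (h1 : 0 < g1) {a : ℝ} (ha : 0 < a) :
    0 < primitiveG g a := by
  have := hg.upper a ha
  have h2 := mul_pos ha (hg.pos a ha)
  by_contra hcon
  nlinarith [not_lt.mp hcon]

lemma continuousOn_primitiveG (hg : IsStructureFunction g0 g1 g) :
    ContinuousOn (primitiveG g) (Ici 0) := by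
  intro x hx
  have hx0 : (0 : ℝ) ≤ x := hx
  have h : ContinuousOn (primitiveG g) (Icc 0 (x + 1)) := by
    have := intervalIntegral.continuousOn_primitive_interval (a := 0) (b := x + 1) (μ := volume)
      (f := g) (by
        have := (hg.intervalIntegrable le_rfl (by linarith : (0 : ℝ) ≤ x + 1))
        rw [intervalIntegrable_iff_integrableOn_Icc_of_le (by linarith)] at this
        rwa [uIcc_of_le (by linarith)])
    rwa [uIcc_of_le (by linarith)] at this
  have h2 := h x ⟨hx0, by linarith⟩
  refine h2.mono_of_mem_nhdsWithin ?_
  rw [mem_nhdsWithin]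
  refine ⟨Iio (x + 1), isOpen_Iio, by simp, ?_⟩
  rintro y ⟨hy1, hy2⟩
  exact ⟨hy2, le_of_lt hy1⟩

/-- The ratio `G(y) / y ^ g1` is nonincreasing. -/
lemma antitoneOn_primitiveG_mul_rpow (hg : IsStructureFunction g0 g1 g) :
    AntitoneOn (fun y => primitiveG g y * y ^ (-g1)) (Ioi 0) := by
  have hd : ∀ y ∈ Ioi (0 : ℝ), HasDerivAt (fun y => primitiveG g y * y ^ (-g1))
      (g y * y ^ (-g1) + primitiveG g y * (-g1 * y ^ (-g1 - 1))) y := fun y hy =>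
    (hg.hasDerivAt_primitiveG hy).mul (Real.hasDerivAt_rpow_const (Or.inl (ne_of_gt hy)))
  apply antitoneOn_of_deriv_nonpos (convex_Ioi 0)
  · exact fun y hy => (hd y hy).continuousAt.continuousWithinAt
  · intro y hy
    rw [interior_Ioi] at hy
    exact (hd y hy).differentiableAt.differentiableWithinAt
  · intro y hy
    rw [interior_Ioi] at hy
    have hy0 : (0 : ℝ) < y := hy
    rw [(hd y hy).deriv]
    have e : y ^ (-g1) = y ^ (-g1 - 1) * y := by
      rw [← Real.rpow_add_one hy0.ne']; congr 1; ring
    rw [e]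
    have := hg.upper y hy
    have hp : 0 < y ^ (-g1 - 1) := Real.rpow_pos_of_pos hy0 _
    nlinarith

lemma primitiveG_mul_le (hg : IsStructureFunction g0 g1 g) {l y : ℝ} (hl : 1 ≤ l) (hy : 0 ≤ y) :
    primitiveG g (l * y) ≤ l ^ g1 * primitiveG g y := by
  have hl0 : 0 < l := by linarith
  rcases hy.eq_or_lt with rfl | hy
  · simp [primitiveG_zero]
  have h := hg.antitoneOn_primitiveG_mul_rpow (a := y) (b := l * y) hy (mul_pos hl0 hy)
    (by nlinarith)
  simp only [Real.mul_rpow hl0.le hy.le, Real.rpow_neg hl0.le, Real.rpow_neg hy.le] at h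
  have hp := Real.rpow_pos_of_pos hl0 g1
  have hp2 := Real.rpow_pos_of_pos hy g1
  have h3 : primitiveG g (l * y) * (l ^ g1)⁻¹ ≤ primitiveG g y := by
    rw [← mul_assoc] at h
    exact le_of_mul_le_mul_right h (inv_pos.mpr hp2)
  rw [← div_eq_mul_inv, div_le_iff₀ hp] at h3
  linarith

lemma mul_rpow_le_primitiveG (hg : IsStructureFunction g0 g1 g) {y M : ℝ} (hy : 0 < y)
    (hM : y ≤ M) : primitiveG g M * M ^ (-g1) * y ^ g1 ≤ primitiveG g y := by
  have h := hg.antitoneOn_primitiveG_mul_rpow (a := y) (b := M) hy (hy.trans_le hM) hM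
  simp only [Real.rpow_neg hy.le] at h
  rwa [← div_eq_mul_inv, le_div_iff₀ (Real.rpow_pos_of_pos hy g1)] at h

/-- Young's inequality for `g` and `G`. -/
lemma mul_le_young (hg : IsStructureFunction g0 g1 g) {κ A B : ℝ}
    (hκ : 0 < κ) (hκ1 : κ ≤ 1) (hA : 0 ≤ A) (hB : 0 ≤ B) (h1 : 0 < g1) :
    g A * B ≤ κ * g1 * primitiveG g A + κ * g1 * (κ⁻¹) ^ g1 * primitiveG g B := by
  have hGA := hg.primitiveG_nonneg hA
  have hGB := hg.primitiveG_nonneg hB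
  have hkp : 0 ≤ (κ⁻¹) ^ g1 := Real.rpow_nonneg (inv_nonneg.mpr hκ.le) _
  rcases le_or_gt B (κ * A) with h | h
  · have hAu : A * g A ≤ g1 * primitiveG g A := by
      rcases hA.eq_or_lt with rfl | hA
      · simp [primitiveG_zero]
      · exact hg.upper A hA
    have h2 : g A * B ≤ g A * (κ * A) := mul_le_mul_of_nonneg_left h (hg.nonneg A hA)
    have h3 : 0 ≤ κ * g1 * (κ⁻¹) ^ g1 * primitiveG g B := by positivity
    nlinarith
  · have hB0 : 0 < B := lt_of_le_of_lt (by positivity) h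
    have hBk : 0 < κ⁻¹ * B := by positivity
    have hAB : A ≤ κ⁻¹ * B := by
      rw [inv_mul_eq_div, le_div_iff₀ hκ]; linarith
    have h2 : g A ≤ g (κ⁻¹ * B) := hg.monotoneOn hA hBk.le hAB
    have h3 := hg.upper _ hBk
    have h4 := hg.primitiveG_mul_le (l := κ⁻¹) (y := B) ((one_le_inv₀ hκ).mpr hκ1) hB
    have h5 : g A * B ≤ κ * (κ⁻¹ * B * g (κ⁻¹ * B)) := by
      have : κ * (κ⁻¹ * B * g (κ⁻¹ * B)) = g (κ⁻¹ * B) * B := by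
        field_simp
      rw [this]
      exact mul_le_mul_of_nonneg_right h2 hB
    have h6 : κ * (κ⁻¹ * B * g (κ⁻¹ * B)) ≤ κ * (g1 * ((κ⁻¹) ^ g1 * primitiveG g B)) := by
      apply mul_le_mul_of_nonneg_left _ hκ.le
      exact h3.trans (mul_le_mul_of_nonneg_left h4 h1.le)
    have h7 : 0 ≤ κ * g1 * primitiveG g A := by positivity
    nlinarith

lemma mul_le_add (hg : IsStructureFunction g0 g1 g) (h1 : 0 < g1) {A B : ℝ}
    (hA : 0 ≤ A) (hB : 0 ≤ B) :
    g A * B ≤ g1 * primitiveG g A + g1 * primitiveG g B := by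
  simpa using hg.mul_le_young one_pos le_rfl hA hB h1

lemma le_add_primitiveG (hg : IsStructureFunction g0 g1 g) (h1 : 0 < g1) {A : ℝ}
    (hA : 0 ≤ A) : g A ≤ g1 * primitiveG g A + g1 * primitiveG g 1 := by
  simpa using hg.mul_le_add h1 hA zero_le_one

end IsStructureFunction

/-- A `C¹` weight `p` on the line, vanishing on `(-∞, 0]`, that grows at least linearly and at most
polynomially: `p y ≤ y * p' y ≤ Λ * p y`. -/
structure IsWeight (Λ : ℝ) (p p' : ℝ → ℝ) : Prop where
  hasDerivAt : ∀ y, HasDerivAt p (p' y) y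
  continuous_deriv : Continuous p'
  eq_zero : ∀ y ≤ 0, p y = 0
  deriv_eq_zero : ∀ y ≤ 0, p' y = 0
  nonneg : ∀ y, 0 ≤ p y
  lower : ∀ y, p y ≤ y * p' y
  upper : ∀ y, y * p' y ≤ Λ * p y

namespace IsWeight

variable {Λ : ℝ} {p p' : ℝ → ℝ}

lemma continuous (hp : IsWeight Λ p p') : Continuous p :=
  continuous_iff_continuousAt.mpr fun y => (hp.hasDerivAt y).continuousAt

lemma deriv_nonneg (hp : IsWeight Λ p p') (y : ℝ) : 0 ≤ p' y := by
  rcases le_or_gt y 0 with h | h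
  · exact (hp.deriv_eq_zero y h).ge
  · have := (hp.nonneg y).trans (hp.lower y)
    exact nonneg_of_mul_nonneg_right this h

lemma monotone (hp : IsWeight Λ p p') : Monotone p :=
  monotone_of_hasDerivAt_nonneg hp.hasDerivAt hp.deriv_nonneg

lemma hasDerivAt_primitive (hp : IsWeight Λ p p') (y : ℝ) :
    HasDerivAt (fun y => ∫ x in (0 : ℝ)..y, p x) (p y) y :=
  intervalIntegral.integral_hasDerivAt_right (hp.continuous.intervalIntegrable _ _)
    (hp.continuous.stronglyMeasurableAtFilter _ _) hp.continuous.continuousAt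

lemma primitive_eq_zero (hp : IsWeight Λ p p') {y : ℝ} (hy : y ≤ 0) :
    ∫ x in (0 : ℝ)..y, p x = 0 := by
  rw [intervalIntegral.integral_congr (g := fun _ => 0)]
  · simp
  · intro x hx
    rw [uIcc_of_ge hy] at hx
    exact hp.eq_zero x hx.2

lemma primitive_nonneg (hp : IsWeight Λ p p') (y : ℝ) : 0 ≤ ∫ x in (0 : ℝ)..y, p x := by
  rcases le_or_gt y 0 with h | h
  · exact (hp.primitive_eq_zero h).ge
  · exact intervalIntegral.integral_nonneg h.le fun x _ => hp.nonneg x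

lemma primitive_le (hp : IsWeight Λ p p') (y : ℝ) : ∫ x in (0 : ℝ)..y, p x ≤ y * p y := by
  rcases le_or_gt y 0 with h | h
  · simp [hp.primitive_eq_zero h, hp.eq_zero y h]
  · calc ∫ x in (0 : ℝ)..y, p x ≤ ∫ _ in (0 : ℝ)..y, p y :=
          intervalIntegral.integral_mono_on h.le (hp.continuous.intervalIntegrable _ _)
            intervalIntegrable_const fun x hx => hp.monotone hx.2
      _ = y * p y := by simp

lemma mul_le_primitive (hp : IsWeight Λ p p') (y : ℝ) :
    y * p y ≤ (Λ + 1) * ∫ x in (0 : ℝ)..y, p x := by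
  rcases le_or_gt y 0 with h | h
  · simp [hp.primitive_eq_zero h, hp.eq_zero y h]
  · have hd : ∀ x, HasDerivAt (fun x => x * p x) (1 * p x + x * p' x) x := fun x =>
      (hasDerivAt_id x).mul (hp.hasDerivAt x)
    have hc : Continuous fun x => 1 * p x + x * p' x :=
      (continuous_const.mul hp.continuous).add (continuous_id.mul hp.continuous_deriv)
    have e := intervalIntegral.integral_eq_sub_of_hasDerivAt (a := 0) (b := y)
      (fun x _ => hd x) (hc.intervalIntegrable _ _)
    have h2 : ∫ x in (0 : ℝ)..y, (1 * p x + x * p' x) ≤ ∫ x in (0 : ℝ)..y, (Λ + 1) * p x :=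
      intervalIntegral.integral_mono_on h.le (hc.intervalIntegrable _ _)
        ((continuous_const.mul hp.continuous).intervalIntegrable _ _) fun x _ => by
          have := hp.upper x
          linarith
    rw [intervalIntegral.integral_const_mul] at h2
    simp only [zero_mul, sub_zero] at e
    linarith

end IsWeight

/-- The function `G(y)^e * y^m` on `(0,∞)`, extended by zero. -/
noncomputable def powerWeight (g : ℝ → ℝ) (e m : ℝ) (y : ℝ) : ℝ :=
  if 0 < y then primitiveG g y ^ e * y ^ m else 0

/-- The derivative of `powerWeight`. -/
noncomputable def powerWeightDeriv (g : ℝ → ℝ) (e m : ℝ) (y : ℝ) : ℝ :=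
  if 0 < y then primitiveG g y ^ e * y ^ (m - 1) * (m + e * (y * g y / primitiveG g y)) else 0

section PowerWeight

variable {g0 g1 e m : ℝ} {g : ℝ → ℝ}

lemma powerWeight_nonneg (hg : IsStructureFunction g0 g1 g) (y : ℝ) : 0 ≤ powerWeight g e m y := by
  unfold powerWeight
  split_ifs with h
  · exact mul_nonneg (Real.rpow_nonneg (hg.primitiveG_nonneg h.le) _) (Real.rpow_nonneg h.le _)
  · exact le_rfl

lemma powerWeight_of_nonpos {y : ℝ} (hy : y ≤ 0) : powerWeight g e m y = 0 := by
  simp [powerWeight, not_lt.mpr hy]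

lemma powerWeight_le (hg : IsStructureFunction g0 g1 g) (h1 : 0 < g1) (he : e ≤ 0) {y M : ℝ}
    (hy : 0 < y) (hM : y ≤ M) :
    powerWeight g e m y ≤ (primitiveG g M * M ^ (-g1)) ^ e * y ^ (m + e * g1) := by
  have hM0 : 0 < M := hy.trans_le hM
  have hb := hg.mul_rpow_le_primitiveG hy hM
  have hc : 0 < primitiveG g M * M ^ (-g1) :=
    mul_pos (hg.primitiveG_pos h1 hM0) (Real.rpow_pos_of_pos hM0 _)
  have hy1 : 0 < y ^ g1 := Real.rpow_pos_of_pos hy _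
  have h2 : primitiveG g y ^ e ≤ (primitiveG g M * M ^ (-g1) * y ^ g1) ^ e :=
    Real.rpow_le_rpow_of_nonpos (mul_pos hc hy1) hb he
  rw [powerWeight, if_pos hy]
  calc primitiveG g y ^ e * y ^ m ≤ (primitiveG g M * M ^ (-g1) * y ^ g1) ^ e * y ^ m :=
        mul_le_mul_of_nonneg_right h2 (Real.rpow_nonneg hy.le _)
    _ = (primitiveG g M * M ^ (-g1)) ^ e * y ^ (m + e * g1) := by
        rw [Real.mul_rpow hc.le hy1.le, ← Real.rpow_mul hy.le, mul_assoc, ← Real.rpow_add hy]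
        ring_nf

lemma hasDerivAt_powerWeight_of_pos (hg : IsStructureFunction g0 g1 g) (h1 : 0 < g1) {y : ℝ}
    (hy : 0 < y) : HasDerivAt (powerWeight g e m) (powerWeightDeriv g e m y) y := by
  have hG := hg.primitiveG_pos h1 hy
  have h := ((hg.hasDerivAt_primitiveG hy).rpow_const (p := e) (Or.inl hG.ne')).mul
    (Real.hasDerivAt_rpow_const (p := m) (Or.inl hy.ne'))
  have e1 : powerWeightDeriv g e m y = g y * e * primitiveG g y ^ (e - 1) * y ^ m
      + primitiveG g y ^ e * (m * y ^ (m - 1)) := by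
    rw [powerWeightDeriv, if_pos hy, Real.rpow_sub_one hG.ne', Real.rpow_sub_one hy.ne']
    field_simp
    ring
  rw [e1]
  refine h.congr_of_eventuallyEq ?_
  filter_upwards [Ioi_mem_nhds hy] with x hx
  simp [powerWeight, mem_Ioi.mp hx]

lemma powerWeight_le_mul_deriv (hg : IsStructureFunction g0 g1 g) (h1 : 0 < g1) (he : e ≤ 0)
    (hm : 1 ≤ m + e * g1) (y : ℝ) :
    powerWeight g e m y ≤ y * powerWeightDeriv g e m y := by
  rcases le_or_gt y 0 with h | h
  · simp [powerWeight, powerWeightDeriv, not_lt.mpr h]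
  · have hG := hg.primitiveG_pos h1 h
    have hu : y * g y / primitiveG g y ≤ g1 := by
      rw [div_le_iff₀ hG]; exact hg.upper y h
    rw [powerWeight, powerWeightDeriv, if_pos h, if_pos h, Real.rpow_sub_one h.ne']
    have hp : 0 ≤ primitiveG g y ^ e * y ^ m :=
      mul_nonneg (Real.rpow_nonneg hG.le _) (Real.rpow_nonneg h.le _)
    calc primitiveG g y ^ e * y ^ m = primitiveG g y ^ e * y ^ m * 1 := (mul_one _).symm
      _ ≤ primitiveG g y ^ e * y ^ m * (m + e * (y * g y / primitiveG g y)) :=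
          mul_le_mul_of_nonneg_left (by nlinarith) hp
      _ = _ := by field_simp

lemma mul_powerWeightDeriv_le (hg : IsStructureFunction g0 g1 g) (h1 : 0 < g1) (he : e ≤ 0)
    (y : ℝ) : y * powerWeightDeriv g e m y ≤ m * powerWeight g e m y := by
  rcases le_or_gt y 0 with h | h
  · simp [powerWeight, powerWeightDeriv, not_lt.mpr h]
  · have hG := hg.primitiveG_pos h1 h
    have hu : 0 ≤ y * g y / primitiveG g y :=
      div_nonneg (mul_nonneg h.le (hg.nonneg y h.le)) hG.le
    rw [powerWeight, powerWeightDeriv, if_pos h, if_pos h, Real.rpow_sub_one h.ne']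
    have hp : 0 ≤ primitiveG g y ^ e * y ^ m :=
      mul_nonneg (Real.rpow_nonneg hG.le _) (Real.rpow_nonneg h.le _)
    calc y * (primitiveG g y ^ e * (y ^ m / y) * (m + e * (y * g y / primitiveG g y)))
        = primitiveG g y ^ e * y ^ m * (m + e * (y * g y / primitiveG g y)) := by field_simp
      _ ≤ primitiveG g y ^ e * y ^ m * m :=
          mul_le_mul_of_nonneg_left (by nlinarith) hp
      _ = _ := by ring

/-- If `m + e * g1 > 1`, then `G(y)^e * y^m` is an admissible weight. -/
lemma isWeight_powerWeight (hg : IsStructureFunction g0 g1 g) (h1 : 0 < g1) (he : e ≤ 0)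
    (hm : 1 < m + e * g1) {Λ : ℝ} (hΛ : m ≤ Λ) :
    IsWeight Λ (powerWeight g e m) (powerWeightDeriv g e m) := by
  set C := (primitiveG g 1 * 1 ^ (-g1)) ^ e with hC
  have hC0 : 0 ≤ C := Real.rpow_nonneg (by
    simpa using hg.primitiveG_nonneg zero_le_one) _
  set d := m + e * g1 - 1 with hd
  have hd0 : 0 < d := by linarith
  have hm0 : 0 ≤ m := by nlinarith
  have hb : ∀ y, |y| ≤ 1 → powerWeight g e m y ≤ C * |y| ^ (1 + d) := by
    intro y hy
    rcases le_or_gt y 0 with h | h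
    · rw [powerWeight_of_nonpos h]; positivity
    · rw [abs_of_pos h] at hy ⊢
      have := powerWeight_le (m := m) hg h1 he h hy
      rwa [show 1 + d = m + e * g1 by rw [hd]; ring]
  have hdn : ∀ y, 0 ≤ powerWeightDeriv g e m y := by
    intro y
    rcases le_or_gt y 0 with h | h
    · simp [powerWeightDeriv, not_lt.mpr h]
    · exact nonneg_of_mul_nonneg_right
        ((powerWeight_nonneg hg y).trans (powerWeight_le_mul_deriv hg h1 he hm.le y)) h
  have hdb : ∀ y, |y| ≤ 1 → powerWeightDeriv g e m y ≤ m * C * |y| ^ d := by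
    intro y hy
    rcases le_or_gt y 0 with h | h
    · simp only [powerWeightDeriv, not_lt.mpr h, if_false]; positivity
    · have h2 := mul_powerWeightDeriv_le (m := m) hg h1 he y
      have h3 := hb y hy
      rw [abs_of_pos h] at hy h3 ⊢
      rw [Real.rpow_add h, Real.rpow_one] at h3
      refine le_of_mul_le_mul_left ?_ h
      nlinarith
  have hderiv : ∀ y, HasDerivAt (powerWeight g e m) (powerWeightDeriv g e m y) y := by
    intro y
    rcases lt_trichotomy y 0 with h | h | h
    · have : powerWeightDeriv g e m y = 0 := by simp [powerWeightDeriv, not_lt.mpr h.le]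
      rw [this]
      refine (hasDerivAt_const y (0 : ℝ)).congr_of_eventuallyEq ?_
      filter_upwards [Iio_mem_nhds h] with x hx
      exact powerWeight_of_nonpos (le_of_lt hx)
    · subst h
      have : powerWeightDeriv g e m 0 = 0 := by simp [powerWeightDeriv]
      rw [this, hasDerivAt_iff_isLittleO]
      simp only [sub_zero, smul_zero, powerWeight_of_nonpos (le_refl (0 : ℝ))]
      rw [Asymptotics.isLittleO_iff]
      intro c hc
      have ht : Tendsto (fun y : ℝ => C * |y| ^ d) (𝓝 0) (𝓝 0) := by
        have : Continuous fun y : ℝ => C * |y| ^ d :=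
          continuous_const.mul (continuous_abs.rpow_const fun _ => Or.inr hd0.le)
        simpa [Real.zero_rpow hd0.ne'] using this.tendsto 0
      filter_upwards [ht.eventually (Iic_mem_nhds hc),
        Metric.closedBall_mem_nhds (0 : ℝ) one_pos] with y hy1 hy2
      have hy2' : |y| ≤ 1 := by simpa using hy2
      rw [Real.norm_of_nonneg (powerWeight_nonneg hg y), Real.norm_eq_abs]
      rcases eq_or_ne y 0 with rfl | hne
      · simp [powerWeight]
      refine (hb y hy2').trans ?_
      rw [Real.rpow_add (abs_pos.mpr hne), Real.rpow_one]
      have : C * |y| ^ d ≤ c := hy1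
      nlinarith [abs_nonneg y]
    · exact hasDerivAt_powerWeight_of_pos hg h1 h
  refine ⟨hderiv, ?_, fun y hy => powerWeight_of_nonpos hy, fun y hy => ?_,
    powerWeight_nonneg hg, powerWeight_le_mul_deriv hg h1 he hm.le, fun y => ?_⟩
  · rw [continuous_iff_continuousAt]
    intro y
    rcases lt_trichotomy y 0 with h | h | h
    · refine (continuousAt_const (y := (0 : ℝ))).congr ?_
      filter_upwards [Iio_mem_nhds h] with x hx
      simp [powerWeightDeriv, not_lt.mpr (mem_Iio.mp hx).le]
    · subst h
      have h0 : powerWeightDeriv g e m 0 = 0 := by simp [powerWeightDeriv]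
      rw [ContinuousAt, h0]
      have ht : Tendsto (fun y : ℝ => m * C * |y| ^ d) (𝓝 0) (𝓝 0) := by
        have : Continuous fun y : ℝ => m * C * |y| ^ d :=
          continuous_const.mul (continuous_abs.rpow_const fun _ => Or.inr hd0.le)
        simpa [Real.zero_rpow hd0.ne'] using this.tendsto 0
      refine tendsto_of_tendsto_of_tendsto_of_le_of_le' tendsto_const_nhds ht
        (Eventually.of_forall hdn) ?_
      filter_upwards [Metric.closedBall_mem_nhds (0 : ℝ) one_pos] with y hy
      exact hdb y (by simpa using hy)
    · have hG := hg.primitiveG_pos h1 h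
      have hGc := (hg.hasDerivAt_primitiveG h).continuousAt
      have hgc : ContinuousAt g y := hg.continuousOn.continuousAt (Ici_mem_nhds h)
      have : ContinuousAt (fun y => primitiveG g y ^ e * y ^ (m - 1) *
          (m + e * (y * g y / primitiveG g y))) y :=
        ((hGc.rpow_const (Or.inl hG.ne')).mul
          (continuousAt_id.rpow_const (Or.inl h.ne'))).mul
          (continuousAt_const.add (continuousAt_const.mul
            ((continuousAt_id.mul hgc).div hGc hG.ne')))
      refine this.congr ?_
      filter_upwards [Ioi_mem_nhds h] with x hx
      simp [powerWeightDeriv, mem_Ioi.mp hx]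
  · simp [powerWeightDeriv, not_lt.mpr hy]
  · refine (mul_powerWeightDeriv_le hg h1 he y).trans ?_
    exact mul_le_mul_of_nonneg_right hΛ (powerWeight_nonneg hg y)

end PowerWeight

instance instIsAddHaarMeasureVolumeProdReal (N : ℕ) :
    (volume : Measure (EuclideanSpace ℝ (Fin N) × ℝ)).IsAddHaarMeasure :=
  inferInstanceAs
    ((volume : Measure (EuclideanSpace ℝ (Fin N))).prod (volume : Measure ℝ)).IsAddHaarMeasure

/-- Dominated convergence with a varying dominating function. -/
lemma tendsto_integral_of_dominated_of_tendsto {α : Type*} [MeasurableSpace α] {μ : Measure α}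
    {F w : ℕ → α → ℝ} {f w0 : α → ℝ} (hF : ∀ n, AEStronglyMeasurable (F n) μ)
    (hw : ∀ n, Integrable (w n) μ) (hw0 : Integrable w0 μ)
    (hbound : ∀ n, ∀ᵐ x ∂μ, |F n x| ≤ w n x)
    (hlimF : ∀ᵐ x ∂μ, Tendsto (fun n => F n x) atTop (𝓝 (f x)))
    (hlimw : ∀ᵐ x ∂μ, Tendsto (fun n => w n x) atTop (𝓝 (w0 x)))
    (hlim : Tendsto (fun n => ∫ x, w n x ∂μ) atTop (𝓝 (∫ x, w0 x ∂μ))) :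
    Tendsto (fun n => ∫ x, F n x ∂μ) atTop (𝓝 (∫ x, f x ∂μ)) := by
  have hw0n : ∀ᵐ x ∂μ, 0 ≤ w0 x := by
    filter_upwards [hlimw, ae_all_iff.mpr hbound] with x h1 h2
    exact ge_of_tendsto' h1 fun n => (abs_nonneg _).trans (h2 n)
  have hfb : ∀ᵐ x ∂μ, |f x| ≤ w0 x := by
    filter_upwards [hlimw, hlimF, ae_all_iff.mpr hbound] with x h1 h2 h3
    exact le_of_tendsto_of_tendsto' h2.abs h1 h3
  have hlow : Tendsto (fun n => ∫ x, min (w n x) (w0 x) ∂μ) atTop (𝓝 (∫ x, w0 x ∂μ)) := by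
    refine tendsto_integral_of_dominated_convergence w0
      (fun n => ((hw n).aestronglyMeasurable.inf hw0.aestronglyMeasurable)) hw0 (fun n => ?_) ?_
    · filter_upwards [hw0n, hbound n] with x h1 h2
      have h3 := (abs_nonneg _).trans h2
      rw [Real.norm_of_nonneg (le_min h3 h1)]
      exact min_le_right _ _
    · filter_upwards [hlimw] with x h1
      simpa using h1.min (tendsto_const_nhds (x := w0 x))
  have hexc : Tendsto (fun n => ∫ x, (w n x - min (w n x) (w0 x)) ∂μ) atTop (𝓝 0) := by
    have hmi : ∀ n, Integrable (fun x => min (w n x) (w0 x)) μ := fun n => (hw n).inf hw0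
    have e : ∀ n, ∫ x, (w n x - min (w n x) (w0 x)) ∂μ
        = ∫ x, w n x ∂μ - ∫ x, min (w n x) (w0 x) ∂μ := fun n => integral_sub (hw n) (hmi n)
    simp_rw [e]
    simpa using hlim.sub hlow
  have hcl : Tendsto (fun n => ∫ x, max (-w0 x) (min (F n x) (w0 x)) ∂μ) atTop
      (𝓝 (∫ x, f x ∂μ)) := by
    refine tendsto_integral_of_dominated_convergence w0
      (fun n => (hw0.aestronglyMeasurable.neg.sup ((hF n).inf hw0.aestronglyMeasurable)))
      hw0 (fun n => ?_) ?_
    · filter_upwards [hw0n] with x h1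
      rw [Real.norm_eq_abs, abs_le]
      exact ⟨le_max_left _ _, max_le (by linarith) (min_le_right _ _)⟩
    · filter_upwards [hlimF, hfb] with x h1 h2
      have h3 := (tendsto_const_nhds (x := -w0 x)).max (h1.min (tendsto_const_nhds (x := w0 x)))
      rw [abs_le] at h2
      rwa [min_eq_left h2.2, max_eq_right h2.1] at h3
  have hFi : ∀ n, Integrable (F n) μ := fun n => (hw n).mono' (hF n) (hbound n)
  have hdiff : Tendsto (fun n => ∫ x, F n x ∂μ - ∫ x, max (-w0 x) (min (F n x) (w0 x)) ∂μ)
      atTop (𝓝 0) := by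
    refine squeeze_zero_norm (fun n => ?_) hexc
    have hci : Integrable (fun x => max (-w0 x) (min (F n x) (w0 x))) μ :=
      hw0.neg.sup ((hFi n).inf hw0)
    rw [← integral_sub (hFi n) hci]
    refine norm_integral_le_of_norm_le ((hw n).sub ((hw n).inf hw0)) ?_
    filter_upwards [hw0n, hbound n] with x h1 h2
    rw [Real.norm_eq_abs]
    rw [abs_le] at h2 ⊢
    rcases le_total (w n x) (w0 x) with h | h
    · rw [min_eq_left (h2.2.trans h), max_eq_right (by linarith), min_eq_left h]
      simp
    · rw [min_eq_right h]
      rcases le_total (F n x) (w0 x) with h3 | h3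
      · rw [min_eq_left h3]
        rcases le_total (-w0 x) (F n x) with h4 | h4
        · rw [max_eq_right h4]; constructor <;> linarith
        · rw [max_eq_left h4]; constructor <;> linarith
      · rw [min_eq_right h3, max_eq_right (by linarith)]; constructor <;> linarith
  simpa using hdiff.add hcl

section Mollify

variable {X : Type*} [NormedAddCommGroup X] [NormedSpace ℝ X] [FiniteDimensional ℝ X]
  [MeasureSpace X] [BorelSpace X] [(volume : Measure X).IsAddHaarMeasure]
  {F : Type*} [NormedAddCommGroup F] [NormedSpace ℝ F]

/-- Mollification of `f` by a normalized bump function. -/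
noncomputable def mollify (φ : ContDiffBump (0 : X)) (f : X → F) (p : X) : F :=
  ∫ y, φ.normed volume (p - y) • f y

/-- A sequence of bump functions whose supports shrink to the origin. -/
noncomputable def shrinkingBump (X : Type*) [NormedAddCommGroup X] (n : ℕ) :
    ContDiffBump (0 : X) where
  rIn := 1 / ((n : ℝ) + 1)
  rOut := 2 / ((n : ℝ) + 1)
  rIn_pos := by positivity
  rIn_lt_rOut := by gcongr; norm_num

lemma tendsto_rOut_shrinkingBump :
    Tendsto (fun n => (shrinkingBump X n).rOut) atTop (𝓝 0) := by
  have := (tendsto_one_div_add_atTop_nhds_zero_nat (𝕜 := ℝ)).const_mul 2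
  simpa [shrinkingBump, div_eq_mul_inv] using this

lemma mollify_eq_convolution (φ : ContDiffBump (0 : X)) (f : X → F) :
    mollify φ f = convolution (φ.normed volume) f (ContinuousLinearMap.lsmul ℝ ℝ) volume := by
  funext p
  rw [convolution_lsmul_swap]
  rfl

lemma ae_tendsto_mollify [CompleteSpace F] {f : X → F} (hf : LocallyIntegrable f volume) :
    ∀ᵐ p, Tendsto (fun n => mollify (shrinkingBump X n) f p) atTop (𝓝 (f p)) := by
  simp_rw [mollify_eq_convolution]
  refine ContDiffBump.ae_convolution_tendsto_right_of_locallyIntegrable (K := 2)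
    tendsto_rOut_shrinkingBump (Eventually.of_forall fun n => ?_) hf
  simp only [shrinkingBump]
  apply le_of_eq; ring

lemma contDiff_mollify (φ : ContDiffBump (0 : X)) {f : X → F} (hf : LocallyIntegrable f volume)
    (n : ℕ∞) : ContDiff ℝ n (mollify φ f) := by
  rw [mollify_eq_convolution]
  exact φ.hasCompactSupport_normed.contDiff_convolution_left _ φ.contDiff_normed hf

lemma hasCompactSupport_mollify (φ : ContDiffBump (0 : X)) {f : X → F}
    (hf : HasCompactSupport f) : HasCompactSupport (mollify φ f) := by
  rw [mollify_eq_convolution]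
  exact φ.hasCompactSupport_normed.convolution _ hf

lemma continuous_normed_sub (φ : ContDiffBump (0 : X)) (p : X) :
    Continuous fun y => φ.normed volume (p - y) :=
  φ.continuous_normed.comp (continuous_const.sub continuous_id)

lemma hasCompactSupport_normed_sub (φ : ContDiffBump (0 : X)) (p : X) :
    HasCompactSupport fun y => φ.normed volume (p - y) :=
  φ.hasCompactSupport_normed.comp_homeomorph (Homeomorph.subLeft p)

lemma integrable_normed_sub_smul (φ : ContDiffBump (0 : X)) {f : X → F}
    (hf : LocallyIntegrable f volume) (p : X) :
    Integrable fun y => φ.normed volume (p - y) • f y :=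
  hf.integrable_smul_left_of_hasCompactSupport (continuous_normed_sub φ p)
    (hasCompactSupport_normed_sub φ p)

lemma integral_normed_sub (φ : ContDiffBump (0 : X)) (p : X) :
    ∫ y, φ.normed volume (p - y) = 1 := by
  rw [integral_sub_left_eq_self (fun y => φ.normed volume y) volume p]
  exact φ.integral_normed

lemma fderiv_mollify (φ : ContDiffBump (0 : X)) {f : X → ℝ} (hf : LocallyIntegrable f volume)
    (p v : X) :
    fderiv ℝ (mollify φ f) p v = ∫ y, fderiv ℝ (φ.normed volume) (p - y) v * f y := by
  have hc : ContDiff ℝ 1 (φ.normed volume) := φ.contDiff_normed (n := 1)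
  rw [mollify_eq_convolution, (φ.hasCompactSupport_normed.hasFDerivAt_convolution_left
    (ContinuousLinearMap.lsmul ℝ ℝ) hc hf p).fderiv, convolution_eq_swap,
    ContinuousLinearMap.integral_apply]
  · simp
  · have h := (φ.hasCompactSupport_normed.fderiv ℝ).convolutionExists_left
      ((ContinuousLinearMap.lsmul ℝ ℝ).precompL X) (hc.continuous_fderiv one_ne_zero) hf p
    exact h.integrable_swap

lemma norm_mollify_le (φ : ContDiffBump (0 : X)) (f : X → F) (p : X) :
    ‖mollify φ f p‖ ≤ mollify φ (fun y => ‖f y‖) p := by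
  refine (norm_integral_le_integral_norm _).trans_eq ?_
  simp only [mollify, norm_smul, smul_eq_mul, Real.norm_of_nonneg (φ.nonneg_normed _)]

lemma mollify_mono (φ : ContDiffBump (0 : X)) {f₁ f₂ : X → ℝ}
    (h₁ : LocallyIntegrable f₁ volume) (h₂ : LocallyIntegrable f₂ volume)
    (h : ∀ᵐ y, f₁ y ≤ f₂ y) (p : X) : mollify φ f₁ p ≤ mollify φ f₂ p := by
  refine integral_mono_ae (integrable_normed_sub_smul φ h₁ p) (integrable_normed_sub_smul φ h₂ p) ?_
  filter_upwards [h] with y hy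
  exact mul_le_mul_of_nonneg_left hy (φ.nonneg_normed _)

lemma mollify_const (φ : ContDiffBump (0 : X)) (c : ℝ) (p : X) :
    mollify φ (fun _ => c) p = c := by
  simp only [mollify, smul_eq_mul]
  rw [integral_mul_const, integral_normed_sub, one_mul]

lemma norm_mollify_le_of_bound (φ : ContDiffBump (0 : X)) {f : X → F} {M : ℝ}
    (hf : LocallyIntegrable f volume) (hM : ∀ y, ‖f y‖ ≤ M) (p : X) : ‖mollify φ f p‖ ≤ M := by
  refine (norm_mollify_le φ f p).trans ((mollify_mono φ (fun x => (hf x).norm)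
    (locallyIntegrable_const M) (Eventually.of_forall hM) p).trans_eq (mollify_const φ M p))

lemma integrable_mollify (φ : ContDiffBump (0 : X)) {f : X → F} (hf : Integrable f) :
    Integrable (mollify φ f) := by
  rw [mollify_eq_convolution]
  exact Integrable.integrable_convolution _
    (φ.continuous_normed.integrable_of_hasCompactSupport φ.hasCompactSupport_normed) hf

lemma integral_mollify (φ : ContDiffBump (0 : X)) {f : X → ℝ} (hf : Integrable f) :
    ∫ p, mollify φ f p = ∫ p, f p := by
  rw [mollify_eq_convolution, integral_convolution _
    (φ.continuous_normed.integrable_of_hasCompactSupport φ.hasCompactSupport_normed) hf,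
    φ.integral_normed]
  simp

/-- A bound for the product of two mollifications from a bound for the products of values. -/
lemma mollify_mul_mollify_le (φ : ContDiffBump (0 : X)) {A B W : X → ℝ}
    (hA : LocallyIntegrable A volume) (hB : LocallyIntegrable B volume)
    (hW : LocallyIntegrable W volume)
    (h : ∀ᵐ y, ∀ᵐ z, A y * B z ≤ W y + W z) (p : X) :
    mollify φ A p * mollify φ B p ≤ 2 * mollify φ W p := by
  have h1 : ∀ᵐ y, A y * mollify φ B p ≤ W y + mollify φ W p := by
    filter_upwards [h] with y hy
    have e1 : A y * mollify φ B p = mollify φ (fun z => A y * B z) p := by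
      simp only [mollify, smul_eq_mul]
      rw [← integral_const_mul]
      congr 1; funext z; ring
    have e2 : W y + mollify φ W p = mollify φ (fun z => W y + W z) p := by
      have := mollify_const φ (W y) p
      rw [← this]
      simp only [mollify, smul_eq_mul, mul_add] at this ⊢
      rw [this, integral_add]
      · rw [this]
      · exact integrable_normed_sub_smul φ (locallyIntegrable_const (W y)) p
      · exact integrable_normed_sub_smul φ hW p
    rw [e1, e2]
    exact mollify_mono φ (hB.smul (A y)) ((locallyIntegrable_const (W y)).add hW) hy p
  have e1 : mollify φ A p * mollify φ B p = mollify φ (fun y => A y * mollify φ B p) p := by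
    simp only [mollify, smul_eq_mul]
    rw [← integral_mul_const]
    congr 1; funext z; ring
  have e2 : 2 * mollify φ W p = mollify φ (fun y => W y + mollify φ W p) p := by
    have := mollify_const φ (mollify φ W p) p
    rw [two_mul]
    nth_rewrite 2 [← this]
    simp only [mollify, smul_eq_mul, mul_add]
    rw [integral_add]
    · exact integrable_normed_sub_smul φ hW p
    · exact integrable_normed_sub_smul φ (locallyIntegrable_const _) p
  rw [e1, e2]
  refine mollify_mono φ ?_ (hW.add (locallyIntegrable_const _)) h1 p
  exact (hA.smul (mollify φ B p)).congr (Eventually.of_forall fun y => mul_comm _ _)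

end Mollify

/-- A `C¹` function `H z w` whose derivative `h = ∂H/∂w` is again `C¹`, vanishing to first order at
`z = 0`; `Hz`, `hz`, `hw` are the remaining partial derivatives. -/
structure IsEnergyIntegrand (H h Hz hz hw : ℝ → ℝ → ℝ) : Prop where
  hasFDerivAt_H : ∀ z w, HasFDerivAt (fun q : ℝ × ℝ => H q.1 q.2)
    (Hz z w • ContinuousLinearMap.fst ℝ ℝ ℝ + h z w • ContinuousLinearMap.snd ℝ ℝ ℝ) (z, w)
  hasFDerivAt_h : ∀ z w, HasFDerivAt (fun q : ℝ × ℝ => h q.1 q.2)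
    (hz z w • ContinuousLinearMap.fst ℝ ℝ ℝ + hw z w • ContinuousLinearMap.snd ℝ ℝ ℝ) (z, w)
  continuous_Hz : Continuous fun q : ℝ × ℝ => Hz q.1 q.2
  continuous_hz : Continuous fun q : ℝ × ℝ => hz q.1 q.2
  continuous_hw : Continuous fun q : ℝ × ℝ => hw q.1 q.2
  H_zero : ∀ w, H 0 w = 0
  h_zero : ∀ w, h 0 w = 0
  Hz_zero : ∀ w, Hz 0 w = 0
  hz_zero : ∀ w, hz 0 w = 0
  hw_zero : ∀ w, hw 0 w = 0

lemma contDiff_one_of_hasFDerivAt_pair {f fz fw : ℝ → ℝ → ℝ}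
    (hf : ∀ z w, HasFDerivAt (fun q : ℝ × ℝ => f q.1 q.2)
      (fz z w • ContinuousLinearMap.fst ℝ ℝ ℝ + fw z w • ContinuousLinearMap.snd ℝ ℝ ℝ) (z, w))
    (hz : Continuous fun q : ℝ × ℝ => fz q.1 q.2) (hw : Continuous fun q : ℝ × ℝ => fw q.1 q.2) :
    ContDiff ℝ 1 fun q : ℝ × ℝ => f q.1 q.2 :=
  contDiff_one_iff_hasFDerivAt.mpr ⟨fun q => fz q.1 q.2 • ContinuousLinearMap.fst ℝ ℝ ℝ
    + fw q.1 q.2 • ContinuousLinearMap.snd ℝ ℝ ℝ,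
    (hz.smul continuous_const).add (hw.smul continuous_const), fun q => hf q.1 q.2⟩

namespace IsEnergyIntegrand

variable {H h Hz hz hw : ℝ → ℝ → ℝ}

lemma contDiff_h (hH : IsEnergyIntegrand H h Hz hz hw) :
    ContDiff ℝ 1 fun q : ℝ × ℝ => h q.1 q.2 :=
  contDiff_one_of_hasFDerivAt_pair hH.hasFDerivAt_h hH.continuous_hz hH.continuous_hw

lemma continuous_h (hH : IsEnergyIntegrand H h Hz hz hw) :
    Continuous fun q : ℝ × ℝ => h q.1 q.2 := hH.contDiff_h.continuous

lemma contDiff_H (hH : IsEnergyIntegrand H h Hz hz hw) :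
    ContDiff ℝ 1 fun q : ℝ × ℝ => H q.1 q.2 :=
  contDiff_one_of_hasFDerivAt_pair hH.hasFDerivAt_H hH.continuous_Hz hH.continuous_h

lemma continuous_H (hH : IsEnergyIntegrand H h Hz hz hw) :
    Continuous fun q : ℝ × ℝ => H q.1 q.2 := hH.contDiff_H.continuous

end IsEnergyIntegrand

lemma exists_lipschitzWith_comp {X Y : Type*} [NormedAddCommGroup X]
    [NormedAddCommGroup Y] [NormedSpace ℝ Y] [FiniteDimensional ℝ Y]
    {Φ : Y → ℝ} (hΦ : ContDiff ℝ 1 Φ) {f : X → Y} {C : NNReal} (hf : LipschitzWith C f) {M : ℝ}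
    (hM : ∀ x, ‖f x‖ ≤ M) : ∃ C', LipschitzWith C' (Φ ∘ f) := by
  obtain ⟨K, hK⟩ := hΦ.contDiffOn.exists_lipschitzOnWith (s := Metric.closedBall (0 : Y) M)
    one_ne_zero (convex_closedBall 0 M) (isCompact_closedBall 0 M)
  refine ⟨K * C, ?_⟩
  rw [← lipschitzOnWith_univ]
  exact hK.comp (lipschitzOnWith_univ.mpr hf) fun x _ => by simpa using hM x

lemma integrable_lineDeriv_of_hasCompactSupport {X : Type*} [NormedAddCommGroup X]
    [NormedSpace ℝ X] [FiniteDimensional ℝ X] [MeasurableSpace X] [BorelSpace X] {μ : Measure X}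
    [μ.IsAddHaarMeasure] {f : X → ℝ} {C : NNReal} (hf : LipschitzWith C f)
    (hc : HasCompactSupport f) (v : X) : Integrable (fun x => lineDeriv ℝ f x v) μ := by
  have h := (hf.locallyIntegrable_lineDeriv (μ := μ) v).integrableOn_isCompact hc
  rw [integrableOn_iff_integrable_of_support_subset] at h
  · exact h
  · intro x hx
    by_contra hxt
    apply hx
    have h0 : f =ᶠ[𝓝 x] fun _ => 0 := notMem_tsupport_iff_eventuallyEq.mp hxt
    change lineDeriv ℝ f x v = 0
    rw [h0.lineDeriv_eq]
    simp [lineDeriv]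

lemma integral_lineDeriv_eq_zero {X : Type*} [NormedAddCommGroup X]
    [NormedSpace ℝ X] [FiniteDimensional ℝ X] [MeasurableSpace X] [BorelSpace X] {μ : Measure X}
    [μ.IsAddHaarMeasure] {f : X → ℝ} {C : NNReal} (hf : LipschitzWith C f)
    (hc : HasCompactSupport f) (v : X) : ∫ x, lineDeriv ℝ f x v ∂μ = 0 := by
  have h := (LipschitzWith.const (α := X) (1 : ℝ)).integral_lineDeriv_mul_eq (μ := μ) hf hc (-v)
  simp only [neg_neg, mul_one] at h
  rw [← h]
  simp [lineDeriv]

section SmoothIdentity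

variable {N : ℕ}

lemma lineDeriv_comp_mul_time {f fz fw : ℝ → ℝ → ℝ}
    (hf : ∀ z w, HasFDerivAt (fun q : ℝ × ℝ => f q.1 q.2)
      (fz z w • ContinuousLinearMap.fst ℝ ℝ ℝ + fw z w • ContinuousLinearMap.snd ℝ ℝ ℝ) (z, w))
    {ζ U : EuclideanSpace ℝ (Fin N) × ℝ → ℝ} {χ χ' : ℝ → ℝ} (hχ : ∀ t, HasDerivAt χ (χ' t) t)
    {p : EuclideanSpace ℝ (Fin N) × ℝ}
    (hζ : DifferentiableAt ℝ ζ p) (hU : DifferentiableAt ℝ U p) (v : EuclideanSpace ℝ (Fin N) × ℝ) :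
    lineDeriv ℝ (fun p => f (ζ p) (U p) * χ p.2) p v =
      (fz (ζ p) (U p) * fderiv ℝ ζ p v + fw (ζ p) (U p) * fderiv ℝ U p v) * χ p.2
        + f (ζ p) (U p) * (χ' p.2 * v.2) := by
  have h1 : HasFDerivAt (fun p => f (ζ p) (U p))
      ((fz (ζ p) (U p) • ContinuousLinearMap.fst ℝ ℝ ℝ
        + fw (ζ p) (U p) • ContinuousLinearMap.snd ℝ ℝ ℝ).comp
          ((fderiv ℝ ζ p).prod (fderiv ℝ U p))) p :=
    HasFDerivAt.comp (f := fun p => (ζ p, U p)) (g := fun q : ℝ × ℝ => f q.1 q.2) p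
      (hf (ζ p) (U p)) (hζ.hasFDerivAt.prodMk hU.hasFDerivAt)
  have h2 : HasFDerivAt (fun p : EuclideanSpace ℝ (Fin N) × ℝ => χ p.2)
      (χ' p.2 • ContinuousLinearMap.snd ℝ (EuclideanSpace ℝ (Fin N)) ℝ) p :=
    (hχ p.2).comp_hasFDerivAt p hasFDerivAt_snd
  refine ((h1.mul h2).hasLineDerivAt v).lineDeriv.trans ?_
  simp
  ring

lemma exists_lipschitzWith_comp_mul_time {f : ℝ → ℝ → ℝ}
    (hf : ContDiff ℝ 1 fun q : ℝ × ℝ => f q.1 q.2)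
    {ζ U : EuclideanSpace ℝ (Fin N) × ℝ → ℝ} {χ : ℝ → ℝ} {Cζ CU Cχ : NNReal}
    (hζ : LipschitzWith Cζ ζ)
    (hU : LipschitzWith CU U) (hχ : LipschitzWith Cχ χ) {M : ℝ} (hζM : ∀ p, |ζ p| ≤ M)
    (hUM : ∀ p, |U p| ≤ M) (hχM : ∀ t, |χ t| ≤ M) :
    ∃ C, LipschitzWith C fun p : EuclideanSpace ℝ (Fin N) × ℝ => f (ζ p) (U p) * χ p.2 := by
  have hΦ : ContDiff ℝ 1 fun q : (ℝ × ℝ) × ℝ => f q.1.1 q.1.2 * q.2 :=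
    (hf.comp contDiff_fst).mul contDiff_snd
  have hl := (hζ.prodMk hU).prodMk (hχ.comp (LipschitzWith.prod_snd (α := EuclideanSpace ℝ (Fin N))
      (β := ℝ)))
  refine exists_lipschitzWith_comp hΦ hl (M := M) fun p => ?_
  simp only [Prod.norm_def, Real.norm_eq_abs, Function.comp]
  exact max_le (max_le (hζM p) (hUM p)) (hχM p.2)

/-- The energy identity for a smooth solution `U` of `∂U/∂t = div A` near the support of the
cutoff. -/
lemma smooth_energy_identity {H h Hz hz hw : ℝ → ℝ → ℝ} (hH : IsEnergyIntegrand H h Hz hz hw)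
    {ζ U : EuclideanSpace ℝ (Fin N) × ℝ → ℝ} {A : Fin N → EuclideanSpace ℝ (Fin N) × ℝ → ℝ}
    {χ χ' : ℝ → ℝ} {Cζ CU Cχ : NNReal}
    {CA : Fin N → NNReal} (hζ : LipschitzWith Cζ ζ) (hU : LipschitzWith CU U)
    (hχL : LipschitzWith Cχ χ) (hA : ∀ i, LipschitzWith (CA i) (A i))
    (hχ : ∀ t, HasDerivAt χ (χ' t) t) {M : ℝ} (hζM : ∀ p, |ζ p| ≤ M)
    (hUM : ∀ p, |U p| ≤ M) (hχM : ∀ t, |χ t| ≤ M)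
    (hUd : ContDiff ℝ 1 U) (hAd : ∀ i, ContDiff ℝ 1 (A i)) (hAc : ∀ i, HasCompactSupport (A i))
    {S : Set (EuclideanSpace ℝ (Fin N) × ℝ)} (hS : IsCompact S)
    (hSζ : ∀ p : EuclideanSpace ℝ (Fin N) × ℝ, ζ p ≠ 0 → χ p.2 ≠ 0 → p ∈ S)
    (heq : ∀ p ∈ S, fderiv ℝ U p (0, 1) =
      ∑ i, fderiv ℝ (A i) p (EuclideanSpace.single i 1, 0)) :
    ∫ p, (Hz (ζ p) (U p) * fderiv ℝ ζ p (0, 1) * χ p.2 + H (ζ p) (U p) * χ' p.2) =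
      ∫ p, ∑ i, A i p * ((hz (ζ p) (U p) * fderiv ℝ ζ p (EuclideanSpace.single i 1, 0)
        + hw (ζ p) (U p) * fderiv ℝ U p (EuclideanSpace.single i 1, 0)) * χ p.2) := by
  have hsupp : ∀ f : ℝ → ℝ → ℝ, (∀ w, f 0 w = 0) →
      HasCompactSupport fun p : EuclideanSpace ℝ (Fin N) × ℝ => f (ζ p) (U p) * χ p.2 := by
    intro f hf
    refine HasCompactSupport.intro hS fun p hp => ?_
    by_cases h0 : ζ p = 0
    · rw [h0, hf, zero_mul]
    · by_cases h1 : χ p.2 = 0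
      · rw [h1, mul_zero]
      · exact absurd (hSζ p h0 h1) hp
  obtain ⟨C1, hL1⟩ := exists_lipschitzWith_comp_mul_time hH.contDiff_H hζ hU hχL hζM hUM hχM
  obtain ⟨C2, hL2⟩ := exists_lipschitzWith_comp_mul_time hH.contDiff_h hζ hU hχL hζM hUM hχM
  have hc1 := hsupp H hH.H_zero
  have hc2 := hsupp h hH.h_zero
  have hζd : ∀ᵐ p, DifferentiableAt ℝ ζ p := hζ.ae_differentiableAt
  have hUdd : ∀ p, DifferentiableAt ℝ U p := hUd.differentiable one_ne_zero
  have hint1 : Integrable fun p : EuclideanSpace ℝ (Fin N) × ℝ => fderiv ℝ U p (0, 1) *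
      (h (ζ p) (U p) * χ p.2) := by
    apply Continuous.integrable_of_hasCompactSupport
    · exact ((hUd.continuous_fderiv one_ne_zero).clm_apply continuous_const).mul hL2.continuous
    · exact hc2.mul_left
  have e1 : ∫ p, (Hz (ζ p) (U p) * fderiv ℝ ζ p (0, 1) * χ p.2 + H (ζ p) (U p) * χ' p.2) =
      - ∫ p, fderiv ℝ U p (0, 1) * (h (ζ p) (U p) * χ p.2) := by
    have := integral_lineDeriv_eq_zero (μ := volume) hL1 hc1 (0, 1)
    rw [← zero_sub, ← this,
      ← integral_sub (integrable_lineDeriv_of_hasCompactSupport hL1 hc1 _) hint1]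
    apply integral_congr_ae
    filter_upwards [hζd] with p hp
    rw [lineDeriv_comp_mul_time hH.hasFDerivAt_H hχ hp (hUdd p)]
    ring
  have e2 : ∫ p, fderiv ℝ U p (0, 1) * (h (ζ p) (U p) * χ p.2) =
      ∑ i, ∫ p, fderiv ℝ (A i) p (EuclideanSpace.single i 1, 0) * (h (ζ p) (U p) * χ p.2) := by
    rw [← integral_finsetSum]
    · congr 1
      funext p
      by_cases hp : h (ζ p) (U p) * χ p.2 = 0
      · simp [hp]
      · have hpS : p ∈ S := by
          refine hSζ p (fun h0 => hp ?_) (fun h0 => hp ?_)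
          · rw [h0, hH.h_zero, zero_mul]
          · rw [h0, mul_zero]
        rw [heq p hpS, Finset.sum_mul]
    · intro i _
      apply Continuous.integrable_of_hasCompactSupport
      · exact (((hAd i).continuous_fderiv one_ne_zero).clm_apply continuous_const).mul
          hL2.continuous
      · exact hc2.mul_left
  have e3 : ∀ i, ∫ p, fderiv ℝ (A i) p (EuclideanSpace.single i 1, 0) *
      (h (ζ p) (U p) * χ p.2) = - ∫ p, A i p *
        lineDeriv ℝ (fun p : EuclideanSpace ℝ (Fin N) × ℝ => h (ζ p) (U p) * χ p.2) p
          (EuclideanSpace.single i 1, 0) := by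
    intro i
    have h1 := (hA i).integral_lineDeriv_mul_eq (μ := volume) hL2 hc2
      (EuclideanSpace.single i 1, 0)
    have h2 : ∀ p, lineDeriv ℝ (A i) p (EuclideanSpace.single i 1, 0)
        = fderiv ℝ (A i) p (EuclideanSpace.single i 1, 0) := fun p =>
      ((hAd i).differentiable one_ne_zero p).lineDeriv_eq_fderiv
    simp_rw [h2, lineDeriv_neg] at h1
    rw [h1, ← integral_neg]
    congr 1
    funext p
    ring
  rw [e1, e2, Finset.sum_congr rfl fun i _ => e3 i, Finset.sum_neg_distrib, neg_neg,
    ← integral_finsetSum]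
  · apply integral_congr_ae
    filter_upwards [hζd] with p hp
    refine Finset.sum_congr rfl fun i _ => ?_
    rw [lineDeriv_comp_mul_time hH.hasFDerivAt_h hχ hp (hUdd p)]
    simp
  · intro i _
    exact (hL2.locallyIntegrable_lineDeriv
      (μ := volume) _).integrable_smul_left_of_hasCompactSupport
      (hA i).continuous (hAc i)

end SmoothIdentity

section EnergyIdentity

variable {N : ℕ}

/-- The pair `(u, V)` with the flux `a` solves `∂u/∂t = div a`, `V = Du` on `Q`
in the sense of distributions. -/
structure IsDistributionalSolution (Q : Set (EuclideanSpace ℝ (Fin N) × ℝ))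
    (u : EuclideanSpace ℝ (Fin N) × ℝ → ℝ)
    (V a : EuclideanSpace ℝ (Fin N) × ℝ → EuclideanSpace ℝ (Fin N)) :
    Prop where
  continuousOn : ContinuousOn u Q
  integrableOn_grad : IntegrableOn V Q
  integrableOn_flux : IntegrableOn a Q
  weak_gradient : ∀ φ : EuclideanSpace ℝ (Fin N) × ℝ → ℝ, ContDiff ℝ (⊤ : ℕ∞) φ →
      HasCompactSupport φ → tsupport φ ⊆ Q →
    ∀ i : Fin N, (∫ p in Q, u p * fderiv ℝ φ p (EuclideanSpace.single i 1, 0)) =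
      -(∫ p in Q, V p i * φ p)
  weak_form : ∀ φ : EuclideanSpace ℝ (Fin N) × ℝ → ℝ, ContDiff ℝ (⊤ : ℕ∞) φ → HasCompactSupport φ →
      tsupport φ ⊆ Q →
    (∫ p in Q, u p * fderiv ℝ φ p (0, 1)) = ∫ p in Q, fderiv ℝ φ p (a p, 0)

lemma clm_apply_space_eq_sum (L : EuclideanSpace ℝ (Fin N) × ℝ →L[ℝ] ℝ)
    (b : EuclideanSpace ℝ (Fin N)) :
    L (b, 0) = ∑ i, b i * L (EuclideanSpace.single i 1, 0) := by
  have hb : b = ∑ i, b i • EuclideanSpace.single i (1 : ℝ) := by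
    simpa using ((EuclideanSpace.basisFun (Fin N) ℝ).sum_repr b).symm
  have h2 : L (b, 0) = (L.comp (ContinuousLinearMap.inl ℝ (EuclideanSpace ℝ (Fin N)) ℝ)) b := by
    simp
  rw [h2]
  conv_lhs => rw [hb]
  rw [map_sum]
  simp

lemma mollify_coord {X : Type*} [NormedAddCommGroup X] [NormedSpace ℝ X] [FiniteDimensional ℝ X]
    [MeasureSpace X] [BorelSpace X] [(volume : Measure X).IsAddHaarMeasure]
    (φ : ContDiffBump (0 : X)) {f : X → EuclideanSpace ℝ (Fin N)} (hf : LocallyIntegrable f volume)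
    (i : Fin N) (p : X) :
    (mollify φ f p) i = mollify φ (fun y => f y i) p := by
  have h := (EuclideanSpace.proj (𝕜 := ℝ) i).integral_comp_comm
    (integrable_normed_sub_smul φ hf p)
  simpa [mollify] using h.symm

lemma fderiv_normed_sub (φ : ContDiffBump (0 : EuclideanSpace ℝ (Fin N) × ℝ))
    (p y v : EuclideanSpace ℝ (Fin N) × ℝ) :
    fderiv ℝ (fun y => φ.normed volume (p - y)) y v = - fderiv ℝ (φ.normed volume) (p - y) v := by
  have h1 : HasFDerivAt (φ.normed volume) (fderiv ℝ (φ.normed volume) (p - y)) (p - y) :=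
    ((φ.contDiff_normed (n := 1)).differentiable one_ne_zero _).hasFDerivAt
  have h2 : HasFDerivAt (fun y : EuclideanSpace ℝ (Fin N) × ℝ => p - y)
      (-ContinuousLinearMap.id ℝ (EuclideanSpace ℝ (Fin N) × ℝ)) y :=
    (hasFDerivAt_id y).const_sub p
  have h3 : HasFDerivAt (fun y => φ.normed volume (p - y))
      ((fderiv ℝ (φ.normed volume) (p - y)).comp
        (-ContinuousLinearMap.id ℝ (EuclideanSpace ℝ (Fin N) × ℝ))) y :=
    h1.comp y h2
  rw [h3.fderiv]
  simp

lemma tsupport_normed_sub_subset (φ : ContDiffBump (0 : EuclideanSpace ℝ (Fin N) × ℝ))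
    (p : EuclideanSpace ℝ (Fin N) × ℝ) :
    tsupport (fun y => φ.normed volume (p - y)) ⊆ Metric.closedBall p φ.rOut := by
  refine closure_minimal (fun y hy => ?_) Metric.isClosed_closedBall
  have h1 : p - y ∈ Function.support (φ.normed volume) := hy
  rw [φ.support_normed_eq, mem_ball_zero_iff] at h1
  rw [Metric.mem_closedBall, dist_comm, dist_eq_norm]
  exact h1.le

lemma contDiff_normed_sub (φ : ContDiffBump (0 : EuclideanSpace ℝ (Fin N) × ℝ))
    (p : EuclideanSpace ℝ (Fin N) × ℝ) (n : ℕ∞) :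
    ContDiff ℝ n fun y => φ.normed volume (p - y) :=
  φ.contDiff_normed.comp (contDiff_const.sub contDiff_id)

lemma fderiv_mollify_indicator {Q T : Set (EuclideanSpace ℝ (Fin N) × ℝ)} (hTQ : T ⊆ Q)
    {u : EuclideanSpace ℝ (Fin N) × ℝ → ℝ} (hu : LocallyIntegrable (T.indicator u) volume)
    (φ : ContDiffBump (0 : EuclideanSpace ℝ (Fin N) × ℝ)) {p : EuclideanSpace ℝ (Fin N) × ℝ}
    (hp : Metric.closedBall p φ.rOut ⊆ T) (v : EuclideanSpace ℝ (Fin N) × ℝ) :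
    fderiv ℝ (mollify φ (T.indicator u)) p v =
      -∫ y in Q, u y * fderiv ℝ (fun y => φ.normed volume (p - y)) y v := by
  have hz : ∀ y, y ∉ T → fderiv ℝ (fun y => φ.normed volume (p - y)) y v = 0 := by
    intro y hy
    have : y ∉ tsupport (fun y => φ.normed volume (p - y)) := fun h =>
      hy (hp (tsupport_normed_sub_subset φ p h))
    rw [fderiv_of_notMem_tsupport ℝ this]
    simp
  rw [fderiv_mollify φ hu, ← integral_neg, setIntegral_eq_integral_of_forall_compl_eq_zero]
  · congr 1
    funext y
    by_cases hy : y ∈ T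
    · rw [indicator_of_mem hy, fderiv_normed_sub]; ring
    · rw [indicator_of_notMem hy, hz y hy]; simp
  · intro y hy
    rw [hz y fun h => hy (hTQ h)]; simp

lemma setIntegral_mul_eq_integral_indicator {Q : Set (EuclideanSpace ℝ (Fin N) × ℝ)}
    (hQ : MeasurableSet Q)
    (f k : EuclideanSpace ℝ (Fin N) × ℝ → ℝ) : ∫ y in Q, f y * k y = ∫ y, k y * Q.indicator f y := by
  rw [← integral_indicator hQ]
  congr 1
  funext y
  by_cases hy : y ∈ Q
  · simp [hy, mul_comm]
  · simp [hy]

namespace IsDistributionalSolution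

variable {Q : Set (EuclideanSpace ℝ (Fin N) × ℝ)} {u : EuclideanSpace ℝ (Fin N) × ℝ → ℝ}
  {V a : EuclideanSpace ℝ (Fin N) × ℝ → EuclideanSpace ℝ (Fin N)}

lemma fderiv_mollify_space (hs : IsDistributionalSolution Q u V a) (hQ : MeasurableSet Q)
    {T : Set (EuclideanSpace ℝ (Fin N) × ℝ)} (hTQ : T ⊆ Q)
    (hu : LocallyIntegrable (T.indicator u) volume)
    (φ : ContDiffBump (0 : EuclideanSpace ℝ (Fin N) × ℝ)) {p : EuclideanSpace ℝ (Fin N) × ℝ}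
    (hp : Metric.closedBall p φ.rOut ⊆ T) (i : Fin N) :
    fderiv ℝ (mollify φ (T.indicator u)) p (EuclideanSpace.single i 1, 0) =
      (mollify φ (Q.indicator V) p : EuclideanSpace ℝ (Fin N)) i := by
  have hVi : LocallyIntegrable (Q.indicator V) volume :=
    (hs.integrableOn_grad.integrable_indicator hQ).locallyIntegrable
  rw [fderiv_mollify_indicator hTQ hu φ hp, hs.weak_gradient _ (contDiff_normed_sub φ p _)
    (hasCompactSupport_normed_sub φ p)
    ((tsupport_normed_sub_subset φ p).trans (hp.trans hTQ)), neg_neg, mollify_coord φ hVi,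
    setIntegral_mul_eq_integral_indicator hQ]
  simp only [mollify, smul_eq_mul]
  congr 1
  funext y
  by_cases hy : y ∈ Q <;> simp [hy]

lemma fderiv_mollify_time (hs : IsDistributionalSolution Q u V a) (hQ : MeasurableSet Q)
    {T : Set (EuclideanSpace ℝ (Fin N) × ℝ)} (hTQ : T ⊆ Q)
    (hu : LocallyIntegrable (T.indicator u) volume)
    (φ : ContDiffBump (0 : EuclideanSpace ℝ (Fin N) × ℝ)) {p : EuclideanSpace ℝ (Fin N) × ℝ}
    (hp : Metric.closedBall p φ.rOut ⊆ T) :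
    fderiv ℝ (mollify φ (T.indicator u)) p (0, 1) =
      ∑ i, fderiv ℝ (mollify φ (fun y => (Q.indicator a y : EuclideanSpace ℝ (Fin N)) i)) p
        (EuclideanSpace.single i 1, 0) := by
  have hai : Integrable (Q.indicator a) volume := hs.integrableOn_flux.integrable_indicator hQ
  have haii : ∀ i, Integrable (fun y => (Q.indicator a y : EuclideanSpace ℝ (Fin N)) i) volume :=
      fun i =>
    (EuclideanSpace.proj (𝕜 := ℝ) i).integrable_comp hai
  rw [fderiv_mollify_indicator hTQ hu φ hp, hs.weak_form _ (contDiff_normed_sub φ p _)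
    (hasCompactSupport_normed_sub φ p)
    ((tsupport_normed_sub_subset φ p).trans (hp.trans hTQ))]
  simp_rw [fun i => fderiv_mollify φ (haii i).locallyIntegrable p (EuclideanSpace.single i 1, 0)]
  rw [← integral_finsetSum, ← integral_neg, ← integral_indicator hQ]
  · congr 1
    funext y
    by_cases hy : y ∈ Q
    · simp only [hy, indicator_of_mem]
      rw [clm_apply_space_eq_sum, ← Finset.sum_neg_distrib]
      refine Finset.sum_congr rfl fun i _ => ?_
      rw [fderiv_normed_sub]; ring
    · simp [hy]
  · intro i _
    have hc : ContDiff ℝ 1 (φ.normed (volume : Measure (EuclideanSpace ℝ (Fin N) × ℝ))) :=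
      φ.contDiff_normed (n := 1)
    refine (haii i).locallyIntegrable.integrable_smul_left_of_hasCompactSupport
      (g := fun y => fderiv ℝ (φ.normed volume) (p - y) (EuclideanSpace.single i 1, 0)) ?_ ?_
    · exact ((hc.continuous_fderiv one_ne_zero).comp
        (continuous_const.sub continuous_id)).clm_apply continuous_const
    · exact ((φ.hasCompactSupport_normed.fderiv_apply ℝ _).comp_homeomorph (Homeomorph.subLeft p))

end IsDistributionalSolution

end EnergyIdentity

section EnergyIdentityLimit

variable {N : ℕ}

lemma exists_abs_le_of_continuous_pair {f : ℝ → ℝ → ℝ} (hf : Continuous fun q : ℝ × ℝ => f q.1 q.2)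
    (M : ℝ) : ∃ B, 0 ≤ B ∧ ∀ z w, |z| ≤ M → |w| ≤ M → |f z w| ≤ B := by
  obtain ⟨B, hB⟩ :=
    (isCompact_closedBall (0 : ℝ × ℝ) M).exists_bound_of_continuousOn hf.continuousOn
  refine ⟨max B 0, le_max_right _ _, fun z w hz hw => ?_⟩
  refine (hB (z, w) ?_).trans (le_max_left _ _)
  simpa [Prod.norm_def] using ⟨hz, hw⟩

lemma norm_fderiv_apply_space_le {ζ : EuclideanSpace ℝ (Fin N) × ℝ → ℝ} {C : NNReal}
    (hζ : LipschitzWith C ζ) (p : EuclideanSpace ℝ (Fin N) × ℝ) (b : EuclideanSpace ℝ (Fin N)) :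
    |fderiv ℝ ζ p (b, 0)| ≤ C * ‖b‖ := by
  have h1 := (fderiv ℝ ζ p).le_opNorm (b, 0)
  have h2 : ‖((b, 0) : EuclideanSpace ℝ (Fin N) × ℝ)‖ = ‖b‖ := by simp [Prod.norm_def]
  rw [h2] at h1
  exact h1.trans (mul_le_mul_of_nonneg_right (norm_fderiv_le_of_lipschitz ℝ hζ) (norm_nonneg _))

lemma aestronglyMeasurable_fderiv_apply {ζ : EuclideanSpace ℝ (Fin N) × ℝ → ℝ}
    {μ : Measure (EuclideanSpace ℝ (Fin N) × ℝ)}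
    {b : EuclideanSpace ℝ (Fin N) × ℝ → EuclideanSpace ℝ (Fin N)}
    (hb : AEStronglyMeasurable b μ) :
    AEStronglyMeasurable (fun p => fderiv ℝ ζ p (b p, 0)) μ := by
  have h1 : AEStronglyMeasurable (fun p => fderiv ℝ ζ p) μ :=
    (measurable_fderiv ℝ ζ).aestronglyMeasurable
  have h2 : AEStronglyMeasurable (fun p => (b p, (0 : ℝ))) μ :=
    hb.prodMk aestronglyMeasurable_const
  exact isBoundedBilinearMap_apply.continuous.comp_aestronglyMeasurable (h1.prodMk h2)

/-- The energy identity for distributional solutions. -/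
theorem IsDistributionalSolution.energy_identity
    {Q : Set (EuclideanSpace ℝ (Fin N) × ℝ)} {u : EuclideanSpace ℝ (Fin N) × ℝ → ℝ}
    {V a : EuclideanSpace ℝ (Fin N) × ℝ → EuclideanSpace ℝ (Fin N)}
    (hs : IsDistributionalSolution Q u V a) (hQo : IsOpen Q) (hQb : Bornology.IsBounded Q)
    {W : EuclideanSpace ℝ (Fin N) × ℝ → ℝ} (hW : IntegrableOn W Q)
    (haW : ∀ᵐ y ∂(volume.restrict Q), ‖a y‖ ≤ W y)
    (haVW : ∀ᵐ y ∂(volume.restrict Q), ∀ᵐ z ∂(volume.restrict Q), ‖a y‖ * ‖V z‖ ≤ W y + W z)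
    {H h Hz hz hw : ℝ → ℝ → ℝ} (hH : IsEnergyIntegrand H h Hz hz hw)
    {ζ : EuclideanSpace ℝ (Fin N) × ℝ → ℝ} {Cζ Cχ : NNReal} (hζ : LipschitzWith Cζ ζ)
    (hζ1 : ∀ p, |ζ p| ≤ 1) {χ χ' : ℝ → ℝ} (hχL : LipschitzWith Cχ χ) (hχ1 : ∀ t, |χ t| ≤ 1)
    (hχ : ∀ t, HasDerivAt χ (χ' t) t) (hχc : Continuous χ')
    {S : Set (EuclideanSpace ℝ (Fin N) × ℝ)} (hS : IsCompact S) (hSQ : S ⊆ Q)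
    (hSζ : ∀ p : EuclideanSpace ℝ (Fin N) × ℝ, ζ p ≠ 0 → (χ p.2 ≠ 0 ∨ χ' p.2 ≠ 0) → p ∈ S) :
    ∫ p in Q, (Hz (ζ p) (u p) * fderiv ℝ ζ p (0, 1) * χ p.2 + H (ζ p) (u p) * χ' p.2) =
      ∫ p in Q, (hz (ζ p) (u p) * fderiv ℝ ζ p (a p, 0)
        + hw (ζ p) (u p) * inner ℝ (a p) (V p)) * χ p.2 := by
  have hQm : MeasurableSet Q := hQo.measurableSet
  obtain ⟨δ, hδ, hδQ⟩ := hS.exists_cthickening_subset_open hQo hSQ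
  set T := Metric.cthickening δ S with hT
  have hTc : IsCompact T := hS.cthickening
  have hST : S ⊆ T := Metric.self_subset_cthickening S
  obtain ⟨M0, hM0⟩ := hTc.exists_bound_of_continuousOn (hs.continuousOn.mono hδQ)
  set M := max M0 1 with hM
  have hM1 : 1 ≤ M := le_max_right _ _
  set u0 := T.indicator u with hu0
  set V0 := Q.indicator V with hV0
  set a0 := Q.indicator a with ha0
  set W0 := Q.indicator W with hW0
  have hu0M : ∀ y, ‖u0 y‖ ≤ M := by
    intro y
    by_cases hy : y ∈ T
    · rw [hu0, indicator_of_mem hy]; exact (hM0 y hy).trans (le_max_left _ _)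
    · rw [hu0, indicator_of_notMem hy, norm_zero]; linarith
  have hu0i : Integrable u0 volume := by
    apply IntegrableOn.integrable_indicator _ hTc.measurableSet
    exact (hs.continuousOn.mono hδQ).integrableOn_compact hTc
  have hV0i : Integrable V0 volume := hs.integrableOn_grad.integrable_indicator hQm
  have ha0i : Integrable a0 volume := hs.integrableOn_flux.integrable_indicator hQm
  have hW0i : Integrable W0 volume := hW.integrable_indicator hQm
  have haii : ∀ i, Integrable (fun y => (a0 y) i) volume := fun i =>
    (EuclideanSpace.proj (𝕜 := ℝ) i).integrable_comp ha0i
  have hu0c : HasCompactSupport u0 :=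
    HasCompactSupport.intro hTc fun y hy => indicator_of_notMem hy _
  have ha0c : ∀ i, HasCompactSupport (fun y => (a0 y) i) := fun i =>
    HasCompactSupport.intro hQb.isCompact_closure fun y hy => by
      simp [ha0, indicator_of_notMem fun h => hy (subset_closure h)]
  have haW0 : ∀ᵐ y, ‖a0 y‖ ≤ W0 y := by
    have := (ae_restrict_iff' hQm).mp haW
    filter_upwards [this] with y hy
    by_cases hyQ : y ∈ Q
    · simpa [ha0, hW0, hyQ] using hy hyQ
    · simp [ha0, hW0, hyQ]
  have hW0n : ∀ᵐ y, 0 ≤ W0 y := by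
    filter_upwards [haW0] with y hy
    exact (norm_nonneg _).trans hy
  have haVW0 : ∀ᵐ y, ∀ᵐ z, ‖a0 y‖ * ‖V0 z‖ ≤ W0 y + W0 z := by
    have := (ae_restrict_iff' hQm).mp haVW
    filter_upwards [this, hW0n] with y hy hyW
    by_cases hyQ : y ∈ Q
    · have h2 := (ae_restrict_iff' hQm).mp (hy hyQ)
      filter_upwards [h2] with z hz
      by_cases hzQ : z ∈ Q
      · simpa [ha0, hV0, hW0, hyQ, hzQ] using hz hzQ
      · simpa [ha0, hV0, hW0, hyQ, hzQ] using hyW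
    · filter_upwards [hW0n] with z hz
      have h1 : ‖a0 y‖ = 0 := by simp [ha0, hyQ]
      rw [h1, zero_mul]
      exact add_nonneg hyW hz
  obtain ⟨B1, hB1, hB1'⟩ := exists_abs_le_of_continuous_pair hH.continuous_Hz M
  obtain ⟨B2, hB2, hB2'⟩ := exists_abs_le_of_continuous_pair hH.continuous_H M
  obtain ⟨B3, hB3, hB3'⟩ := exists_abs_le_of_continuous_pair hH.continuous_hz M
  obtain ⟨B4, hB4, hB4'⟩ := exists_abs_le_of_continuous_pair hH.continuous_hw M
  have hζM : ∀ p, |ζ p| ≤ M := fun p => (hζ1 p).trans hM1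
  have hχM : ∀ t, |χ t| ≤ M := fun t => (hχ1 t).trans hM1
  set U : ℕ → EuclideanSpace ℝ (Fin N) × ℝ → ℝ := fun n => mollify (shrinkingBump _ n) u0 with hU
  set A : ℕ → EuclideanSpace ℝ (Fin N) × ℝ → EuclideanSpace ℝ (Fin N) :=
    fun n => mollify (shrinkingBump _ n) a0 with hA
  set Vn : ℕ → EuclideanSpace ℝ (Fin N) × ℝ → EuclideanSpace ℝ (Fin N) :=
    fun n => mollify (shrinkingBump _ n) V0 with hVn
  have hUM : ∀ n p, |U n p| ≤ M := fun n p =>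
    norm_mollify_le_of_bound _ hu0i.locallyIntegrable hu0M p
  have hUc : ∀ n, Continuous (U n) := fun n =>
    (contDiff_mollify (shrinkingBump _ n) hu0i.locallyIntegrable 1).continuous
  have hAc : ∀ n, Continuous (A n) := fun n =>
    (contDiff_mollify (shrinkingBump _ n) ha0i.locallyIntegrable 1).continuous
  have hVc : ∀ n, Continuous (Vn n) := fun n =>
    (contDiff_mollify (shrinkingBump _ n) hV0i.locallyIntegrable 1).continuous
  -- integrands at level `n`
  set Ln : ℕ → EuclideanSpace ℝ (Fin N) × ℝ → ℝ := fun n p =>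
    Hz (ζ p) (U n p) * fderiv ℝ ζ p (0, 1) * χ p.2 + H (ζ p) (U n p) * χ' p.2 with hLn
  set Rn : ℕ → EuclideanSpace ℝ (Fin N) × ℝ → ℝ := fun n p =>
    (hz (ζ p) (U n p) * fderiv ℝ ζ p (A n p, 0)
      + hw (ζ p) (U n p) * inner ℝ (A n p) (Vn n p)) * χ p.2 with hRn
  have hident : ∀ᶠ n in atTop, ∫ p, Ln n p = ∫ p, Rn n p := by
    have hev : ∀ᶠ n in atTop,
        (shrinkingBump (EuclideanSpace ℝ (Fin N) × ℝ) n).rOut < δ :=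
      tendsto_rOut_shrinkingBump.eventually (Iio_mem_nhds hδ)
    filter_upwards [hev] with n hn
    have hball : ∀ p ∈ S, Metric.closedBall p
        (shrinkingBump (EuclideanSpace ℝ (Fin N) × ℝ) n).rOut ⊆ T := fun p hp =>
      (Metric.closedBall_subset_closedBall hn.le).trans
        (Metric.closedBall_subset_cthickening hp δ)
    obtain ⟨CU, hCU⟩ := ContDiff.lipschitzWith_of_hasCompactSupport (𝕂 := ℝ)
      (hasCompactSupport_mollify (shrinkingBump _ n) hu0c)
      (contDiff_mollify (shrinkingBump _ n) hu0i.locallyIntegrable 1) one_ne_zero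
    have hAd : ∀ i, ContDiff ℝ 1 (mollify (shrinkingBump _ n) fun y => (a0 y) i) := fun i =>
      contDiff_mollify (shrinkingBump _ n) (haii i).locallyIntegrable 1
    have hAcs : ∀ i, HasCompactSupport (mollify (shrinkingBump _ n) fun y => (a0 y) i) := fun i =>
      hasCompactSupport_mollify (shrinkingBump _ n) (ha0c i)
    choose CA hCA using fun i =>
      ContDiff.lipschitzWith_of_hasCompactSupport (𝕂 := ℝ) (hAcs i) (hAd i) one_ne_zero
    have key := smooth_energy_identity hH hζ hCU hχL hCA hχ hζM (hUM n) hχM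
      (contDiff_mollify (shrinkingBump _ n) hu0i.locallyIntegrable 1) hAd hAcs hS
      (fun p h1 h2 => hSζ p h1 (Or.inl h2))
      (fun p hp => hs.fderiv_mollify_time hQm hδQ hu0i.locallyIntegrable _ (hball p hp))
    refine key.trans ?_
    congr 1
    funext p
    simp only [hRn]
    by_cases h0 : ζ p = 0
    · simp [h0, hH.hz_zero, hH.hw_zero]
    by_cases h1 : χ p.2 = 0
    · simp [h1]
    have hp : p ∈ S := hSζ p h0 (Or.inl h1)
    rw [clm_apply_space_eq_sum, PiLp.inner_apply, Finset.mul_sum, Finset.mul_sum,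
      ← Finset.sum_add_distrib, Finset.sum_mul]
    refine Finset.sum_congr rfl fun i _ => ?_
    rw [hs.fderiv_mollify_space hQm hδQ hu0i.locallyIntegrable _ (hball p hp),
      ← mollify_coord _ ha0i.locallyIntegrable]
    simp only [hA, hVn, hU, RCLike.inner_apply, conj_trivial]
    ring
  have hUlim := ae_tendsto_mollify hu0i.locallyIntegrable
  have hVlim := ae_tendsto_mollify hV0i.locallyIntegrable
  have halim := ae_tendsto_mollify ha0i.locallyIntegrable
  have hWlim := ae_tendsto_mollify hW0i.locallyIntegrable
  have hcontcomp : ∀ {f : ℝ → ℝ → ℝ}, Continuous (fun q : ℝ × ℝ => f q.1 q.2) → ∀ n,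
      Continuous fun p => f (ζ p) (U n p) := fun hf n =>
    hf.comp (hζ.continuous.prodMk (hUc n))
  have hχcont : Continuous fun p : EuclideanSpace ℝ (Fin N) × ℝ => χ p.2 :=
    hχL.continuous.comp continuous_snd
  have hχ'cont : Continuous fun p : EuclideanSpace ℝ (Fin N) × ℝ => χ' p.2 :=
    hχc.comp continuous_snd
  have hlimcomp : ∀ {f : ℝ → ℝ → ℝ}, Continuous (fun q : ℝ × ℝ => f q.1 q.2) →
      ∀ p ∈ S, Tendsto (fun n => U n p) atTop (𝓝 (u0 p)) →
      Tendsto (fun n => f (ζ p) (U n p)) atTop (𝓝 (f (ζ p) (u p))) := by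
    intro f hf p hp hlim
    have e : u0 p = u p := indicator_of_mem (hST hp) _
    rw [e] at hlim
    exact (hf.tendsto (ζ p, u p)).comp (tendsto_const_nhds.prodMk_nhds hlim)
  have hLlim : Tendsto (fun n => ∫ p, Ln n p) atTop (𝓝 (∫ p, (Hz (ζ p) (u p) *
      fderiv ℝ ζ p (0, 1) * χ p.2 + H (ζ p) (u p) * χ' p.2))) := by
    obtain ⟨B5, hB5⟩ := hS.exists_bound_of_continuousOn hχ'cont.continuousOn
    refine tendsto_integral_of_dominated_convergence
      (S.indicator fun _ => B1 * Cζ + B2 * max B5 0) (fun n => ?_) ?_ (fun n => ?_) ?_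
    · exact (((hcontcomp hH.continuous_Hz n).aestronglyMeasurable.mul
        (measurable_fderiv_apply_const ℝ ζ (0, 1)).aestronglyMeasurable).mul
          hχcont.aestronglyMeasurable).add
        ((hcontcomp hH.continuous_H n).aestronglyMeasurable.mul hχ'cont.aestronglyMeasurable)
    · apply IntegrableOn.integrable_indicator _ hS.measurableSet
      exact integrableOn_const hS.measure_lt_top.ne
    · refine Eventually.of_forall fun p => ?_
      by_cases hp : p ∈ S
      · rw [indicator_of_mem hp, Real.norm_eq_abs]
        have h1 := hB1' _ _ (hζM p) (hUM n p)
        have h2 := hB2' _ _ (hζM p) (hUM n p)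
        have h3 : |fderiv ℝ ζ p (0, 1)| ≤ Cζ := by
          have := (fderiv ℝ ζ p).le_opNorm (0, 1)
          have h4 := norm_fderiv_le_of_lipschitz ℝ hζ (x₀ := p)
          have h5 : ‖((0, 1) : EuclideanSpace ℝ (Fin N) × ℝ)‖ = 1 := by simp [Prod.norm_def]
          rw [h5, mul_one] at this
          exact this.trans h4
        have h6 : |χ' p.2| ≤ max B5 0 := (hB5 p hp).trans (le_max_left _ _)
        refine (abs_add_le _ _).trans ?_
        rw [abs_mul, abs_mul, abs_mul]
        have h7 := hχ1 p.2
        have h8 : |Hz (ζ p) (U n p)| * |fderiv ℝ ζ p (0, 1)| * |χ p.2| ≤ B1 * Cζ * 1 := by gcongr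
        have h9 : |H (ζ p) (U n p)| * |χ' p.2| ≤ B2 * max B5 0 := by gcongr
        linarith
      · rw [indicator_of_notMem hp]
        by_cases h0 : ζ p = 0
        · simp [hLn, h0, hH.Hz_zero, hH.H_zero]
        · have h1 : χ p.2 = 0 := by by_contra h1; exact hp (hSζ p h0 (Or.inl h1))
          have h2 : χ' p.2 = 0 := by by_contra h2; exact hp (hSζ p h0 (Or.inr h2))
          simp [hLn, h1, h2]
    · filter_upwards [hUlim] with p hp
      by_cases hpS : p ∈ S
      · exact ((hlimcomp hH.continuous_Hz p hpS hp).mul_const _ |>.mul_const _).add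
          ((hlimcomp hH.continuous_H p hpS hp).mul_const _)
      · by_cases h0 : ζ p = 0
        · simp [hLn, h0, hH.Hz_zero, hH.H_zero]
        · have h1 : χ p.2 = 0 := by by_contra h1; exact hpS (hSζ p h0 (Or.inl h1))
          have h2 : χ' p.2 = 0 := by by_contra h2; exact hpS (hSζ p h0 (Or.inr h2))
          simp [hLn, h1, h2]
  have hRlim : Tendsto (fun n => ∫ p, Rn n p) atTop (𝓝 (∫ p, (hz (ζ p) (u p) *
      fderiv ℝ ζ p (a0 p, 0) + hw (ζ p) (u p) * inner ℝ (a0 p) (V0 p)) * χ p.2)) := by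
    set B := B3 * Cζ + 2 * B4 with hB
    have hBn : 0 ≤ B := by positivity
    refine tendsto_integral_of_dominated_of_tendsto
      (w := fun n p => B * mollify (shrinkingBump _ n) W0 p) (w0 := fun p => B * W0 p)
      (fun n => ?_) (fun n => (integrable_mollify _ hW0i).const_mul B) (hW0i.const_mul B)
      (fun n => Eventually.of_forall fun p => ?_) ?_ ?_ ?_
    · exact (((hcontcomp hH.continuous_hz n).aestronglyMeasurable.mul
        (aestronglyMeasurable_fderiv_apply (hAc n).aestronglyMeasurable)).add
        ((hcontcomp hH.continuous_hw n).aestronglyMeasurable.mul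
          ((hAc n).inner (hVc n)).aestronglyMeasurable)).mul hχcont.aestronglyMeasurable
    · have h1 := hB3' _ _ (hζM p) (hUM n p)
      have h2 := hB4' _ _ (hζM p) (hUM n p)
      have hnA : ‖A n p‖ ≤ mollify (shrinkingBump _ n) W0 p :=
        (norm_mollify_le _ _ _).trans (mollify_mono _ ha0i.norm.locallyIntegrable
          hW0i.locallyIntegrable haW0 p)
      have hAV : ‖A n p‖ * ‖Vn n p‖ ≤ 2 * mollify (shrinkingBump _ n) W0 p := by
        refine le_trans ?_ (mollify_mul_mollify_le (shrinkingBump _ n)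
          ha0i.norm.locallyIntegrable hV0i.norm.locallyIntegrable hW0i.locallyIntegrable haVW0 p)
        exact mul_le_mul (norm_mollify_le _ _ _) (norm_mollify_le _ _ _) (norm_nonneg _)
          ((norm_nonneg _).trans (norm_mollify_le _ a0 _))
      have h3 := norm_fderiv_apply_space_le hζ p (A n p)
      have h4 : |inner ℝ (A n p) (Vn n p)| ≤ ‖A n p‖ * ‖Vn n p‖ := abs_real_inner_le_norm _ _
      have hw0 : 0 ≤ mollify (shrinkingBump _ n) W0 p := (norm_nonneg _).trans hnA
      rw [abs_mul]
      refine (mul_le_of_le_one_right (abs_nonneg _) (hχ1 _)).trans ?_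
      refine (abs_add_le _ _).trans ?_
      rw [abs_mul, abs_mul]
      have h5 : |hz (ζ p) (U n p)| * |fderiv ℝ ζ p (A n p, 0)| ≤
          B3 * (Cζ * mollify (shrinkingBump _ n) W0 p) := by
        apply mul_le_mul h1 (h3.trans _) (abs_nonneg _) hB3
        gcongr
      have h6 : |hw (ζ p) (U n p)| * |inner ℝ (A n p) (Vn n p)| ≤
          B4 * (2 * mollify (shrinkingBump _ n) W0 p) :=
        mul_le_mul h2 (h4.trans hAV) (abs_nonneg _) hB4
      calc _ ≤ _ := add_le_add h5 h6
        _ = _ := by rw [hB]; ring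
    · filter_upwards [hUlim, hVlim, halim] with p hp1 hp2 hp3
      by_cases hpS : p ∈ S
      · refine Tendsto.mul_const _ (((hlimcomp hH.continuous_hz p hpS hp1).mul ?_).add
          ((hlimcomp hH.continuous_hw p hpS hp1).mul (hp3.inner hp2)))
        exact ((fderiv ℝ ζ p).continuous.tendsto _).comp (hp3.prodMk_nhds tendsto_const_nhds)
      · by_cases h0 : ζ p = 0
        · simp [hRn, h0, hH.hz_zero, hH.hw_zero]
        · have h1 : χ p.2 = 0 := by by_contra h1; exact hpS (hSζ p h0 (Or.inl h1))
          simp [hRn, h1]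
    · filter_upwards [hWlim] with p hp
      exact hp.const_mul B
    · simp_rw [integral_const_mul, integral_mollify _ hW0i]
      exact tendsto_const_nhds
  have hfin := tendsto_nhds_unique (hLlim.congr' hident) hRlim
  rw [setIntegral_eq_integral_of_forall_compl_eq_zero, hfin, ← integral_indicator hQm]
  · congr 1
    funext p
    by_cases hp : p ∈ Q
    · simp [hp, ha0, hV0]
    · rw [indicator_of_notMem hp]
      by_cases h0 : ζ p = 0
      · simp [h0, hH.hz_zero, hH.hw_zero]
      · have h1 : χ p.2 = 0 := by by_contra h1; exact hp (hSQ (hSζ p h0 (Or.inl h1)))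
        simp [h1]
  · intro p hp
    by_cases h0 : ζ p = 0
    · simp [h0, hH.Hz_zero, hH.H_zero]
    · have h1 : χ p.2 = 0 := by by_contra h1; exact hp (hSQ (hSζ p h0 (Or.inl h1)))
      have h2 : χ' p.2 = 0 := by by_contra h2; exact hp (hSQ (hSζ p h0 (Or.inr h2)))
      simp [h1, h2]

end EnergyIdentityLimit

section WeakSolution

variable {N : ℕ}

lemma isOpen_cube (y : EuclideanSpace ℝ (Fin N)) (ρ : ℝ) : IsOpen (cube N y ρ) := by
  have : cube N y ρ = ⋂ i, {x | |x i - y i| < ρ} := by ext x; simp [cube]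
  rw [this]
  exact isOpen_iInter_of_finite fun i => isOpen_lt (by fun_prop) continuous_const

lemma isBounded_cube (y : EuclideanSpace ℝ (Fin N)) (ρ : ℝ) :
    Bornology.IsBounded (cube N y ρ) := by
  have h := (PiLp.antilipschitzWith_ofLp 2 (fun _ : Fin N => ℝ)).isBounded_preimage
    (Metric.isBounded_closedBall (x := WithLp.ofLp y) (r := max ρ 0))
  refine h.subset fun x hx => ?_
  simp only [mem_preimage, Metric.mem_closedBall]
  rw [dist_pi_le_iff (le_max_right _ _)]
  exact fun i => (hx i).le.trans (le_max_left _ _)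

lemma deriv_slice_eq_fderiv {φ : EuclideanSpace ℝ (Fin N) × ℝ → ℝ}
    {x : EuclideanSpace ℝ (Fin N)} {t : ℝ} (hφ : DifferentiableAt ℝ φ (x, t)) :
    deriv (fun t => φ (x, t)) t = fderiv ℝ φ (x, t) (0, 1) := by
  have h2 : HasDerivAt (fun t : ℝ => (x, t)) ((0 : EuclideanSpace ℝ (Fin N)), (1 : ℝ)) t :=
    (hasDerivAt_const t x).prodMk (hasDerivAt_id t)
  exact (hφ.hasFDerivAt.comp_hasDerivAt t h2).deriv

lemma fderiv_slice_eq_comp_inl {φ : EuclideanSpace ℝ (Fin N) × ℝ → ℝ}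
    {x : EuclideanSpace ℝ (Fin N)} {t : ℝ} (hφ : DifferentiableAt ℝ φ (x, t)) :
    fderiv ℝ (fun y => φ (y, t)) x =
      (fderiv ℝ φ (x, t)).comp (ContinuousLinearMap.inl ℝ (EuclideanSpace ℝ (Fin N)) ℝ) :=
  HasFDerivAt.fderiv (hφ.hasFDerivAt.comp x (hasFDerivAt_prodMk_left x t))

/-- Iterated integrals over a cylinder as integrals over the product. -/
lemma intervalIntegral_setIntegral_eq {K : Set (EuclideanSpace ℝ (Fin N))} {t0 t1 : ℝ}
    (ht : t0 ≤ t1) {F : EuclideanSpace ℝ (Fin N) → ℝ → ℝ}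
    (hF : IntegrableOn (fun p : EuclideanSpace ℝ (Fin N) × ℝ => F p.1 p.2) (K ×ˢ Ioo t0 t1)) :
    ∫ t in t0..t1, ∫ x in K, F x t = ∫ p in K ×ˢ Ioo t0 t1, F p.1 p.2 := by
  rw [intervalIntegral.integral_of_le ht, integral_Ioc_eq_integral_Ioo]
  rw [IntegrableOn, Measure.volume_eq_prod, ← Measure.prod_restrict] at hF
  rw [Measure.volume_eq_prod, ← Measure.prod_restrict, integral_prod_symm _ hF]

lemma isLipschitzTest_of_contDiff {K : Set (EuclideanSpace ℝ (Fin N))} (hK : IsOpen K) {t0 t1 : ℝ}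
    {φ : EuclideanSpace ℝ (Fin N) × ℝ → ℝ} (hφ : ContDiff ℝ (⊤ : ℕ∞) φ)
    (hc : HasCompactSupport φ) (hsupp : tsupport φ ⊆ K ×ˢ Ioo t0 t1) :
    IsLipschitzTest K t0 t1 (fun x t => φ (x, t)) := by
  refine ⟨?_, (tsupport φ)ᶜ, (isClosed_tsupport φ).isOpen_compl, ?_, ?_⟩
  · obtain ⟨C, hC⟩ := hφ.lipschitzWith_of_hasCompactSupport hc (by simp)
    exact ⟨C, hC.lipschitzOnWith⟩
  · rintro p hp hps
    have h1 := hsupp hps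
    rcases hp with hp | hp
    · have := hp.1
      rw [hK.frontier_eq] at this
      exact this.2 h1.1
    · have h2 : p.2 = t0 := hp.2
      exact absurd h1.2.1 (by rw [h2]; exact lt_irrefl _)
  · rintro p ⟨hp, _⟩
    exact image_eq_zero_of_notMem_tsupport hp

lemma integrableOn_mul_of_hasCompactSupport {Q : Set (EuclideanSpace ℝ (Fin N) × ℝ)}
    {u φ : EuclideanSpace ℝ (Fin N) × ℝ → ℝ} (hu : ContinuousOn u Q) (hφ : Continuous φ)
    (hc : HasCompactSupport φ) (hsupp : tsupport φ ⊆ Q) :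
    IntegrableOn (fun p => u p * φ p) Q := by
  have h1 : IntegrableOn (fun p => u p * φ p) (tsupport φ) :=
    ((hu.mono hsupp).mul hφ.continuousOn).integrableOn_compact hc
  rw [integrableOn_iff_integrable_of_support_subset] at h1
  · exact h1.integrableOn
  · intro p hp
    by_contra h
    exact hp (by simp [image_eq_zero_of_notMem_tsupport h])

lemma IsWeakSolution.exists_distributionalSolution {C0 C1 g0 g1 : ℝ} {g : ℝ → ℝ}
    (hg : IsStructureFunction g0 g1 g) (h1 : 0 < g1) (hC1 : 0 < C1)
    {K : Set (EuclideanSpace ℝ (Fin N))} (hK : IsOpen K) (hKb : Bornology.IsBounded K)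
    {t0 t1 : ℝ} (ht : t0 < t1) {u : EuclideanSpace ℝ (Fin N) → ℝ → ℝ}
    {V : EuclideanSpace ℝ (Fin N) → ℝ → EuclideanSpace ℝ (Fin N)}
    (hs : IsWeakSolution C0 C1 g K t0 t1 u V) :
    ∃ a : EuclideanSpace ℝ (Fin N) × ℝ → EuclideanSpace ℝ (Fin N),
      IsDistributionalSolution (K ×ˢ Ioo t0 t1) (fun p => u p.1 p.2) (fun p => V p.1 p.2) a ∧
      ∀ᵐ p ∂(volume.restrict (K ×ˢ Ioo t0 t1)),
        C0 * primitiveG g ‖V p.1 p.2‖ ≤ inner ℝ (a p) (V p.1 p.2) ∧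
        ‖a p‖ ≤ C1 * g ‖V p.1 p.2‖ := by
  obtain ⟨a, ham, hab, haw⟩ := hs.weak_form
  have hQb : Bornology.IsBounded (K ×ˢ Ioo t0 t1) := hKb.prod (Metric.isBounded_Ioo t0 t1)
  have hQo : IsOpen (K ×ˢ Ioo t0 t1) := hK.prod isOpen_Ioo
  have hQfin : volume (K ×ˢ Ioo t0 t1) ≠ ⊤ := hQb.measure_lt_top.ne
  have hgpos := hg.pos 1 one_pos
  have hcont : ContinuousOn (fun p : EuclideanSpace ℝ (Fin N) × ℝ => u p.1 p.2)
      (K ×ˢ Ioo t0 t1) :=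
    hs.continuousOn.mono (prod_mono_right Ioo_subset_Ioc_self)
  have hbound : IntegrableOn (fun p : EuclideanSpace ℝ (Fin N) × ℝ =>
      g1 * primitiveG g ‖V p.1 p.2‖ + g1 * primitiveG g 1) (K ×ˢ Ioo t0 t1) :=
    (hs.grad_integrable.const_mul g1).add (integrableOn_const hQfin)
  have hVi : IntegrableOn (fun p : EuclideanSpace ℝ (Fin N) × ℝ => V p.1 p.2)
      (K ×ˢ Ioo t0 t1) := by
    refine Integrable.mono' (hbound.const_mul (g 1)⁻¹) hs.grad_measurable.aestronglyMeasurable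
      (Eventually.of_forall fun p => ?_)
    have := hg.mul_le_add h1 zero_le_one (norm_nonneg (V p.1 p.2))
    rw [inv_mul_eq_div, le_div_iff₀ hgpos]
    linarith
  have hai : IntegrableOn (fun p : EuclideanSpace ℝ (Fin N) × ℝ => a p.1 p.2)
      (K ×ˢ Ioo t0 t1) := by
    refine Integrable.mono' (hbound.const_mul C1) ham.aestronglyMeasurable ?_
    filter_upwards [hab] with p hp
    exact hp.2.trans (mul_le_mul_of_nonneg_left (hg.le_add_primitiveG h1 (norm_nonneg _)) hC1.le)
  refine ⟨fun p => a p.1 p.2, ⟨hcont, hVi, hai, hs.weak_gradient, ?_⟩, hab⟩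
  intro φ hφ hc hsupp
  have key := haw _ (isLipschitzTest_of_contDiff hK hφ hc hsupp) t0 t1 le_rfl ht.le le_rfl
  have hz : ∀ x t, t ∉ Ioo t0 t1 → φ (x, t) = 0 := fun x t ht' =>
    image_eq_zero_of_notMem_tsupport fun h => ht' (hsupp h).2
  have hd : ∀ x t, DifferentiableAt ℝ φ (x, t) := fun x t => hφ.differentiable (by simp) (x, t)
  have hdt : ∀ x t, deriv (fun t => φ (x, t)) t = fderiv ℝ φ (x, t) (0, 1) := fun x t =>
    deriv_slice_eq_fderiv (hd x t)
  have hdx : ∀ x t b, fderiv ℝ (fun y => φ (y, t)) x b = fderiv ℝ φ (x, t) (b, 0) := by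
    intro x t b
    rw [fderiv_slice_eq_comp_inl (hd x t)]
    simp
  have hcf : Continuous (fderiv ℝ φ) := hφ.continuous_fderiv (by simp)
  have hi1 : IntegrableOn (fun p : EuclideanSpace ℝ (Fin N) × ℝ =>
      u p.1 p.2 * fderiv ℝ φ p (0, 1)) (K ×ˢ Ioo t0 t1) := by
    refine integrableOn_mul_of_hasCompactSupport hcont (hcf.clm_apply continuous_const)
      (hc.fderiv_apply ℝ _) ?_
    refine (closure_minimal ?_ (isClosed_tsupport φ)).trans hsupp
    intro p hp
    by_contra h
    exact hp (by simp [fderiv_of_notMem_tsupport ℝ h])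
  have hi2 : IntegrableOn (fun p : EuclideanSpace ℝ (Fin N) × ℝ =>
      fderiv ℝ φ p (a p.1 p.2, 0)) (K ×ˢ Ioo t0 t1) := by
    obtain ⟨C, hC⟩ := hφ.lipschitzWith_of_hasCompactSupport hc (by simp)
    refine Integrable.mono' (hai.norm.const_mul C)
      (aestronglyMeasurable_fderiv_apply hai.aestronglyMeasurable)
      (Eventually.of_forall fun p => norm_fderiv_apply_space_le hC p _)
  simp only [hz _ t1 (by simp), hz _ t0 (by simp), mul_zero, integral_zero, sub_zero, hdt,
    hdx] at key
  rw [intervalIntegral_setIntegral_eq ht.le (F := fun x t => u x t * fderiv ℝ φ (x, t) (0, 1)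
    - fderiv ℝ φ (x, t) (a x t, 0)) (hi1.sub hi2), integral_sub hi1 hi2] at key
  linarith

end WeakSolution

section WeightedIntegrand

variable {Λ g1 ρ k : ℝ} {p p' : ℝ → ℝ}

/-- The energy density generated by the weight `p`. -/
noncomputable def energyDensity (g1 ρ k : ℝ) (p : ℝ → ℝ) (z w : ℝ) : ℝ :=
  ρ * z ^ g1 * ∫ y in (0 : ℝ)..(z * (w - k) / ρ), p y

/-- The derivative of `energyDensity` in `z`. -/
noncomputable def energyDensityDz (g1 ρ k : ℝ) (p : ℝ → ℝ) (z w : ℝ) : ℝ :=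
  ρ * (g1 * z ^ (g1 - 1)) * (∫ y in (0 : ℝ)..(z * (w - k) / ρ), p y)
    + z ^ g1 * p (z * (w - k) / ρ) * (w - k)

/-- The derivative of `energyDensity` in `w`. -/
noncomputable def energyTest (g1 ρ k : ℝ) (p : ℝ → ℝ) (z w : ℝ) : ℝ :=
  z ^ g1 * z * p (z * (w - k) / ρ)

/-- The derivative of `energyTest` in `z`. -/
noncomputable def energyTestDz (g1 ρ k : ℝ) (p p' : ℝ → ℝ) (z w : ℝ) : ℝ :=
  (g1 * z ^ (g1 - 1) * z + z ^ g1) * p (z * (w - k) / ρ)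
    + z ^ g1 * z * (p' (z * (w - k) / ρ) * ((w - k) / ρ))

/-- The derivative of `energyTest` in `w`. -/
noncomputable def energyTestDw (g1 ρ k : ℝ) (p' : ℝ → ℝ) (z w : ℝ) : ℝ :=
  z ^ g1 * z * (p' (z * (w - k) / ρ) * (z / ρ))

lemma isEnergyIntegrand_energyDensity (hp : IsWeight Λ p p') (h1 : 1 < g1) (hρ : ρ ≠ 0) :
    IsEnergyIntegrand (energyDensity g1 ρ k p) (energyTest g1 ρ k p) (energyDensityDz g1 ρ k p)
      (energyTestDz g1 ρ k p p') (energyTestDw g1 ρ k p') := by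
  have hfst : ∀ z w : ℝ, HasFDerivAt (fun q : ℝ × ℝ => q.1) (ContinuousLinearMap.fst ℝ ℝ ℝ)
      (z, w) :=
    fun z w => hasFDerivAt_fst
  have hpow : ∀ z w : ℝ, HasFDerivAt (fun q : ℝ × ℝ => q.1 ^ g1)
      ((g1 * z ^ (g1 - 1)) • ContinuousLinearMap.fst ℝ ℝ ℝ) (z, w) := fun z w =>
    HasDerivAt.comp_hasFDerivAt (h₂ := fun z : ℝ => z ^ g1) (f := fun q : ℝ × ℝ => q.1) (z, w)
      (Real.hasDerivAt_rpow_const (Or.inr h1.le)) (hfst z w)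
  have hy : ∀ z w : ℝ, HasFDerivAt (fun q : ℝ × ℝ => q.1 * (q.2 - k) / ρ)
      (((w - k) / ρ) • ContinuousLinearMap.fst ℝ ℝ ℝ + (z / ρ) • ContinuousLinearMap.snd ℝ ℝ ℝ)
      (z, w) := by
    intro z w
    have h2 : HasFDerivAt (fun q : ℝ × ℝ => q.2 - k) (ContinuousLinearMap.snd ℝ ℝ ℝ) (z, w) :=
      hasFDerivAt_snd.sub_const k
    have h3 := ((hfst z w).mul h2).mul_const ρ⁻¹
    refine (h3.congr_fderiv ?_)
    ext <;> simp <;> ring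
  have hpy : ∀ z w : ℝ, HasFDerivAt (fun q : ℝ × ℝ => p (q.1 * (q.2 - k) / ρ))
      (p' (z * (w - k) / ρ) • (((w - k) / ρ) • ContinuousLinearMap.fst ℝ ℝ ℝ
        + (z / ρ) • ContinuousLinearMap.snd ℝ ℝ ℝ)) (z, w) := fun z w =>
    HasDerivAt.comp_hasFDerivAt (h₂ := p) (f := fun q : ℝ × ℝ => q.1 * (q.2 - k) / ρ) (z, w)
      (hp.hasDerivAt _) (hy z w)
  have hPy : ∀ z w : ℝ, HasFDerivAt
      (fun q : ℝ × ℝ => ∫ y in (0 : ℝ)..(q.1 * (q.2 - k) / ρ), p y)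
      (p (z * (w - k) / ρ) • (((w - k) / ρ) • ContinuousLinearMap.fst ℝ ℝ ℝ
        + (z / ρ) • ContinuousLinearMap.snd ℝ ℝ ℝ)) (z, w) := fun z w =>
    HasDerivAt.comp_hasFDerivAt (h₂ := fun y => ∫ x in (0 : ℝ)..y, p x)
      (f := fun q : ℝ × ℝ => q.1 * (q.2 - k) / ρ) (z, w) (hp.hasDerivAt_primitive _) (hy z w)
  have hcy : Continuous fun q : ℝ × ℝ => q.1 * (q.2 - k) / ρ :=
    (continuous_fst.mul (continuous_snd.sub continuous_const)).div_const ρ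
  have hcp : Continuous fun q : ℝ × ℝ => p (q.1 * (q.2 - k) / ρ) := hp.continuous.comp hcy
  have hcp' : Continuous fun q : ℝ × ℝ => p' (q.1 * (q.2 - k) / ρ) := hp.continuous_deriv.comp hcy
  have hcP : Continuous fun q : ℝ × ℝ => ∫ y in (0 : ℝ)..(q.1 * (q.2 - k) / ρ), p y :=
    continuous_iff_continuousAt.mpr fun q => (hPy q.1 q.2).continuousAt
  have hc1 : Continuous fun q : ℝ × ℝ => q.1 ^ g1 :=
    continuous_fst.rpow_const fun _ => Or.inr (by linarith)
  have hc2 : Continuous fun q : ℝ × ℝ => q.1 ^ (g1 - 1) :=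
    continuous_fst.rpow_const fun _ => Or.inr (by linarith)
  have z1 : (0 : ℝ) ^ g1 = 0 := Real.zero_rpow (by linarith)
  have z2 : (0 : ℝ) ^ (g1 - 1) = 0 := Real.zero_rpow (by linarith)
  refine ⟨fun z w => ?_, fun z w => ?_, ?_, ?_, ?_, ?_, ?_, ?_, ?_, ?_⟩
  · refine ((((hpow z w).const_mul ρ).mul (hPy z w)).congr_fderiv ?_)
    ext
    · simp [energyDensityDz, energyTest]; field_simp; ring
    · simp [energyDensityDz, energyTest]; field_simp
  · refine ((((hpow z w).mul (hfst z w)).mul (hpy z w)).congr_fderiv ?_)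
    ext
    · simp [energyTestDz, energyTestDw]; ring
    · simp [energyTestDz, energyTestDw]
  · unfold energyDensityDz
    exact ((continuous_const.mul (continuous_const.mul hc2)).mul hcP).add
      ((hc1.mul hcp).mul (continuous_snd.sub continuous_const))
  · unfold energyTestDz
    exact ((((continuous_const.mul hc2).mul continuous_fst).add hc1).mul hcp).add
      ((hc1.mul continuous_fst).mul
        (hcp'.mul ((continuous_snd.sub continuous_const).div_const ρ)))
  · unfold energyTestDw
    exact (hc1.mul continuous_fst).mul (hcp'.mul (continuous_fst.div_const ρ))
  · intro w; simp [energyDensity]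
  · intro w; simp [energyTest]
  · intro w; simp [energyDensityDz, z1]
  · intro w; simp [energyTestDz, z1]
  · intro w; simp [energyTestDw]

lemma energyDensity_nonneg (hp : IsWeight Λ p p') (hρ : 0 < ρ) {z : ℝ} (hz : 0 ≤ z) (w : ℝ) :
    0 ≤ energyDensity g1 ρ k p z w :=
  mul_nonneg (mul_nonneg hρ.le (Real.rpow_nonneg hz _)) (hp.primitive_nonneg _)

lemma rpow_sub_one_mul_self {z : ℝ} (hz : 0 ≤ z) (h1 : 1 < g1) : z ^ (g1 - 1) * z = z ^ g1 := by
  rcases hz.eq_or_lt with rfl | hz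
  · simp [Real.zero_rpow (by linarith : g1 ≠ 0)]
  · rw [Real.rpow_sub_one hz.ne']; field_simp

lemma energyDensityDz_le (hp : IsWeight Λ p p') (h1 : 1 < g1) (hρ : 0 < ρ) {z : ℝ} (hz : 0 ≤ z)
    (w : ℝ) : energyDensityDz g1 ρ k p z w ≤
      (g1 + 1) * (z ^ g1 * ((w - k) * p (z * (w - k) / ρ))) := by
  have h := hp.primitive_le (z * (w - k) / ρ)
  have hn : 0 ≤ ρ * (g1 * z ^ (g1 - 1)) := by positivity
  have h2 := mul_le_mul_of_nonneg_left h hn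
  have e : ρ * (g1 * z ^ (g1 - 1)) * (z * (w - k) / ρ * p (z * (w - k) / ρ))
      = g1 * (z ^ g1 * ((w - k) * p (z * (w - k) / ρ))) := by
    rw [← rpow_sub_one_mul_self hz h1]; field_simp
  unfold energyDensityDz
  linarith

lemma le_energyDensity (hp : IsWeight Λ p p') (hρ : 0 < ρ) {z : ℝ} (hz : 0 ≤ z) (w : ℝ) :
    z ^ g1 * z * ((w - k) * p (z * (w - k) / ρ)) ≤ (Λ + 1) * energyDensity g1 ρ k p z w := by
  have h := hp.mul_le_primitive (z * (w - k) / ρ)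
  have hn : 0 ≤ ρ * z ^ g1 := by positivity
  have h2 := mul_le_mul_of_nonneg_left h hn
  have e : ρ * z ^ g1 * (z * (w - k) / ρ * p (z * (w - k) / ρ))
      = z ^ g1 * z * ((w - k) * p (z * (w - k) / ρ)) := by
    field_simp
  unfold energyDensity
  linarith

/-- The pointwise lower bound for the elliptic part of the energy identity. -/
lemma elliptic_part_ge {g0 : ℝ} {g : ℝ → ℝ} (hg : IsStructureFunction g0 g1 g)
    (hp : IsWeight Λ p p') (hΛ : 0 ≤ Λ) (h1 : 1 < g1) (hρ : 0 < ρ) {C0 C1 κ : ℝ} (hC1 : 0 < C1)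
    (hκ : 0 < κ) (hκ1 : κ ≤ 1) (hκC : (1 + g1 + Λ) * C1 * (κ * g1) ≤ C0 / 2)
    {z w A D av ad : ℝ} (hz : 0 ≤ z) (hz1 : z ≤ 1) (hA : 0 ≤ A) (hD : 0 ≤ D)
    (hav : C0 * primitiveG g A ≤ av) (had : |ad| ≤ C1 * g A * D) :
    C0 / 2 * (primitiveG g A * (z ^ g1 * z * (p (z * (w - k) / ρ) / (w - k))))
      - (1 + g1 + Λ) * C1 * (κ * g1 * (κ⁻¹) ^ g1) *
        (primitiveG g (D * z * (w - k)) * (p (z * (w - k) / ρ) / (w - k)) * z ^ (-g1))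
      ≤ energyTestDz g1 ρ k p p' z w * ad + energyTestDw g1 ρ k p' z w * av := by
  set y := z * (w - k) / ρ with hy
  rcases le_or_gt y 0 with hy0 | hy0
  · have e1 := hp.eq_zero y hy0
    have e2 := hp.deriv_eq_zero y hy0
    simp [energyTestDz, energyTestDw, ← hy, e1, e2]
  have hzw : 0 < z * (w - k) := by
    rw [hy] at hy0
    exact (div_pos_iff_of_pos_right hρ).mp hy0
  have hz0 : 0 < z := lt_of_le_of_ne hz fun h => by rw [← h] at hzw; simp at hzw
  have hw0 : 0 < w - k := by
    by_contra h
    nlinarith [not_lt.mp h]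
  set v := w - k with hv
  have hpn := hp.nonneg y
  have hpl := hp.lower y
  have hpu := hp.upper y
  have hGA := hg.primitiveG_nonneg hA
  have hzg : 0 < z ^ g1 := Real.rpow_pos_of_pos hz0 _
  have hCp : 0 ≤ (1 + g1 + Λ) * C1 := by nlinarith
  -- the quadratic term
  have ezρ : z / ρ = y / v := by rw [hy]; field_simp
  have hdw : z ^ g1 * z * (p y / v) ≤ energyTestDw g1 ρ k p' z w := by
    simp only [energyTestDw, ← hv, ← hy]
    apply mul_le_mul_of_nonneg_left _ (by positivity)
    rw [ezρ, mul_div_assoc', div_le_div_iff_of_pos_right hw0]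
    linarith
  have hq0 : 0 ≤ z ^ g1 * z * (p y / v) := by positivity
  have hquad : C0 * (primitiveG g A * (z ^ g1 * z * (p y / v)))
      ≤ energyTestDw g1 ρ k p' z w * av := by
    have hC0 : 0 ≤ C0 := by
      have : 0 ≤ (1 + g1 + Λ) * C1 * (κ * g1) := by positivity
      linarith
    calc C0 * (primitiveG g A * (z ^ g1 * z * (p y / v)))
        = (z ^ g1 * z * (p y / v)) * (C0 * primitiveG g A) := by ring
      _ ≤ energyTestDw g1 ρ k p' z w * (C0 * primitiveG g A) :=
          mul_le_mul_of_nonneg_right hdw (by positivity)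
      _ ≤ _ := mul_le_mul_of_nonneg_left hav (hq0.trans hdw)
  -- the mixed term
  have hdz : energyTestDz g1 ρ k p p' z w = z ^ g1 * ((1 + g1) * p y + y * p' y) := by
    have e : z * (v / ρ) = y := by rw [hy]; ring
    simp only [energyTestDz, ← hv, ← hy]
    rw [mul_assoc g1, rpow_sub_one_mul_self hz h1]
    calc _ = z ^ g1 * ((1 + g1) * p y + (z * (v / ρ)) * p' y) := by ring
      _ = _ := by rw [e]
  have hdz0 : 0 ≤ energyTestDz g1 ρ k p p' z w := by
    rw [hdz]
    have : 0 ≤ y * p' y := hpn.trans hpl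
    positivity
  have hdz1 : energyTestDz g1 ρ k p p' z w ≤ (1 + g1 + Λ) * (z ^ g1 * p y) := by
    rw [hdz]
    nlinarith
  have hyoung := hg.mul_le_young (B := D * v / z) hκ hκ1 hA (by positivity) (by linarith)
  have hscale : primitiveG g (D * v / z) ≤ z ^ (-(2 * g1)) * primitiveG g (D * z * v) := by
    have e : D * v / z = (z ^ 2)⁻¹ * (D * z * v) := by field_simp
    have h2 := hg.primitiveG_mul_le (l := (z ^ 2)⁻¹) (y := D * z * v)
      ((one_le_inv₀ (by positivity)).mpr (by nlinarith)) (by positivity)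
    rw [e]
    refine h2.trans_eq ?_
    congr 1
    rw [Real.inv_rpow (by positivity), ← Real.rpow_natCast, ← Real.rpow_mul hz, Real.rpow_neg hz]
    norm_num
  have hGD : 0 ≤ primitiveG g (D * z * v) := hg.primitiveG_nonneg (by positivity)
  have hexp : z ^ g1 * z * z ^ (-(2 * g1)) ≤ z ^ (-g1) := by
    have e : z ^ g1 * z * z ^ (-(2 * g1)) = z ^ (-g1) * z := by
      rw [mul_right_comm, ← Real.rpow_add hz0]
      congr 2; ring
    rw [e]
    exact mul_le_of_le_one_right (Real.rpow_nonneg hz _) hz1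
  set c := κ * g1 * (κ⁻¹) ^ g1 with hc
  have hc0 : 0 ≤ c := by positivity
  have hmix : z ^ g1 * p y * (g A * D) ≤
      κ * g1 * (primitiveG g A * (z ^ g1 * z * (p y / v)))
        + c * (primitiveG g (D * z * v) * (p y / v) * z ^ (-g1)) := by
    have e : z ^ g1 * p y * (g A * D) = z ^ g1 * z * (p y / v) * (g A * (D * v / z)) := by
      field_simp
    rw [e]
    have h2 : z ^ g1 * z * (p y / v) * (g A * (D * v / z)) ≤ z ^ g1 * z * (p y / v) *
        (κ * g1 * primitiveG g A + c * (z ^ (-(2 * g1)) * primitiveG g (D * z * v))) := by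
      apply mul_le_mul_of_nonneg_left _ hq0
      refine hyoung.trans ?_
      gcongr
    refine h2.trans ?_
    have h3 : z ^ g1 * z * z ^ (-(2 * g1)) * (c * (primitiveG g (D * z * v) * (p y / v))) ≤
        z ^ (-g1) * (c * (primitiveG g (D * z * v) * (p y / v))) :=
      mul_le_mul_of_nonneg_right hexp (by positivity)
    calc _ = κ * g1 * (primitiveG g A * (z ^ g1 * z * (p y / v))) +
          z ^ g1 * z * z ^ (-(2 * g1)) * (c * (primitiveG g (D * z * v) * (p y / v))) := by ring
      _ ≤ κ * g1 * (primitiveG g A * (z ^ g1 * z * (p y / v))) +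
          z ^ (-g1) * (c * (primitiveG g (D * z * v) * (p y / v))) := by linarith
      _ = _ := by ring
  have hgA := hg.nonneg A hA
  have hmixed : -(energyTestDz g1 ρ k p p' z w * ad) ≤
      (1 + g1 + Λ) * C1 * (z ^ g1 * p y * (g A * D)) := by
    calc -(energyTestDz g1 ρ k p p' z w * ad) = energyTestDz g1 ρ k p p' z w * (-ad) := by ring
      _ ≤ energyTestDz g1 ρ k p p' z w * (C1 * g A * D) :=
          mul_le_mul_of_nonneg_left ((neg_le_abs ad).trans had) hdz0
      _ ≤ (1 + g1 + Λ) * (z ^ g1 * p y) * (C1 * g A * D) :=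
          mul_le_mul_of_nonneg_right hdz1 (by positivity)
      _ = _ := by ring
  have hm2 := mul_le_mul_of_nonneg_left hmix hCp
  have hX : 0 ≤ primitiveG g A * (z ^ g1 * z * (p y / v)) := mul_nonneg hGA hq0
  have hm3 := mul_le_mul_of_nonneg_right hκC hX
  have hring : (1 + g1 + Λ) * C1 * (κ * g1 * (primitiveG g A * (z ^ g1 * z * (p y / v)))
        + c * (primitiveG g (D * z * v) * (p y / v) * z ^ (-g1)))
      = (1 + g1 + Λ) * C1 * (κ * g1) * (primitiveG g A * (z ^ g1 * z * (p y / v)))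
        + (1 + g1 + Λ) * C1 * c * (primitiveG g (D * z * v) * (p y / v) * z ^ (-g1)) := by ring
  rw [hring] at hm2
  linarith

end WeightedIntegrand

/-- A nonincreasing `C¹` function of time equal to `1` before `c` and to `0` after `d`. -/
structure IsTimeCutoff (c d : ℝ) (χ χ' : ℝ → ℝ) : Prop where
  lipschitz : ∃ C, LipschitzWith C χ
  hasDerivAt : ∀ t, HasDerivAt χ (χ' t) t
  continuous_deriv : Continuous χ'
  nonneg : ∀ t, 0 ≤ χ t
  le_one : ∀ t, χ t ≤ 1
  deriv_nonpos : ∀ t, χ' t ≤ 0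
  eq_one : ∀ t ≤ c, χ t = 1
  eq_zero : ∀ t, d ≤ t → χ t = 0
  deriv_eq_zero_of_lt : ∀ t < c, χ' t = 0
  deriv_eq_zero_of_gt : ∀ t, d < t → χ' t = 0

lemma exists_isTimeCutoff {c d : ℝ} (hcd : c < d) : ∃ χ χ' : ℝ → ℝ, IsTimeCutoff c d χ χ' := by
  set f : ℝ → ℝ := fun t => Real.smoothTransition ((d - t) / (d - c)) with hf
  have hpos : 0 < d - c := sub_pos.mpr hcd
  have hcd1 : ContDiff ℝ 1 f :=
    Real.smoothTransition.contDiff.comp ((contDiff_const.sub contDiff_id).div_const _)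
  have hd : ∀ t, HasDerivAt f (deriv f t) t := fun t =>
    (hcd1.differentiable one_ne_zero t).hasDerivAt
  have hcont : Continuous (deriv f) := hcd1.continuous_deriv_one
  have hone : ∀ t ≤ c, f t = 1 := fun t ht =>
    Real.smoothTransition.one_of_one_le (by rw [le_div_iff₀ hpos]; linarith)
  have hzero : ∀ t, d ≤ t → f t = 0 := fun t ht =>
    Real.smoothTransition.zero_of_nonpos (div_nonpos_of_nonpos_of_nonneg (by linarith) hpos.le)
  have hanti : Antitone f := fun s t hst =>
    Real.smoothTransition.monotone (by gcongr)
  have hlt : ∀ t < c, deriv f t = 0 := by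
    intro t ht
    have : f =ᶠ[𝓝 t] fun _ => 1 := by
      filter_upwards [Iio_mem_nhds ht] with x hx using hone x (mem_Iio.mp hx).le
    rw [this.deriv_eq]; simp
  have hgt : ∀ t, d < t → deriv f t = 0 := by
    intro t ht
    have : f =ᶠ[𝓝 t] fun _ => 0 := by
      filter_upwards [Ioi_mem_nhds ht] with x hx using hzero x (mem_Ioi.mp hx).le
    rw [this.deriv_eq]; simp
  refine ⟨f, deriv f, ?_, hd, hcont, fun t => Real.smoothTransition.nonneg _,
    fun t => Real.smoothTransition.le_one _, fun t => hanti.deriv_nonpos, hone, hzero, hlt, hgt⟩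
  obtain ⟨B, hB⟩ := (isCompact_Icc (a := c) (b := d)).exists_bound_of_continuousOn
    hcont.continuousOn
  refine ⟨Real.toNNReal B, lipschitzWith_of_nnnorm_deriv_le
    (hcd1.differentiable one_ne_zero) fun t => ?_⟩
  rw [← NNReal.coe_le_coe, coe_nnnorm, Real.coe_toNNReal']
  rcases lt_or_ge t c with h | h
  · rw [hlt t h, norm_zero]; exact le_max_right _ _
  rcases lt_or_ge d t with h' | h'
  · rw [hgt t h', norm_zero]; exact le_max_right _ _
  exact (hB t ⟨h, h'⟩).trans (le_max_left _ _)

section EnergyInequality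

variable {N : ℕ}

/-- A globally Lipschitz cutoff with values in `[0,1]`, compactly supported in `K × (t0,∞)` and
nondecreasing in time on `K × (t0,t1)`. -/
structure IsCutoff (K : Set (EuclideanSpace ℝ (Fin N))) (t0 t1 : ℝ)
    (ζ : EuclideanSpace ℝ (Fin N) × ℝ → ℝ) : Prop where
  lipschitz : ∃ C, LipschitzWith C ζ
  hasCompactSupport : HasCompactSupport ζ
  tsupport_subset : tsupport ζ ⊆ K ×ˢ Ioi t0
  nonneg : ∀ q, 0 ≤ ζ q
  le_one : ∀ q, ζ q ≤ 1
  deriv_nonneg : ∀ q ∈ K ×ˢ Ioo t0 t1, 0 ≤ fderiv ℝ ζ q (0, 1)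

/-- The weighted energy of the gradient. -/
noncomputable def gradTerm (g : ℝ → ℝ) (g1 ρ k : ℝ) (p : ℝ → ℝ)
    (ζ u : EuclideanSpace ℝ (Fin N) × ℝ → ℝ)
    (V : EuclideanSpace ℝ (Fin N) × ℝ → EuclideanSpace ℝ (Fin N))
    (q : EuclideanSpace ℝ (Fin N) × ℝ) : ℝ :=
  primitiveG g ‖V q‖ * (ζ q ^ g1 * ζ q * (p (ζ q * (u q - k) / ρ) / (u q - k)))

/-- The term that carries the time derivative of the cutoff. -/
noncomputable def timeTerm (g1 ρ k : ℝ) (p : ℝ → ℝ) (ζ u : EuclideanSpace ℝ (Fin N) × ℝ → ℝ)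
    (q : EuclideanSpace ℝ (Fin N) × ℝ) : ℝ :=
  ζ q ^ g1 * ((u q - k) * p (ζ q * (u q - k) / ρ)) * fderiv ℝ ζ q (0, 1)

/-- The term that carries the spatial gradient of the cutoff. -/
noncomputable def cutTerm (g : ℝ → ℝ) (g1 ρ k : ℝ) (p : ℝ → ℝ)
    (ζ u : EuclideanSpace ℝ (Fin N) × ℝ → ℝ) (q : EuclideanSpace ℝ (Fin N) × ℝ) : ℝ :=
  primitiveG g (‖(fderiv ℝ ζ q).comp (ContinuousLinearMap.inl ℝ (EuclideanSpace ℝ (Fin N)) ℝ)‖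
    * ζ q * (u q - k)) * (p (ζ q * (u q - k) / ρ) / (u q - k)) * ζ q ^ (-g1)

section Nonneg

variable {Λ g1 ρ k : ℝ} {p p' : ℝ → ℝ} {z w : ℝ}

lemma IsWeight.mul_nonneg (hp : IsWeight Λ p p') (hρ : 0 < ρ) (hz : 0 ≤ z) :
    0 ≤ w * p (z * w / ρ) := by
  rcases le_or_gt w 0 with h | h
  · rw [hp.eq_zero _ (div_nonpos_of_nonpos_of_nonneg (mul_nonpos_of_nonneg_of_nonpos hz h) hρ.le)]
    simp
  · exact _root_.mul_nonneg h.le (hp.nonneg _)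

lemma IsWeight.div_nonneg (hp : IsWeight Λ p p') (hρ : 0 < ρ) (hz : 0 ≤ z) :
    0 ≤ p (z * w / ρ) / w := by
  rcases le_or_gt w 0 with h | h
  · rw [hp.eq_zero _ (div_nonpos_of_nonpos_of_nonneg (mul_nonpos_of_nonneg_of_nonpos hz h) hρ.le)]
    simp
  · exact _root_.div_nonneg (hp.nonneg _) h.le

end Nonneg

variable {Λ g0 g1 ρ k C0 C1 κ : ℝ} {g p p' : ℝ → ℝ} {K : Set (EuclideanSpace ℝ (Fin N))}
  {t0 t1 : ℝ} {ζ u : EuclideanSpace ℝ (Fin N) × ℝ → ℝ}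
  {V : EuclideanSpace ℝ (Fin N) × ℝ → EuclideanSpace ℝ (Fin N)}

lemma gradTerm_nonneg (hg : IsStructureFunction g0 g1 g) (hp : IsWeight Λ p p') (hρ : 0 < ρ)
    (hζ : IsCutoff K t0 t1 ζ) (q : EuclideanSpace ℝ (Fin N) × ℝ) :
    0 ≤ gradTerm g g1 ρ k p ζ u V q := by
  have h1 := hp.div_nonneg (w := u q - k) hρ (hζ.nonneg q)
  have h2 := hg.primitiveG_nonneg (norm_nonneg (V q))
  have h3 := hζ.nonneg q
  unfold gradTerm
  positivity

lemma timeTerm_nonneg (hp : IsWeight Λ p p') (hρ : 0 < ρ) (hζ : IsCutoff K t0 t1 ζ)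
    {q : EuclideanSpace ℝ (Fin N) × ℝ} (hq : q ∈ K ×ˢ Ioo t0 t1) :
    0 ≤ timeTerm g1 ρ k p ζ u q := by
  have h1 := hp.mul_nonneg (w := u q - k) hρ (hζ.nonneg q)
  have h3 := hζ.nonneg q
  have h4 := hζ.deriv_nonneg q hq
  unfold timeTerm
  exact mul_nonneg (mul_nonneg (Real.rpow_nonneg h3 _) h1) h4

lemma cutTerm_nonneg (hg : IsStructureFunction g0 g1 g) (hp : IsWeight Λ p p') (hρ : 0 < ρ)
    (hζ : IsCutoff K t0 t1 ζ) (q : EuclideanSpace ℝ (Fin N) × ℝ) :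
    0 ≤ cutTerm g g1 ρ k p ζ u q := by
  have h3 := hζ.nonneg q
  unfold cutTerm
  rcases le_or_gt (u q - k) 0 with h | h
  · rw [hp.eq_zero _ (div_nonpos_of_nonpos_of_nonneg (mul_nonpos_of_nonneg_of_nonpos h3 h) hρ.le)]
    simp
  · have h1 := hp.div_nonneg (w := u q - k) hρ (hζ.nonneg q)
    have h2 : 0 ≤ primitiveG g (‖(fderiv ℝ ζ q).comp
        (ContinuousLinearMap.inl ℝ (EuclideanSpace ℝ (Fin N)) ℝ)‖ * ζ q * (u q - k)) :=
      hg.primitiveG_nonneg (by positivity)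
    positivity

lemma IntegrableOn.mul_time {Q : Set (EuclideanSpace ℝ (Fin N) × ℝ)}
    {f : EuclideanSpace ℝ (Fin N) × ℝ → ℝ} (hf : IntegrableOn f Q) {χ : ℝ → ℝ} (hχ : Continuous χ)
    (h1 : ∀ t, |χ t| ≤ 1) : IntegrableOn (fun q => f q * χ q.2) Q := by
  refine Integrable.mono' hf.norm
    (hf.aestronglyMeasurable.mul (hχ.comp continuous_snd).aestronglyMeasurable)
    (Eventually.of_forall fun q => ?_)
  rw [norm_mul]
  exact mul_le_of_le_one_right (norm_nonneg _) (h1 q.2)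

/-- The energy inequality for a fixed weight and a fixed time cutoff. -/
lemma energy_inequality (hg : IsStructureFunction g0 g1 g) (hp : IsWeight Λ p p') (hΛ : 0 ≤ Λ)
    (h1 : 1 < g1) (hρ : 0 < ρ) (hC1 : 0 < C1)
    (hκ : 0 < κ) (hκ1 : κ ≤ 1) (hκC : (1 + g1 + Λ) * C1 * (κ * g1) ≤ C0 / 2)
    (hK : IsOpen K) (hKb : Bornology.IsBounded K)
    {a : EuclideanSpace ℝ (Fin N) × ℝ → EuclideanSpace ℝ (Fin N)}
    {u0 : EuclideanSpace ℝ (Fin N) × ℝ → ℝ}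
    (hs : IsDistributionalSolution (K ×ˢ Ioo t0 t1) u0 V a)
    (hab : ∀ᵐ q ∂(volume.restrict (K ×ˢ Ioo t0 t1)),
      C0 * primitiveG g ‖V q‖ ≤ inner ℝ (a q) (V q) ∧ ‖a q‖ ≤ C1 * g ‖V q‖)
    (hGi : IntegrableOn (fun q => primitiveG g ‖V q‖) (K ×ˢ Ioo t0 t1))
    (hζ : IsCutoff K t0 t1 ζ) (hu : Continuous u)
    (hu0 : ∀ q ∈ K ×ˢ Ioo t0 t1, ζ q ≠ 0 → u0 q = u q)
    (hgrad : IntegrableOn (gradTerm g g1 ρ k p ζ u V) (K ×ˢ Ioo t0 t1))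
    (htime : IntegrableOn (timeTerm g1 ρ k p ζ u) (K ×ˢ Ioo t0 t1))
    (hcut : IntegrableOn (cutTerm g g1 ρ k p ζ u) (K ×ˢ Ioo t0 t1))
    {c d : ℝ} {χ χ' : ℝ → ℝ} (hχ : IsTimeCutoff c d χ χ') (hd : d < t1) :
    C0 / 2 * (∫ q in K ×ˢ Ioo t0 t1, gradTerm g g1 ρ k p ζ u V q * χ q.2)
      - (∫ q in K ×ˢ Ioo t0 t1, energyDensity g1 ρ k p (ζ q) (u q) * χ' q.2)
      ≤ (g1 + 1) * (∫ q in K ×ˢ Ioo t0 t1, timeTerm g1 ρ k p ζ u q)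
        + (1 + g1 + Λ) * C1 * (κ * g1 * (κ⁻¹) ^ g1) *
          (∫ q in K ×ˢ Ioo t0 t1, cutTerm g g1 ρ k p ζ u q) := by
  set Q := K ×ˢ Ioo t0 t1 with hQ
  have hQo : IsOpen Q := hK.prod isOpen_Ioo
  have hQm := hQo.measurableSet
  have hQb : Bornology.IsBounded Q := hKb.prod (Metric.isBounded_Ioo t0 t1)
  have hg1 : 0 < g1 := by linarith
  obtain ⟨Cζ, hζL⟩ := hζ.lipschitz
  obtain ⟨Cχ, hχL⟩ := hχ.lipschitz
  have hζ1 : ∀ q, |ζ q| ≤ 1 := fun q => by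
    rw [abs_of_nonneg (hζ.nonneg q)]; exact hζ.le_one q
  have hχ1 : ∀ t, |χ t| ≤ 1 := fun t => by
    rw [abs_of_nonneg (hχ.nonneg t)]; exact hχ.le_one t
  have hH := isEnergyIntegrand_energyDensity (k := k) hp h1 hρ.ne'
  set S := tsupport ζ ∩ {q : EuclideanSpace ℝ (Fin N) × ℝ | q.2 ≤ d} with hS
  have hSc : IsCompact S :=
    hζ.hasCompactSupport.inter_right (isClosed_le continuous_snd continuous_const)
  have hSQ : S ⊆ Q := fun q hq =>
    ⟨(hζ.tsupport_subset hq.1).1, (hζ.tsupport_subset hq.1).2, lt_of_le_of_lt hq.2 hd⟩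
  have hSζ : ∀ q : EuclideanSpace ℝ (Fin N) × ℝ, ζ q ≠ 0 → (χ q.2 ≠ 0 ∨ χ' q.2 ≠ 0) → q ∈ S := by
    intro q hq1 hq2
    refine ⟨subset_closure hq1, ?_⟩
    by_contra hlt
    have hlt' : d < q.2 := not_le.mp hlt
    rcases hq2 with h | h
    · exact h (hχ.eq_zero _ hlt'.le)
    · exact h (hχ.deriv_eq_zero_of_gt _ hlt')
  set W : EuclideanSpace ℝ (Fin N) × ℝ → ℝ := fun q =>
    C1 * (g1 * primitiveG g ‖V q‖ + g1 * primitiveG g 1) with hW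
  have hWi : IntegrableOn W Q :=
    ((hGi.const_mul g1).add (integrableOn_const hQb.measure_lt_top.ne)).const_mul C1
  have haW : ∀ᵐ q ∂(volume.restrict Q), ‖a q‖ ≤ W q := by
    filter_upwards [hab] with q hq
    exact hq.2.trans (mul_le_mul_of_nonneg_left (hg.le_add_primitiveG hg1 (norm_nonneg _)) hC1.le)
  have hG1 := hg.primitiveG_nonneg zero_le_one
  have haVW' : ∀ᵐ q ∂(volume.restrict Q), ∀ z, ‖a q‖ * ‖V z‖ ≤ W q + W z := by
    filter_upwards [hab] with q hq z
    have h2 := hg.mul_le_add hg1 (norm_nonneg (V q)) (norm_nonneg (V z))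
    have h3 : ‖a q‖ * ‖V z‖ ≤ C1 * (g ‖V q‖ * ‖V z‖) := by
      rw [← mul_assoc]; exact mul_le_mul_of_nonneg_right hq.2 (norm_nonneg _)
    have h4 := mul_le_mul_of_nonneg_left h2 hC1.le
    have h5 : 0 ≤ C1 * (g1 * primitiveG g 1) := by positivity
    simp only [hW]
    nlinarith
  have key := hs.energy_identity hQo hQb hWi haW
    (haVW'.mono fun q hq => Eventually.of_forall hq) hH hζL hζ1 hχL hχ1 hχ.hasDerivAt
    hχ.continuous_deriv hSc hSQ hSζ
  have hcongr : ∀ f : ℝ → ℝ → ℝ, (∀ w, f 0 w = 0) → ∀ q ∈ Q, f (ζ q) (u0 q) = f (ζ q) (u q) := by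
    intro f hf q hq
    by_cases h0 : ζ q = 0
    · rw [h0, hf, hf]
    · rw [hu0 q hq h0]
  have hbdd : ∀ f : ℝ → ℝ → ℝ, (∀ w, f 0 w = 0) → Continuous (fun q : ℝ × ℝ => f q.1 q.2) →
      Continuous (fun q => f (ζ q) (u q)) ∧ HasCompactSupport (fun q => f (ζ q) (u q)) := by
    intro f hf hfc
    refine ⟨hfc.comp (hζL.continuous.prodMk hu), ?_⟩
    refine HasCompactSupport.intro hζ.hasCompactSupport fun q hq => ?_
    rw [image_eq_zero_of_notMem_tsupport hq, hf]
  have hχc : Continuous fun q : EuclideanSpace ℝ (Fin N) × ℝ => χ q.2 :=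
    hχL.continuous.comp continuous_snd
  obtain ⟨hcHz, hsHz⟩ := hbdd _ hH.Hz_zero hH.continuous_Hz
  obtain ⟨hcH, hsH⟩ := hbdd _ hH.H_zero hH.continuous_H
  obtain ⟨hchz, hshz⟩ := hbdd _ hH.hz_zero hH.continuous_hz
  obtain ⟨hchw, hshw⟩ := hbdd _ hH.hw_zero hH.continuous_hw
  set F1 : EuclideanSpace ℝ (Fin N) × ℝ → ℝ := fun q =>
    energyDensityDz g1 ρ k p (ζ q) (u q) * fderiv ℝ ζ q (0, 1) * χ q.2 with hF1
  set F2 : EuclideanSpace ℝ (Fin N) × ℝ → ℝ := fun q =>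
    energyDensity g1 ρ k p (ζ q) (u q) * χ' q.2 with hF2
  set R : EuclideanSpace ℝ (Fin N) × ℝ → ℝ := fun q =>
    (energyTestDz g1 ρ k p p' (ζ q) (u q) * fderiv ℝ ζ q (a q, 0)
        + energyTestDw g1 ρ k p' (ζ q) (u q) * inner ℝ (a q) (V q)) * χ q.2 with hR
  have key2 : ∫ q in Q, (F1 q + F2 q) = ∫ q in Q, R q := by
    have e1 : ∫ q in Q, (F1 q + F2 q) = ∫ q in Q, (energyDensityDz g1 ρ k p (ζ q) (u0 q) *
        fderiv ℝ ζ q (0, 1) * χ q.2 + energyDensity g1 ρ k p (ζ q) (u0 q) * χ' q.2) := by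
      refine setIntegral_congr_fun hQm fun q hq => ?_
      simp only [hF1, hF2, hcongr _ hH.Hz_zero q hq, hcongr _ hH.H_zero q hq]
    rw [e1, key]
    refine setIntegral_congr_fun hQm fun q hq => ?_
    simp only [hR, hcongr _ hH.hz_zero q hq, hcongr _ hH.hw_zero q hq]
  have hF2i : IntegrableOn F2 Q := by
    apply Integrable.integrableOn
    apply Continuous.integrable_of_hasCompactSupport
    · exact hcH.mul (hχ.continuous_deriv.comp continuous_snd)
    · exact hsH.mul_right
  have hF1i : IntegrableOn F1 Q := by
    have hi : IntegrableOn (fun q => energyDensityDz g1 ρ k p (ζ q) (u q)) Q :=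
      (hcHz.integrable_of_hasCompactSupport hsHz).integrableOn
    refine IntegrableOn.mul_time ?_ hχL.continuous hχ1
    refine Integrable.mono' (hi.norm.mul_const Cζ) (hi.aestronglyMeasurable.mul
      (measurable_fderiv_apply_const ℝ ζ (0, 1)).aestronglyMeasurable)
      (Eventually.of_forall fun q => ?_)
    rw [norm_mul]
    apply mul_le_mul_of_nonneg_left _ (norm_nonneg _)
    have h2 := (fderiv ℝ ζ q).le_opNorm (0, 1)
    have h5 : ‖((0, 1) : EuclideanSpace ℝ (Fin N) × ℝ)‖ = 1 := by simp [Prod.norm_def]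
    rw [h5, mul_one] at h2
    exact h2.trans (norm_fderiv_le_of_lipschitz ℝ hζL)
  have hRi : IntegrableOn R Q := by
    obtain ⟨B3, hB3⟩ := hshz.exists_bound_of_continuous hchz
    obtain ⟨B4, hB4⟩ := hshw.exists_bound_of_continuous hchw
    refine IntegrableOn.mul_time (Integrable.add ?_ ?_) hχL.continuous hχ1
    · refine Integrable.mono' (hWi.const_mul (B3 * Cζ)) (hchz.aestronglyMeasurable.mul
        (aestronglyMeasurable_fderiv_apply hs.integrableOn_flux.aestronglyMeasurable)) ?_
      filter_upwards [haW] with q hq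
      rw [norm_mul, mul_assoc]
      have hB30 : 0 ≤ B3 := (norm_nonneg _).trans (hB3 q)
      refine mul_le_mul (hB3 q) ((norm_fderiv_apply_space_le hζL q (a q)).trans ?_)
        (norm_nonneg _) hB30
      gcongr
    · refine Integrable.mono' ((hWi.const_mul 2).const_mul B4) (hchw.aestronglyMeasurable.mul
        (hs.integrableOn_flux.aestronglyMeasurable.inner
          hs.integrableOn_grad.aestronglyMeasurable)) ?_
      filter_upwards [haVW'] with q hq
      rw [norm_mul]
      refine mul_le_mul (hB4 q) ?_ (norm_nonneg _) ((norm_nonneg _).trans (hB4 q))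
      have := hq q
      rw [two_mul]
      exact (norm_inner_le_norm _ _).trans this
  have hgχ := IntegrableOn.mul_time hgrad hχL.continuous hχ1
  have hcχ := IntegrableOn.mul_time hcut hχL.continuous hχ1
  set Cc := (1 + g1 + Λ) * C1 * (κ * g1 * (κ⁻¹) ^ g1) with hCc
  have hCc0 : 0 ≤ Cc := by positivity
  have hle1 : C0 / 2 * (∫ q in Q, gradTerm g g1 ρ k p ζ u V q * χ q.2)
      - Cc * (∫ q in Q, cutTerm g g1 ρ k p ζ u q * χ q.2) ≤ ∫ q in Q, R q := by
    rw [← integral_const_mul, ← integral_const_mul,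
      ← integral_sub (hgχ.const_mul _) (hcχ.const_mul _)]
    refine integral_mono_ae ((hgχ.const_mul _).sub (hcχ.const_mul _)) hRi ?_
    filter_upwards [hab] with q hq
    have hnorm : |fderiv ℝ ζ q (a q, 0)| ≤ C1 * g ‖V q‖ * ‖(fderiv ℝ ζ q).comp
        (ContinuousLinearMap.inl ℝ (EuclideanSpace ℝ (Fin N)) ℝ)‖ := by
      have h2 := ((fderiv ℝ ζ q).comp
        (ContinuousLinearMap.inl ℝ (EuclideanSpace ℝ (Fin N)) ℝ)).le_opNorm (a q)
      simp only [ContinuousLinearMap.comp_apply, ContinuousLinearMap.inl_apply,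
        Real.norm_eq_abs] at h2
      refine h2.trans ?_
      rw [mul_comm]
      exact mul_le_mul_of_nonneg_right hq.2 (norm_nonneg _)
    have h2 := elliptic_part_ge (k := k) (w := u q) hg hp hΛ h1 hρ hC1 hκ hκ1 hκC (hζ.nonneg q)
      (hζ.le_one q) (norm_nonneg (V q)) (norm_nonneg _) hq.1 hnorm
    have h3 := mul_le_mul_of_nonneg_right h2 (hχ.nonneg q.2)
    simp only [hR, gradTerm, cutTerm]
    refine le_trans (le_of_eq ?_) h3
    ring
  have hle2 : ∫ q in Q, F1 q ≤ (g1 + 1) * ∫ q in Q, timeTerm g1 ρ k p ζ u q := by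
    rw [← integral_const_mul]
    refine setIntegral_mono_on hF1i (htime.const_mul _) hQm fun q hq => ?_
    have h2 := energyDensityDz_le (k := k) hp h1 hρ (hζ.nonneg q) (u q)
    have h3 := mul_le_mul_of_nonneg_right h2 (hζ.deriv_nonneg q hq)
    have h4 : (g1 + 1) * timeTerm g1 ρ k p ζ u q = (g1 + 1) * (ζ q ^ g1 * ((u q - k) *
        p (ζ q * (u q - k) / ρ))) * fderiv ℝ ζ q (0, 1) := by unfold timeTerm; ring
    have h5 : 0 ≤ timeTerm g1 ρ k p ζ u q := timeTerm_nonneg hp hρ hζ hq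
    have h6 : F1 q ≤ (g1 + 1) * timeTerm g1 ρ k p ζ u q * χ q.2 := by
      rw [h4]
      exact mul_le_mul_of_nonneg_right h3 (hχ.nonneg _)
    exact h6.trans (mul_le_of_le_one_right (by positivity) (hχ.le_one _))
  have hle3 : ∫ q in Q, cutTerm g g1 ρ k p ζ u q * χ q.2 ≤ ∫ q in Q, cutTerm g g1 ρ k p ζ u q := by
    refine integral_mono hcχ hcut fun q => ?_
    exact mul_le_of_le_one_right (cutTerm_nonneg hg hp hρ hζ q) (hχ.le_one _)
  rw [integral_add hF1i hF2i] at key2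
  have := mul_le_mul_of_nonneg_left hle3 hCc0
  linarith

end EnergyInequality

section TimeSlices

variable {N : ℕ} {K : Set (EuclideanSpace ℝ (Fin N))} {t0 t1 c0 R : ℝ}
  {D e : EuclideanSpace ℝ (Fin N) × ℝ → ℝ}

lemma continuous_integral_slice (hD : Continuous D) (hDc : HasCompactSupport D) :
    Continuous fun t => ∫ x, D (x, t) := by
  have hsK : IsCompact (Prod.fst '' tsupport D) := hDc.image continuous_fst
  have h : ∀ t, ∫ x, D (x, t) = ∫ x in Prod.fst '' tsupport D, D (x, t) := by
    intro t
    rw [setIntegral_eq_integral_of_forall_compl_eq_zero]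
    intro x hx
    apply image_eq_zero_of_notMem_tsupport
    exact fun h => hx ⟨(x, t), h, rfl⟩
  simp_rw [h]
  have hD' : Continuous (Function.uncurry fun (t : ℝ) (x : EuclideanSpace ℝ (Fin N)) => D (x, t)) :=
    hD.comp continuous_swap
  exact continuous_parametric_integral_of_continuous hD' hsK

/-- A bound for all time cutoffs gives a bound for every time slice. -/
lemma integral_slice_le (hK : IsOpen K) (hD : Continuous D) (hDc : HasCompactSupport D)
    (hDK : tsupport D ⊆ K ×ˢ Ioi t0) (hc0 : 0 ≤ c0) (he : ∀ q, 0 ≤ e q)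
    (hE : ∀ c d χ χ', IsTimeCutoff c d χ χ' → d < t1 →
      c0 * (∫ q in K ×ˢ Ioo t0 t1, e q * χ q.2) - (∫ q in K ×ˢ Ioo t0 t1, D q * χ' q.2) ≤ R)
    {t : ℝ} (ht : t ∈ Ioc t0 t1) : ∫ x in K, D (x, t) ≤ R := by
  have hKm := hK.measurableSet
  have hJK : ∀ τ, ∫ x in K, D (x, τ) = ∫ x, D (x, τ) := by
    intro τ
    rw [setIntegral_eq_integral_of_forall_compl_eq_zero]
    intro x hx
    exact image_eq_zero_of_notMem_tsupport fun h => hx (hDK h).1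
  have hJc := continuous_integral_slice hD hDc
  rw [hJK]
  by_contra hlt
  rw [not_le] at hlt
  set J : ℝ → ℝ := fun τ => ∫ x, D (x, τ) with hJ
  obtain ⟨R', hR1, hR2⟩ := exists_between hlt
  have hnhds : ∀ᶠ τ in 𝓝 t, R' < J τ := hJc.continuousAt.eventually (Ioi_mem_nhds hR2)
  obtain ⟨ε, hε, hball⟩ := Metric.eventually_nhds_iff.mp hnhds
  obtain ⟨c, hc1, hc2⟩ := exists_between (max_lt (by linarith : t - ε < t) ht.1)
  obtain ⟨d, hd1, hd2⟩ := exists_between hc2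
  obtain ⟨χ, χ', hχ⟩ := exists_isTimeCutoff hd1
  have hct0 : t0 < c := (le_max_right _ _).trans_lt hc1
  have hdt1 : d < t1 := hd2.trans_le ht.2
  have h1 := hE c d χ χ' hχ hdt1
  have h2 : 0 ≤ c0 * (∫ q in K ×ˢ Ioo t0 t1, e q * χ q.2) :=
    mul_nonneg hc0 (integral_nonneg fun q => mul_nonneg (he q) (hχ.nonneg _))
  have hDχ : IntegrableOn (fun q : EuclideanSpace ℝ (Fin N) × ℝ => D q * χ' q.2)
      (K ×ˢ Ioo t0 t1) := by
    apply Integrable.integrableOn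
    apply Continuous.integrable_of_hasCompactSupport
    · exact hD.mul (hχ.continuous_deriv.comp continuous_snd)
    · exact hDc.mul_right
  have h3 : ∫ q in K ×ˢ Ioo t0 t1, D q * χ' q.2 = ∫ τ in t0..t1, J τ * χ' τ := by
    rw [← intervalIntegral_setIntegral_eq (F := fun x τ => D (x, τ) * χ' τ)
      (ht.1.le.trans ht.2) hDχ]
    simp_rw [integral_mul_const, hJK]
    rfl
  have h4 : ∫ τ in t0..t1, J τ * χ' τ ≤ ∫ τ in t0..t1, R' * χ' τ := by
    refine intervalIntegral.integral_mono_on (ht.1.le.trans ht.2)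
      ((hJc.mul hχ.continuous_deriv).intervalIntegrable _ _)
      ((continuous_const.mul hχ.continuous_deriv).intervalIntegrable _ _) fun τ _ => ?_
    rcases lt_or_ge τ c with h | h
    · simp [hχ.deriv_eq_zero_of_lt τ h]
    rcases lt_or_ge d τ with h' | h'
    · simp [hχ.deriv_eq_zero_of_gt τ h']
    have hτ : R' < J τ := by
      apply hball
      have : t - ε < c := (le_max_left _ _).trans_lt hc1
      rw [Real.dist_eq, abs_lt]
      constructor <;> linarith
    exact mul_le_mul_of_nonpos_right hτ.le (hχ.deriv_nonpos τ)
  have h5 : ∫ τ in t0..t1, R' * χ' τ = -R' := by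
    rw [intervalIntegral.integral_const_mul, intervalIntegral.integral_eq_sub_of_hasDerivAt
      (fun τ _ => hχ.hasDerivAt τ) (hχ.continuous_deriv.intervalIntegrable _ _),
      hχ.eq_one t0 hct0.le, hχ.eq_zero t1 hdt1.le]
    ring
  linarith

/-- A bound for all time cutoffs gives a bound without cutoff. -/
lemma setIntegral_le_of_forall_timeCutoff (hK : IsOpen K) (hDn : ∀ q, 0 ≤ D q)
    (hei : IntegrableOn e (K ×ˢ Ioo t0 t1))
    (hE : ∀ c d χ χ', IsTimeCutoff c d χ χ' → d < t1 →
      c0 * (∫ q in K ×ˢ Ioo t0 t1, e q * χ q.2) - (∫ q in K ×ˢ Ioo t0 t1, D q * χ' q.2) ≤ R) :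
    c0 * ∫ q in K ×ˢ Ioo t0 t1, e q ≤ R := by
  have hQm : MeasurableSet (K ×ˢ Ioo t0 t1) := (hK.prod isOpen_Ioo).measurableSet
  have hpos : ∀ n : ℕ, (0 : ℝ) < 1 / ((n : ℝ) + 1) := fun n => by positivity
  have hlt : ∀ n : ℕ, t1 - 2 * (1 / ((n : ℝ) + 1)) < t1 - 1 / ((n : ℝ) + 1) := fun n => by
    have := hpos n; linarith
  choose χ χ' hχ using fun n : ℕ => exists_isTimeCutoff (hlt n)
  have hle : ∀ n, c0 * (∫ q in K ×ˢ Ioo t0 t1, e q * χ n q.2) ≤ R := by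
    intro n
    have h1 := hE _ _ _ _ (hχ n) (by have := hpos n; linarith)
    have h2 : ∫ q in K ×ˢ Ioo t0 t1, D q * χ' n q.2 ≤ 0 :=
      integral_nonpos fun q => mul_nonpos_of_nonneg_of_nonpos (hDn q) ((hχ n).deriv_nonpos _)
    linarith
  have hlim : Tendsto (fun n => ∫ q in K ×ˢ Ioo t0 t1, e q * χ n q.2) atTop
      (𝓝 (∫ q in K ×ˢ Ioo t0 t1, e q)) := by
    refine tendsto_integral_of_dominated_convergence (fun q => ‖e q‖) (fun n => ?_) hei.norm
      (fun n => Eventually.of_forall fun q => ?_) ?_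
    · obtain ⟨C, hC⟩ := (hχ n).lipschitz
      exact hei.aestronglyMeasurable.mul (hC.continuous.comp continuous_snd).aestronglyMeasurable
    · rw [norm_mul]
      refine mul_le_of_le_one_right (norm_nonneg _) ?_
      rw [Real.norm_of_nonneg ((hχ n).nonneg _)]
      exact (hχ n).le_one _
    · filter_upwards [ae_restrict_mem hQm] with q hq
      have h2 : Tendsto (fun n : ℕ => t1 - 2 * (1 / ((n : ℝ) + 1))) atTop (𝓝 t1) := by
        have := (tendsto_one_div_add_atTop_nhds_zero_nat (𝕜 := ℝ)).const_mul 2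
        simpa using this.const_sub t1
      have h3 := h2.eventually (Ioi_mem_nhds hq.2.2)
      refine tendsto_const_nhds.congr' ?_
      filter_upwards [h3] with n hn
      rw [(hχ n).eq_one _ (le_of_lt hn), mul_one]
  exact le_of_tendsto' (hlim.const_mul c0) hle

end TimeSlices

/-- Dominated convergence for `f * σ ^ δ` as `δ → 0`. -/
lemma tendsto_integral_mul_rpow {α : Type*} [MeasurableSpace α] {μ : Measure α} {f σ : α → ℝ}
    (hf : Integrable f μ) (hσ : AEMeasurable σ μ) {M : ℝ} (hM : ∀ᵐ x ∂μ, f x ≠ 0 → σ x ≤ M)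
    (hpos : ∀ᵐ x ∂μ, f x ≠ 0 → 0 < σ x) {δ : ℕ → ℝ} (hδ : Tendsto δ atTop (𝓝 0))
    (hδ0 : ∀ n, 0 ≤ δ n) (hδ1 : ∀ n, δ n ≤ 1) :
    (∀ n, Integrable (fun x => f x * σ x ^ δ n) μ) ∧
    Tendsto (fun n => ∫ x, f x * σ x ^ δ n ∂μ) atTop (𝓝 (∫ x, f x ∂μ)) := by
  have hmeas : ∀ n, AEStronglyMeasurable (fun x => f x * σ x ^ δ n) μ := fun n =>
    hf.aestronglyMeasurable.mul (hσ.pow_const (δ n)).aestronglyMeasurable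
  have hbound : ∀ n, ∀ᵐ x ∂μ, ‖f x * σ x ^ δ n‖ ≤ ‖f x‖ * max M 1 := by
    intro n
    filter_upwards [hM, hpos] with x h1 h2
    by_cases h0 : f x = 0
    · simp [h0]
    rw [norm_mul, Real.norm_of_nonneg (Real.rpow_nonneg (h2 h0).le _)]
    apply mul_le_mul_of_nonneg_left _ (norm_nonneg _)
    rcases le_total (σ x) 1 with h | h
    · exact (Real.rpow_le_one (h2 h0).le h (hδ0 n)).trans (le_max_right _ _)
    · calc σ x ^ δ n ≤ σ x ^ (1 : ℝ) := Real.rpow_le_rpow_of_exponent_le h (hδ1 n)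
        _ = σ x := Real.rpow_one _
        _ ≤ max M 1 := (h1 h0).trans (le_max_left _ _)
  have hdom : Integrable (fun x => ‖f x‖ * max M 1) μ := hf.norm.mul_const _
  refine ⟨fun n => hdom.mono' (hmeas n) (hbound n), ?_⟩
  refine tendsto_integral_of_dominated_convergence _ hmeas hdom hbound ?_
  filter_upwards [hpos] with x h2
  by_cases h0 : f x = 0
  · simp [h0]
  have h3 : Tendsto (fun n => σ x ^ δ n) atTop (𝓝 (σ x ^ (0 : ℝ))) :=
    (Real.continuousAt_const_rpow (h2 h0).ne').tendsto.comp hδ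
  rw [Real.rpow_zero] at h3
  simpa using h3.const_mul (f x)

section PowerWeightEstimate

variable {N : ℕ}

lemma measurable_powerWeight {g0 g1 e m : ℝ} {g : ℝ → ℝ} (hg : IsStructureFunction g0 g1 g)
    (h1 : 0 < g1) : Measurable (powerWeight g e m) := by
  have h : powerWeight g e m =
      (Ioi (0 : ℝ)).piecewise (fun y => primitiveG g y ^ e * y ^ m) (fun _ => 0) := by
    funext y
    by_cases hy : 0 < y <;> simp [powerWeight, piecewise, hy]
  rw [h]
  refine ContinuousOn.measurable_piecewise (fun y hy => ?_) continuousOn_const measurableSet_Ioi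
  have hy0 : (0 : ℝ) < y := hy
  exact (((hg.hasDerivAt_primitiveG hy0).continuousAt.rpow_const
    (Or.inl (hg.primitiveG_pos h1 hy0).ne')).mul
    (continuousAt_id.rpow_const (Or.inl hy0.ne'))).continuousWithinAt

lemma powerWeight_add {g : ℝ → ℝ} {e m δ y : ℝ} :
    powerWeight g e (m + δ) y = powerWeight g e m y * y ^ δ := by
  unfold powerWeight
  split_ifs with h
  · rw [Real.rpow_add h]; ring
  · simp

lemma pos_of_powerWeight_ne_zero {g : ℝ → ℝ} {e m y : ℝ} (h : powerWeight g e m y ≠ 0) : 0 < y := by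
  by_contra hy
  exact h (powerWeight_of_nonpos (not_lt.mp hy))

lemma pos_and_pos_of_mul_div_pos {z w ρ : ℝ} (hz : 0 ≤ z) (hρ : 0 < ρ) (h : 0 < z * w / ρ) :
    0 < z ∧ 0 < w := by
  have h1 : 0 < z * w := (div_pos_iff_of_pos_right hρ).mp h
  have hz0 : 0 < z := lt_of_le_of_ne hz fun h => by rw [← h] at h1; simp at h1
  exact ⟨hz0, (mul_pos_iff_of_pos_left hz0).mp h1⟩

variable {g0 g1 ρ k e s : ℝ} {g : ℝ → ℝ} {K : Set (EuclideanSpace ℝ (Fin N))}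
  {t0 t1 : ℝ} {ζ u : EuclideanSpace ℝ (Fin N) × ℝ → ℝ}
  {V : EuclideanSpace ℝ (Fin N) × ℝ → EuclideanSpace ℝ (Fin N)}

lemma IsCutoff.continuous (hζ : IsCutoff K t0 t1 ζ) : Continuous ζ := by
  obtain ⟨C, hC⟩ := hζ.lipschitz
  exact hC.continuous

lemma IsCutoff.exists_bound (hζ : IsCutoff K t0 t1 ζ) (hu : Continuous u) (k : ℝ) :
    ∃ M, 0 < M ∧ ∀ q, ζ q ≠ 0 → |u q - k| ≤ M := by
  obtain ⟨M, hM⟩ := (show IsCompact (tsupport ζ) from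
    hζ.hasCompactSupport).exists_bound_of_continuousOn
    (hu.sub continuous_const : Continuous fun q => u q - k).continuousOn
  exact ⟨max M 1, lt_max_of_lt_right one_pos,
    fun q hq => (hM q (subset_closure hq)).trans (le_max_left _ _)⟩

lemma measurable_powerWeight_comp (hg : IsStructureFunction g0 g1 g) (h1 : 0 < g1)
    (hζ : IsCutoff K t0 t1 ζ) (hu : Continuous u) {m : ℝ} :
    Measurable fun q => powerWeight g e m (ζ q * (u q - k) / ρ) :=
  (measurable_powerWeight hg h1).comp
    ((hζ.continuous.mul (hu.sub continuous_const)).div_const ρ).measurable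

lemma le_div_of_le {z w M : ℝ} (hρ : 0 < ρ) (hz1 : z ≤ 1) (hw : 0 ≤ w) (hM : w ≤ M) :
    z * w / ρ ≤ M / ρ := by
  gcongr
  nlinarith

lemma powerWeight_div_eq {m z w : ℝ} (hρ : 0 < ρ) (hz : 0 < z) (hw : 0 < w) :
    powerWeight g e (m + 1) (z * w / ρ) / w = z / ρ * powerWeight g e m (z * w / ρ) := by
  have hy : 0 < z * w / ρ := by positivity
  rw [powerWeight_add, Real.rpow_one]
  field_simp

lemma integrableOn_gradTerm (hg : IsStructureFunction g0 g1 g) (h1 : 1 < g1) (hρ : 0 < ρ)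
    (he : e ≤ 0) (hs : s + e * g1 = 0)
    (hGi : IntegrableOn (fun q => primitiveG g ‖V q‖) (K ×ˢ Ioo t0 t1))
    (hζ : IsCutoff K t0 t1 ζ) (hu : Continuous u) :
    IntegrableOn (gradTerm g g1 ρ k (powerWeight g e (s + 1)) ζ u V) (K ×ˢ Ioo t0 t1) := by
  obtain ⟨M, hM0, hM⟩ := hζ.exists_bound hu k
  have hg1 : 0 < g1 := by linarith
  set C := (primitiveG g (M / ρ) * (M / ρ) ^ (-g1)) ^ e with hC
  have hmeas : Measurable fun q => ζ q ^ g1 * ζ q *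
      (powerWeight g e (s + 1) (ζ q * (u q - k) / ρ) / (u q - k)) :=
    ((hζ.continuous.rpow_const fun _ => Or.inr hg1.le).measurable.mul
      hζ.continuous.measurable).mul ((measurable_powerWeight_comp hg hg1 hζ hu).div
        (hu.sub continuous_const).measurable)
  refine Integrable.mono' (hGi.norm.mul_const (1 / ρ * C))
    (hGi.aestronglyMeasurable.mul hmeas.aestronglyMeasurable) (Eventually.of_forall fun q => ?_)
  unfold gradTerm
  rw [norm_mul]
  apply mul_le_mul_of_nonneg_left _ (norm_nonneg _)
  have hC0 : 0 ≤ C := Real.rpow_nonneg (mul_nonneg (hg.primitiveG_nonneg (by positivity))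
    (Real.rpow_nonneg (by positivity) _)) _
  have hz := hζ.nonneg q
  have hz1 := hζ.le_one q
  rcases le_or_gt (ζ q * (u q - k) / ρ) 0 with hy | hy
  · rw [powerWeight_of_nonpos hy]; simp; positivity
  obtain ⟨hz0, hw0⟩ := pos_and_pos_of_mul_div_pos hz hρ hy
  have hwM : u q - k ≤ M := (le_abs_self _).trans (hM q hz0.ne')
  have hb := powerWeight_le (m := s) hg hg1 he hy (le_div_of_le hρ hz1 hw0.le hwM)
  rw [hs, Real.rpow_zero, mul_one] at hb
  have hpn := powerWeight_nonneg (e := e) (m := s) hg (ζ q * (u q - k) / ρ)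
  have hzg : ζ q ^ g1 ≤ 1 := Real.rpow_le_one hz hz1 hg1.le
  have hzgn : 0 ≤ ζ q ^ g1 := Real.rpow_nonneg hz _
  rw [powerWeight_div_eq hρ hz0 hw0, Real.norm_of_nonneg (by positivity)]
  calc ζ q ^ g1 * ζ q * (ζ q / ρ * powerWeight g e s (ζ q * (u q - k) / ρ))
      ≤ 1 * 1 * (1 / ρ * C) := by gcongr
    _ = 1 / ρ * C := by ring

lemma abs_mul_powerWeight_le (hg : IsStructureFunction g0 g1 g) (h1 : 0 < g1) (hρ : 0 < ρ)
    (he : e ≤ 0) (hs : s + e * g1 = 0) {z w M : ℝ} (hz : 0 ≤ z) (hz1 : z ≤ 1) (hM0 : 0 < M)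
    (hM : z ≠ 0 → |w| ≤ M) :
    |w * powerWeight g e (s + 1) (z * w / ρ)| ≤
      M * ((primitiveG g (M / ρ) * (M / ρ) ^ (-g1)) ^ e * (M / ρ)) := by
  set C := (primitiveG g (M / ρ) * (M / ρ) ^ (-g1)) ^ e with hC
  have hC0 : 0 ≤ C := Real.rpow_nonneg (mul_nonneg (hg.primitiveG_nonneg (by positivity))
    (Real.rpow_nonneg (by positivity) _)) _
  rcases le_or_gt (z * w / ρ) 0 with hy | hy
  · rw [powerWeight_of_nonpos hy, mul_zero, abs_zero]; positivity
  obtain ⟨hz0, hw0⟩ := pos_and_pos_of_mul_div_pos hz hρ hy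
  have hwM : w ≤ M := (le_abs_self _).trans (hM hz0.ne')
  have hyM := le_div_of_le hρ hz1 hw0.le hwM
  have hb := powerWeight_le (m := s + 1) hg h1 he hy hyM
  rw [show s + 1 + e * g1 = 1 by linarith, Real.rpow_one] at hb
  rw [abs_mul, abs_of_nonneg (powerWeight_nonneg hg _)]
  refine mul_le_mul (hM hz0.ne') (hb.trans ?_) (powerWeight_nonneg hg _) hM0.le
  gcongr

lemma integrableOn_timeTerm (hg : IsStructureFunction g0 g1 g) (h1 : 1 < g1) (hρ : 0 < ρ)
    (he : e ≤ 0) (hs : s + e * g1 = 0) (hKb : Bornology.IsBounded K)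
    (hζ : IsCutoff K t0 t1 ζ) (hu : Continuous u) :
    IntegrableOn (timeTerm g1 ρ k (powerWeight g e (s + 1)) ζ u) (K ×ˢ Ioo t0 t1) := by
  obtain ⟨M, hM0, hM⟩ := hζ.exists_bound hu k
  obtain ⟨L, hL⟩ := hζ.lipschitz
  have hg1 : 0 < g1 := by linarith
  have hmeas : Measurable (timeTerm g1 ρ k (powerWeight g e (s + 1)) ζ u) :=
    ((hζ.continuous.rpow_const fun _ => Or.inr hg1.le).measurable.mul
      ((hu.sub continuous_const).measurable.mul (measurable_powerWeight_comp hg hg1 hζ hu))).mul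
      (measurable_fderiv_apply_const ℝ ζ (0, 1))
  have hfin : volume (K ×ˢ Ioo t0 t1) ≠ ⊤ :=
    (hKb.prod (Metric.isBounded_Ioo t0 t1)).measure_lt_top.ne
  refine Measure.integrableOn_of_bounded hfin hmeas.aestronglyMeasurable
    (M := 1 * (M * ((primitiveG g (M / ρ) * (M / ρ) ^ (-g1)) ^ e * (M / ρ))) * L)
    (Eventually.of_forall fun q => ?_)
  have hz := hζ.nonneg q
  have hz1 := hζ.le_one q
  have h2 := abs_mul_powerWeight_le hg hg1 hρ he hs hz hz1 hM0 (hM q)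
  have h3 : |fderiv ℝ ζ q (0, 1)| ≤ L := by
    have h2 := (fderiv ℝ ζ q).le_opNorm (0, 1)
    have h5 : ‖((0, 1) : EuclideanSpace ℝ (Fin N) × ℝ)‖ = 1 := by simp [Prod.norm_def]
    rw [h5, mul_one] at h2
    exact h2.trans (norm_fderiv_le_of_lipschitz ℝ hL)
  unfold timeTerm
  rw [norm_mul, norm_mul, Real.norm_of_nonneg (Real.rpow_nonneg hz _)]
  have hzg : ζ q ^ g1 ≤ 1 := Real.rpow_le_one hz hz1 hg1.le
  have h4 := (abs_nonneg _).trans h2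
  exact mul_le_mul (mul_le_mul hzg h2 (norm_nonneg _) zero_le_one) h3 (norm_nonneg _)
    (by rw [one_mul]; exact h4)

lemma integrableOn_slice (hg : IsStructureFunction g0 g1 g) (h1 : 1 < g1) (hρ : 0 < ρ)
    (he : e ≤ 0) (hs : s + e * g1 = 0) (hKb : Bornology.IsBounded K)
    (hζ : IsCutoff K t0 t1 ζ) (hu : Continuous u) (t : ℝ) :
    IntegrableOn (fun x => ζ (x, t) ^ g1 * ζ (x, t) * ((u (x, t) - k) *
      powerWeight g e (s + 1) (ζ (x, t) * (u (x, t) - k) / ρ))) K := by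
  obtain ⟨M, hM0, hM⟩ := hζ.exists_bound hu k
  have hg1 : 0 < g1 := by linarith
  have hmeas : Measurable (fun q => ζ q ^ g1 * ζ q * ((u q - k) *
      powerWeight g e (s + 1) (ζ q * (u q - k) / ρ))) :=
    ((hζ.continuous.rpow_const fun _ => Or.inr hg1.le).measurable.mul
      hζ.continuous.measurable).mul
      ((hu.sub continuous_const).measurable.mul (measurable_powerWeight_comp hg hg1 hζ hu))
  refine Measure.integrableOn_of_bounded hKb.measure_lt_top.ne
    (hmeas.comp measurable_prodMk_right).aestronglyMeasurable
    (M := 1 * 1 * (M * ((primitiveG g (M / ρ) * (M / ρ) ^ (-g1)) ^ e * (M / ρ))))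
    (Eventually.of_forall fun x => ?_)
  have hz := hζ.nonneg (x, t)
  have hz1 := hζ.le_one (x, t)
  have h2 := abs_mul_powerWeight_le hg hg1 hρ he hs hz hz1 hM0 (hM (x, t))
  rw [norm_mul, norm_mul, Real.norm_of_nonneg (Real.rpow_nonneg hz _), Real.norm_of_nonneg hz]
  have hzg : ζ (x, t) ^ g1 ≤ 1 := Real.rpow_le_one hz hz1 hg1.le
  exact mul_le_mul (mul_le_mul hzg hz1 hz zero_le_one) h2 (norm_nonneg _) (by norm_num)

lemma integrableOn_cutTerm (hg : IsStructureFunction g0 g1 g) (h1 : 1 < g1) (hρ : 0 < ρ)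
    (he : e + 1 ≤ 0) (hs : s + e * g1 = 0) (hKb : Bornology.IsBounded K)
    (hζ : IsCutoff K t0 t1 ζ) (hu : Continuous u) :
    IntegrableOn (cutTerm g g1 ρ k (powerWeight g e (s + 1)) ζ u) (K ×ˢ Ioo t0 t1) := by
  obtain ⟨M, hM0, hM⟩ := hζ.exists_bound hu k
  obtain ⟨L, hL⟩ := hζ.lipschitz
  have hg1 : 0 < g1 := by linarith
  set D : EuclideanSpace ℝ (Fin N) × ℝ → ℝ := fun q =>
    ‖(fderiv ℝ ζ q).comp (ContinuousLinearMap.inl ℝ (EuclideanSpace ℝ (Fin N)) ℝ)‖ with hD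
  have hDm : Measurable D := by
    have hc : Continuous fun A : EuclideanSpace ℝ (Fin N) × ℝ →L[ℝ] ℝ =>
        ‖A.comp (ContinuousLinearMap.inl ℝ (EuclideanSpace ℝ (Fin N)) ℝ)‖ :=
      (continuous_id.clm_comp continuous_const).norm
    exact hc.measurable.comp (measurable_fderiv ℝ ζ)
  have hDL : ∀ q, D q ≤ L := by
    intro q
    refine ContinuousLinearMap.opNorm_le_bound _ L.coe_nonneg fun b => ?_
    exact norm_fderiv_apply_space_le hL q b
  have hmeas : Measurable (cutTerm g g1 ρ k (powerWeight g e (s + 1)) ζ u) := by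
    have heq : cutTerm g g1 ρ k (powerWeight g e (s + 1)) ζ u = fun q =>
        primitiveG g (max (D q * ζ q * (u q - k)) 0) *
          (powerWeight g e (s + 1) (ζ q * (u q - k) / ρ) / (u q - k)) * ζ q ^ (-g1) := by
      funext q
      unfold cutTerm
      rcases le_or_gt (ζ q * (u q - k) / ρ) 0 with hy | hy
      · rw [powerWeight_of_nonpos hy]; simp
      · obtain ⟨hz0, hw0⟩ := pos_and_pos_of_mul_div_pos (hζ.nonneg q) hρ hy
        rw [max_eq_left (by positivity)]
    rw [heq]
    have hGc : Continuous fun y => primitiveG g (max y 0) :=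
      hg.continuousOn_primitiveG.comp_continuous (continuous_id.max continuous_const)
        fun y => mem_Ici.mpr (le_max_right _ _)
    exact ((hGc.measurable.comp ((hDm.mul hζ.continuous.measurable).mul
      (hu.sub continuous_const).measurable)).mul ((measurable_powerWeight_comp hg hg1 hζ hu).div
        (hu.sub continuous_const).measurable)).mul (hζ.continuous.measurable.pow_const (-g1))
  have hfin : volume (K ×ˢ Ioo t0 t1) ≠ ⊤ :=
    (hKb.prod (Metric.isBounded_Ioo t0 t1)).measure_lt_top.ne
  set l := max 1 (L * ρ) with hl
  have hl1 : 1 ≤ l := le_max_left _ _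
  set C := (primitiveG g (M / ρ) * (M / ρ) ^ (-g1)) ^ (e + 1) with hC
  have hC0 : 0 ≤ C := Real.rpow_nonneg (mul_nonneg (hg.primitiveG_nonneg (by positivity))
    (Real.rpow_nonneg (by positivity) _)) _
  refine Measure.integrableOn_of_bounded hfin hmeas.aestronglyMeasurable
    (M := l ^ g1 * (1 / ρ) * (C * (M / ρ) ^ g1))
    (Eventually.of_forall fun q => ?_)
  have hz := hζ.nonneg q
  have hz1 := hζ.le_one q
  unfold cutTerm
  rcases le_or_gt (ζ q * (u q - k) / ρ) 0 with hy | hy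
  · rw [powerWeight_of_nonpos hy]; simp; positivity
  obtain ⟨hz0, hw0⟩ := pos_and_pos_of_mul_div_pos hz hρ hy
  have hwM : u q - k ≤ M := (le_abs_self _).trans (hM q hz0.ne')
  have hyM := le_div_of_le hρ hz1 hw0.le hwM
  have hDn : 0 ≤ D q := norm_nonneg _
  set y := ζ q * (u q - k) / ρ with hydef
  have hG : primitiveG g (D q * ζ q * (u q - k)) ≤ l ^ g1 * primitiveG g y := by
    have e1 : D q * ζ q * (u q - k) ≤ l * y := by
      have : D q * ζ q * (u q - k) = D q * ρ * y := by rw [hydef]; field_simp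
      rw [this]
      apply mul_le_mul_of_nonneg_right _ hy.le
      exact (mul_le_mul_of_nonneg_right (hDL q) hρ.le).trans (le_max_right _ _)
    exact (hg.primitiveG_mono (by positivity) e1).trans (hg.primitiveG_mul_le hl1 hy.le)
  have hGn : 0 ≤ primitiveG g (D q * ζ q * (u q - k)) := hg.primitiveG_nonneg (by positivity)
  have hGy := hg.primitiveG_pos hg1 hy
  have hpn := powerWeight_nonneg (e := e) (m := s) hg y
  have hzg : 0 < ζ q ^ g1 := Real.rpow_pos_of_pos hz0 _
  have hb := powerWeight_le (m := s) hg hg1 he hy hyM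
  rw [show s + (e + 1) * g1 = g1 by linarith] at hb
  have hsplit : primitiveG g y * powerWeight g e s y = powerWeight g (e + 1) s y := by
    rw [powerWeight, powerWeight, if_pos hy, if_pos hy, Real.rpow_add_one hGy.ne']
    ring
  have hyz : y ^ g1 = ζ q ^ g1 * ((u q - k) / ρ) ^ g1 := by
    rw [hydef, mul_div_assoc, Real.mul_rpow hz (by positivity)]
  rw [powerWeight_div_eq hρ hz0 hw0, ← hydef, Real.rpow_neg hz, Real.norm_of_nonneg (by positivity)]
  have hwr : ((u q - k) / ρ) ^ g1 ≤ (M / ρ) ^ g1 :=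
    Real.rpow_le_rpow (by positivity) (by gcongr) hg1.le
  calc primitiveG g (D q * ζ q * (u q - k)) * (ζ q / ρ * powerWeight g e s y) * (ζ q ^ g1)⁻¹
      ≤ l ^ g1 * primitiveG g y * (ζ q / ρ * powerWeight g e s y) * (ζ q ^ g1)⁻¹ := by gcongr
    _ = l ^ g1 * (ζ q / ρ) * powerWeight g (e + 1) s y * (ζ q ^ g1)⁻¹ := by
        rw [← hsplit]; ring
    _ ≤ l ^ g1 * (ζ q / ρ) * (C * y ^ g1) * (ζ q ^ g1)⁻¹ := by gcongr
    _ = l ^ g1 * (ζ q / ρ) * (C * ((u q - k) / ρ) ^ g1) := by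
        rw [hyz]; field_simp
    _ ≤ l ^ g1 * (1 / ρ) * (C * (M / ρ) ^ g1) := by gcongr

end PowerWeightEstimate

section PowerWeightLimit

variable {N : ℕ} {g0 g1 ρ k e s C0 C1 κ : ℝ} {g : ℝ → ℝ} {K : Set (EuclideanSpace ℝ (Fin N))}
  {t0 t1 : ℝ} {ζ u : EuclideanSpace ℝ (Fin N) × ℝ → ℝ}
  {V : EuclideanSpace ℝ (Fin N) × ℝ → EuclideanSpace ℝ (Fin N)}

/-- The energy estimate for the weight `G(y)^e * y^(s+1)` and a global cutoff. -/
theorem power_energy_estimate (hg : IsStructureFunction g0 g1 g) (h1 : 1 < g1) (hρ : 0 < ρ)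
    (hC0 : 0 < C0) (hC1 : 0 < C1) (he : e + 1 ≤ 0) (hs : s + e * g1 = 0) (hs0 : 0 ≤ s)
    (hκ : 0 < κ) (hκ1 : κ ≤ 1) (hκC : (1 + g1 + (s + 2)) * C1 * (κ * g1) ≤ C0 / 2)
    (hK : IsOpen K) (hKb : Bornology.IsBounded K)
    {a : EuclideanSpace ℝ (Fin N) × ℝ → EuclideanSpace ℝ (Fin N)}
    {u0 : EuclideanSpace ℝ (Fin N) × ℝ → ℝ}
    (hsol : IsDistributionalSolution (K ×ˢ Ioo t0 t1) u0 V a)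
    (hab : ∀ᵐ q ∂(volume.restrict (K ×ˢ Ioo t0 t1)),
      C0 * primitiveG g ‖V q‖ ≤ inner ℝ (a q) (V q) ∧ ‖a q‖ ≤ C1 * g ‖V q‖)
    (hGi : IntegrableOn (fun q => primitiveG g ‖V q‖) (K ×ˢ Ioo t0 t1))
    (hζ : IsCutoff K t0 t1 ζ) (hu : Continuous u)
    (hu0 : ∀ q ∈ K ×ˢ Ioo t0 t1, ζ q ≠ 0 → u0 q = u q) :
    (∀ t ∈ Ioc t0 t1, ∫ x in K, ζ (x, t) ^ g1 * ζ (x, t) * ((u (x, t) - k) *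
        powerWeight g e (s + 1) (ζ (x, t) * (u (x, t) - k) / ρ)) ≤ (s + 3) *
      ((g1 + 1) * (∫ q in K ×ˢ Ioo t0 t1, timeTerm g1 ρ k (powerWeight g e (s + 1)) ζ u q)
        + (1 + g1 + (s + 2)) * C1 * (κ * g1 * (κ⁻¹) ^ g1) *
          (∫ q in K ×ˢ Ioo t0 t1, cutTerm g g1 ρ k (powerWeight g e (s + 1)) ζ u q))) ∧
    C0 / 2 * (∫ q in K ×ˢ Ioo t0 t1, gradTerm g g1 ρ k (powerWeight g e (s + 1)) ζ u V q) ≤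
      (g1 + 1) * (∫ q in K ×ˢ Ioo t0 t1, timeTerm g1 ρ k (powerWeight g e (s + 1)) ζ u q)
        + (1 + g1 + (s + 2)) * C1 * (κ * g1 * (κ⁻¹) ^ g1) *
          (∫ q in K ×ˢ Ioo t0 t1, cutTerm g g1 ρ k (powerWeight g e (s + 1)) ζ u q) := by
  have hg1 : 0 < g1 := by linarith
  have he0 : e ≤ 0 := by linarith
  obtain ⟨M, hM0, hM⟩ := hζ.exists_bound hu k
  set σ : EuclideanSpace ℝ (Fin N) × ℝ → ℝ := fun q => ζ q * (u q - k) / ρ with hσ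
  have hσc : Continuous σ := (hζ.continuous.mul (hu.sub continuous_const)).div_const ρ
  have hσM : ∀ q, 0 < σ q → σ q ≤ M / ρ := by
    intro q hq
    obtain ⟨hz0, hw0⟩ := pos_and_pos_of_mul_div_pos (hζ.nonneg q) hρ hq
    exact le_div_of_le hρ (hζ.le_one q) hw0.le ((le_abs_self _).trans (hM q hz0.ne'))
  set δ : ℕ → ℝ := fun n => 1 / ((n : ℝ) + 1) with hδ
  have hδ0 : ∀ n, 0 < δ n := fun n => by simp only [hδ]; positivity
  have hδ1 : ∀ n, δ n ≤ 1 := fun n => by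
    simp only [hδ]; rw [div_le_one (by positivity)]; linarith [(Nat.cast_nonneg n : (0 : ℝ) ≤ n)]
  have hδlim : Tendsto δ atTop (𝓝 0) := tendsto_one_div_add_atTop_nhds_zero_nat
  have hw : ∀ n, IsWeight (s + 2) (powerWeight g e (s + 1 + δ n))
      (powerWeightDeriv g e (s + 1 + δ n)) := fun n =>
    isWeight_powerWeight hg hg1 he0 (by linarith [hδ0 n]) (by linarith [hδ1 n])
  have egrad : ∀ n, gradTerm g g1 ρ k (powerWeight g e (s + 1 + δ n)) ζ u V = fun q =>
      gradTerm g g1 ρ k (powerWeight g e (s + 1)) ζ u V q * σ q ^ δ n := by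
    intro n; funext q; simp only [gradTerm, powerWeight_add, hσ]; ring
  have etime : ∀ n, timeTerm g1 ρ k (powerWeight g e (s + 1 + δ n)) ζ u = fun q =>
      timeTerm g1 ρ k (powerWeight g e (s + 1)) ζ u q * σ q ^ δ n := by
    intro n; funext q; simp only [timeTerm, powerWeight_add, hσ]; ring
  have ecut : ∀ n, cutTerm g g1 ρ k (powerWeight g e (s + 1 + δ n)) ζ u = fun q =>
      cutTerm g g1 ρ k (powerWeight g e (s + 1)) ζ u q * σ q ^ δ n := by
    intro n; funext q; simp only [cutTerm, powerWeight_add, hσ]; ring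
  have pgrad : ∀ q, gradTerm g g1 ρ k (powerWeight g e (s + 1)) ζ u V q ≠ 0 → 0 < σ q :=
    fun q hq => pos_of_powerWeight_ne_zero (g := g) (e := e) (m := s + 1) fun h => hq (by
      simp only [hσ] at h; simp [gradTerm, h])
  have ptime : ∀ q, timeTerm g1 ρ k (powerWeight g e (s + 1)) ζ u q ≠ 0 → 0 < σ q :=
    fun q hq => pos_of_powerWeight_ne_zero (g := g) (e := e) (m := s + 1) fun h => hq (by
      simp only [hσ] at h; simp [timeTerm, h])
  have pcut : ∀ q, cutTerm g g1 ρ k (powerWeight g e (s + 1)) ζ u q ≠ 0 → 0 < σ q :=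
    fun q hq => pos_of_powerWeight_ne_zero (g := g) (e := e) (m := s + 1) fun h => hq (by
      simp only [hσ] at h; simp [cutTerm, h])
  obtain ⟨igrad, lgrad⟩ := tendsto_integral_mul_rpow
    (integrableOn_gradTerm (k := k) hg h1 hρ he0 hs hGi hζ hu) hσc.measurable.aemeasurable
    (Eventually.of_forall fun q hq => hσM q (pgrad q hq)) (Eventually.of_forall pgrad) hδlim
    (fun n => (hδ0 n).le) hδ1
  obtain ⟨itime, ltime⟩ := tendsto_integral_mul_rpow
    (integrableOn_timeTerm (k := k) hg h1 hρ he0 hs hKb hζ hu) hσc.measurable.aemeasurable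
    (Eventually.of_forall fun q hq => hσM q (ptime q hq)) (Eventually.of_forall ptime) hδlim
    (fun n => (hδ0 n).le) hδ1
  obtain ⟨icut, lcut⟩ := tendsto_integral_mul_rpow
    (integrableOn_cutTerm (k := k) hg h1 hρ he hs hKb hζ hu) hσc.measurable.aemeasurable
    (Eventually.of_forall fun q hq => hσM q (pcut q hq)) (Eventually.of_forall pcut) hδlim
    (fun n => (hδ0 n).le) hδ1
  set Cc := (1 + g1 + (s + 2)) * C1 * (κ * g1 * (κ⁻¹) ^ g1) with hCc
  have hR := (ltime.const_mul (g1 + 1)).add (lcut.const_mul Cc)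
  have hE : ∀ n c d χ χ', IsTimeCutoff c d χ χ' → d < t1 →
      C0 / 2 * (∫ q in K ×ˢ Ioo t0 t1,
        gradTerm g g1 ρ k (powerWeight g e (s + 1 + δ n)) ζ u V q * χ q.2)
      - (∫ q in K ×ˢ Ioo t0 t1,
        energyDensity g1 ρ k (powerWeight g e (s + 1 + δ n)) (ζ q) (u q) * χ' q.2) ≤
      (g1 + 1) * (∫ q in K ×ˢ Ioo t0 t1,
          timeTerm g1 ρ k (powerWeight g e (s + 1)) ζ u q * σ q ^ δ n)
        + Cc * (∫ q in K ×ˢ Ioo t0 t1,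
          cutTerm g g1 ρ k (powerWeight g e (s + 1)) ζ u q * σ q ^ δ n) := by
    intro n c d χ χ' hχ hd
    have h2 := energy_inequality (k := k) hg (hw n) (by linarith) h1 hρ hC1 hκ hκ1 hκC hK hKb
      hsol hab hGi hζ hu hu0 (by rw [egrad n]; exact igrad n) (by rw [etime n]; exact itime n)
      (by rw [ecut n]; exact icut n) hχ hd
    rw [etime n, ecut n] at h2
    exact h2
  refine ⟨fun t ht => ?_, ?_⟩
  · have hpos : ∀ x, ζ (x, t) ^ g1 * ζ (x, t) * ((u (x, t) - k) *
        powerWeight g e (s + 1) (ζ (x, t) * (u (x, t) - k) / ρ)) ≠ 0 → 0 < σ (x, t) :=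
      fun x hx => pos_of_powerWeight_ne_zero (g := g) (e := e) (m := s + 1) fun h => hx (by
        simp only [hσ] at h; simp [h])
    obtain ⟨islice, lslice⟩ := tendsto_integral_mul_rpow
      (integrableOn_slice (k := k) hg h1 hρ he0 hs hKb hζ hu t)
      (σ := fun x => σ (x, t)) (hσc.comp (Continuous.prodMk_left t)).measurable.aemeasurable
      (Eventually.of_forall fun x hx => hσM _ (hpos x hx)) (Eventually.of_forall hpos) hδlim
      (fun n => (hδ0 n).le) hδ1
    refine le_of_tendsto_of_tendsto' lslice (hR.const_mul (s + 3)) fun n => ?_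
    have hH := isEnergyIntegrand_energyDensity (k := k) (hw n) h1 hρ.ne'
    have hDc : Continuous fun q =>
        energyDensity g1 ρ k (powerWeight g e (s + 1 + δ n)) (ζ q) (u q) :=
      hH.continuous_H.comp (hζ.continuous.prodMk hu)
    have hsub : ∀ q, q ∉ tsupport ζ →
        energyDensity g1 ρ k (powerWeight g e (s + 1 + δ n)) (ζ q) (u q) = 0 := fun q hq => by
      rw [image_eq_zero_of_notMem_tsupport hq, hH.H_zero]
    have hDs : HasCompactSupport fun q =>
        energyDensity g1 ρ k (powerWeight g e (s + 1 + δ n)) (ζ q) (u q) :=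
      HasCompactSupport.intro hζ.hasCompactSupport hsub
    have hDK : tsupport (fun q =>
        energyDensity g1 ρ k (powerWeight g e (s + 1 + δ n)) (ζ q) (u q)) ⊆ K ×ˢ Ioi t0 := by
      refine (closure_minimal (fun q hq => ?_) (isClosed_tsupport ζ)).trans hζ.tsupport_subset
      by_contra h
      exact hq (hsub q h)
    have h2 := integral_slice_le hK hDc hDs hDK (by linarith : (0 : ℝ) ≤ C0 / 2)
      (gradTerm_nonneg hg (hw n) hρ hζ) (hE n) ht
    refine le_trans ?_ (mul_le_mul_of_nonneg_left h2 (by linarith : (0 : ℝ) ≤ s + 3))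
    rw [← integral_const_mul]
    have hDi : IntegrableOn (fun x =>
        energyDensity g1 ρ k (powerWeight g e (s + 1 + δ n)) (ζ (x, t)) (u (x, t))) K := by
      apply Integrable.integrableOn
      apply (hDc.comp (Continuous.prodMk_left t)).integrable_of_hasCompactSupport
      refine HasCompactSupport.intro (hDs.image continuous_fst) fun x hx => ?_
      by_contra h
      exact hx ⟨(x, t), subset_closure h, rfl⟩
    refine integral_mono (islice n) (hDi.const_mul _) fun x => ?_
    have h3 := le_energyDensity (g1 := g1) (k := k) (hw n) hρ (hζ.nonneg (x, t)) (u (x, t))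
    rw [powerWeight_add] at h3
    rw [show s + 3 = s + 2 + 1 by ring]
    refine le_trans (le_of_eq ?_) h3
    simp only [hσ]
    ring
  · refine le_of_tendsto_of_tendsto' (lgrad.const_mul (C0 / 2)) hR fun n => ?_
    have h2 := setIntegral_le_of_forall_timeCutoff hK
      (fun q => energyDensity_nonneg (hw n) hρ (hζ.nonneg q) (u q))
      (by rw [egrad n]; exact igrad n) (hE n)
    rw [egrad n] at h2
    exact h2

end PowerWeightLimit

section Reduction

variable {N : ℕ} {K : Set (EuclideanSpace ℝ (Fin N))} {t0 t1 : ℝ}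

/-- A Lipschitz cutoff on `K̄ × [t0,t1]` is the restriction of a global cutoff. -/
lemma exists_isCutoff (hK : IsOpen K) (hKb : Bornology.IsBounded K)
    {ζ : EuclideanSpace ℝ (Fin N) → ℝ → ℝ} (hζ : IsLipschitzTest K t0 t1 ζ)
    (hζ01 : ∀ x ∈ closure K, ∀ t ∈ Icc t0 t1, ζ x t ∈ Icc (0 : ℝ) 1)
    (hmono : ∀ x ∈ closure K, MonotoneOn (ζ x) (Icc t0 t1)) :
    ∃ ζ' : EuclideanSpace ℝ (Fin N) × ℝ → ℝ, IsCutoff K t0 t1 ζ' ∧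
      ∀ x ∈ closure K, ∀ t ∈ Icc t0 t1, ζ' (x, t) = ζ x t := by
  obtain ⟨⟨L, hL⟩, U, hUo, hUb, hU0⟩ := hζ
  set A := (closure K ×ˢ Icc t0 t1) \ U with hA
  have hAc : IsCompact A := (hKb.isCompact_closure.prod isCompact_Icc).diff hUo
  have hAK : A ⊆ K ×ˢ Ioi t0 := by
    rintro ⟨x, t⟩ ⟨⟨hx, ht⟩, hnU⟩
    have hxK : x ∈ K := by
      by_contra h
      refine hnU (hUb (Or.inl ⟨?_, ht⟩))
      rw [hK.frontier_eq]; exact ⟨hx, h⟩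
    refine ⟨hxK, lt_of_le_of_ne ht.1 fun h => hnU (hUb (Or.inr ⟨hx, ?_⟩))⟩
    exact h.symm
  have hderiv : ∀ ζ' : EuclideanSpace ℝ (Fin N) × ℝ → ℝ,
      (∀ x ∈ closure K, ∀ t ∈ Icc t0 t1, ζ' (x, t) = ζ x t) →
      ∀ q ∈ K ×ˢ Ioo t0 t1, 0 ≤ fderiv ℝ ζ' q (0, 1) := by
    rintro ζ' hζ' ⟨x, t⟩ ⟨hx, ht⟩
    by_cases hd : DifferentiableAt ℝ ζ' (x, t)
    · rw [← deriv_slice_eq_fderiv hd]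
      have hev : (fun t => ζ' (x, t)) =ᶠ[𝓝 t] ζ x := by
        filter_upwards [Ioo_mem_nhds ht.1 ht.2] with τ hτ
        exact hζ' x (subset_closure hx) τ ⟨hτ.1.le, hτ.2.le⟩
      rw [hev.deriv_eq, ← derivWithin_of_mem_nhds (Icc_mem_nhds ht.1 ht.2)]
      exact (hmono x (subset_closure hx)).derivWithin_nonneg
    · rw [fderiv_zero_of_not_differentiableAt hd]; simp
  rcases A.eq_empty_or_nonempty with hAe | hAne
  · have hz : ∀ x ∈ closure K, ∀ t ∈ Icc t0 t1, (0 : ℝ) = ζ x t := by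
      intro x hx t ht
      refine (hU0 (x, t) ⟨?_, hx, ht⟩).symm
      by_contra h
      have : (x, t) ∈ A := ⟨⟨hx, ht⟩, h⟩
      rw [hAe] at this
      exact this
    exact ⟨fun _ => 0, ⟨⟨0, LipschitzWith.const 0⟩, HasCompactSupport.zero, by simp [tsupport],
      fun _ => le_rfl, fun _ => zero_le_one, hderiv _ hz⟩, hz⟩
  obtain ⟨δ, hδ, hδA⟩ := hAc.exists_cthickening_subset_open (hK.prod isOpen_Ioi) hAK
  obtain ⟨ζ1, hζ1L, hζ1⟩ := hL.extend_real
  set d : EuclideanSpace ℝ (Fin N) × ℝ → ℝ := fun q => 1 - δ⁻¹ * Metric.infDist q A with hd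
  have hdL : LipschitzWith (Real.toNNReal δ⁻¹) d := by
    refine LipschitzWith.of_dist_le_mul fun p q => ?_
    have h1 := (Metric.lipschitz_infDist_pt A).dist_le_mul p q
    rw [Real.coe_toNNReal _ (by positivity), Real.dist_eq]
    have e : d p - d q = -(δ⁻¹ * (Metric.infDist p A - Metric.infDist q A)) := by
      simp only [hd]; ring
    rw [e, abs_neg, abs_mul, abs_of_pos (inv_pos.mpr hδ)]
    apply mul_le_mul_of_nonneg_left _ (inv_pos.mpr hδ).le
    simpa [Real.dist_eq] using h1
  set f : EuclideanSpace ℝ (Fin N) × ℝ → ℝ := fun q => max 0 (min (min 1 (ζ1 q)) (d q)) with hf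
  have hagree : ∀ x ∈ closure K, ∀ t ∈ Icc t0 t1, f (x, t) = ζ x t := by
    intro x hx t ht
    have h1 : ζ1 (x, t) = ζ x t := (hζ1 (show (x, t) ∈ closure K ×ˢ Icc t0 t1 from ⟨hx, ht⟩)).symm
    have h01 := hζ01 x hx t ht
    simp only [hf, h1]
    by_cases hU : (x, t) ∈ U
    · have h0 : ζ x t = 0 := hU0 (x, t) ⟨hU, hx, ht⟩
      rw [h0]
      exact max_eq_left ((min_le_left _ _).trans (min_le_right _ _))
    · have hAm : (x, t) ∈ A := ⟨⟨hx, ht⟩, hU⟩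
      have hd1 : d (x, t) = 1 := by simp [hd, Metric.infDist_zero_of_mem hAm]
      rw [hd1, min_eq_right h01.2, min_eq_left h01.2, max_eq_right h01.1]
  have hsupp : ∀ q, q ∉ Metric.cthickening δ A → f q = 0 := by
    intro q hq
    have h1 : δ ≤ Metric.infDist q A := by
      by_contra h
      exact hq (Metric.thickening_subset_cthickening δ A
        ((Metric.mem_thickening_iff_infDist_lt hAne).mpr (not_le.mp h)))
    have h2 : d q ≤ 0 := by
      have : 1 ≤ δ⁻¹ * Metric.infDist q A := by
        rw [inv_mul_eq_div, le_div_iff₀ hδ]; linarith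
      simp only [hd]; linarith
    exact max_eq_left ((min_le_right _ _).trans h2)
  refine ⟨f, ⟨⟨_, ((hζ1L.const_min 1).min hdL).const_max 0⟩,
    HasCompactSupport.intro hAc.cthickening hsupp, ?_, fun q => le_max_left _ _, fun q => ?_,
    hderiv f hagree⟩, hagree⟩
  · refine (closure_minimal (fun q hq => ?_) Metric.isClosed_cthickening).trans hδA
    by_contra h
    exact hq (hsupp q h)
  · exact max_le zero_le_one ((min_le_left _ _).trans (min_le_left _ _))

/-- A function continuous on `K × (t0,t1]` agrees on the support of the cutoff with a globally
continuous function. -/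
lemma IsCutoff.exists_continuous_eq {ζ : EuclideanSpace ℝ (Fin N) × ℝ → ℝ}
    (hζ : IsCutoff K t0 t1 ζ) {u : EuclideanSpace ℝ (Fin N) × ℝ → ℝ}
    (hu : ContinuousOn u (K ×ˢ Ioc t0 t1)) :
    ∃ w : EuclideanSpace ℝ (Fin N) × ℝ → ℝ, Continuous w ∧
      ∀ q, q.2 ≤ t1 → ζ q ≠ 0 → u q = w q := by
  set B := tsupport ζ ∩ {q : EuclideanSpace ℝ (Fin N) × ℝ | q.2 ≤ t1} with hB
  have hBc : IsClosed B :=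
    (isClosed_tsupport ζ).inter (isClosed_le continuous_snd continuous_const)
  have hBu : ContinuousOn u B := hu.mono fun q hq =>
    ⟨(hζ.tsupport_subset hq.1).1, (hζ.tsupport_subset hq.1).2, hq.2⟩
  obtain ⟨w, hw⟩ := ContinuousMap.exists_restrict_eq hBc ⟨B.domRestrict u, hBu.domRestrict⟩
  refine ⟨w, w.continuous, fun q hq1 hq2 => ?_⟩
  have := congrArg (fun f => f ⟨q, subset_closure hq2, hq1⟩) hw
  exact this.symm

lemma IsWeakSolution.neg {C0 C1 : ℝ} {g : ℝ → ℝ} {u : EuclideanSpace ℝ (Fin N) → ℝ → ℝ}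
    {V : EuclideanSpace ℝ (Fin N) → ℝ → EuclideanSpace ℝ (Fin N)}
    (hs : IsWeakSolution C0 C1 g K t0 t1 u V) :
    IsWeakSolution C0 C1 g K t0 t1 (fun x t => -u x t) (fun x t => -V x t) := by
  obtain ⟨a, ham, hab, haw⟩ := hs.weak_form
  refine ⟨hs.continuousOn.neg, hs.grad_measurable.neg, by simpa using hs.grad_integrable, ?_, ?_⟩
  · intro φ h1 h2 h3 i
    have h := hs.weak_gradient φ h1 h2 h3 i
    simp only [neg_mul, PiLp.neg_apply, integral_neg, h]
  · refine ⟨fun x t => -a x t, ham.neg, by simpa using hab, ?_⟩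
    intro φ hφ τ1 τ2 h1 h2 h3
    have h := haw φ hφ τ1 τ2 h1 h2 h3
    have e : ∀ t, ∫ x in K, (-u x t * deriv (φ x) t - fderiv ℝ (fun y => φ y t) x (-a x t))
        = -∫ x in K, (u x t * deriv (φ x) t - fderiv ℝ (fun y => φ y t) x (a x t)) := by
      intro t
      rw [← integral_neg]
      congr 1
      funext x
      rw [map_neg]; ring
    simp only [e]
    simp only [neg_mul, integral_neg, intervalIntegral.integral_neg, ← h]
    ring

end Reduction

section Matching

variable {g0 g1 e s q ρ z w : ℝ} {g : ℝ → ℝ}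

lemma powerWeight_eq_zero_of_degenerate (hz : 0 ≤ z) (hρ : 0 < ρ) (h : ¬(0 < z ∧ 0 < w)) :
    powerWeight g e (s + 1) (z * w / ρ) = 0 := by
  by_contra hne
  exact h (pos_and_pos_of_mul_div_pos hz hρ (pos_of_powerWeight_ne_zero hne))

lemma rpow_mul_powerWeight (hρ : 0 < ρ) (hz : 0 < z) (hw : 0 < w) :
    ρ ^ (s + 1) * powerWeight g e (s + 1) (z * w / ρ) =
      primitiveG g (z * w / ρ) ^ e * (z ^ (s + 1) * w ^ (s + 1)) := by
  have hy : 0 < z * w / ρ := by positivity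
  have hρs : 0 < ρ ^ (s + 1) := Real.rpow_pos_of_pos hρ _
  rw [powerWeight, if_pos hy, Real.div_rpow (by positivity) hρ.le, Real.mul_rpow hz.le hw.le]
  field_simp

/-- The weight in the energy at a fixed time. -/
lemma slice_weight_eq (hs : 0 < s) (hq : q = 2 + g1 + s) (hg1 : 0 < g1) (hρ : 0 < ρ) (hz : 0 ≤ z) :
    primitiveG g (z * max w 0 / ρ) ^ e * max w 0 ^ (s + 2) * z ^ q =
      ρ ^ (s + 1) * (z ^ g1 * z * (w * powerWeight g e (s + 1) (z * w / ρ))) := by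
  by_cases h : 0 < z ∧ 0 < w
  · obtain ⟨hz0, hw0⟩ := h
    have e1 : z ^ q = z ^ g1 * z * z ^ (s + 1) := by
      rw [hq, show 2 + g1 + s = g1 + 1 + (s + 1) by ring, Real.rpow_add hz0,
        Real.rpow_add_one hz0.ne']
    have e2 : w ^ (s + 2) = w ^ (s + 1) * w := by
      rw [← Real.rpow_add_one hw0.ne']; ring_nf
    have e3 := rpow_mul_powerWeight (g := g) (e := e) (s := s) hρ hz0 hw0
    rw [max_eq_left hw0.le, e1, e2]
    calc _ = primitiveG g (z * w / ρ) ^ e * (z ^ (s + 1) * w ^ (s + 1)) * (z ^ g1 * z * w) := by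
          ring
      _ = _ := by rw [← e3]; ring
  · rw [powerWeight_eq_zero_of_degenerate hz hρ h]
    rcases hz.eq_or_lt with h0 | h0
    · rw [← h0, Real.zero_rpow (by linarith : q ≠ 0)]; simp
    · have : w ≤ 0 := not_lt.mp fun hw => h ⟨h0, hw⟩
      rw [max_eq_right this, Real.zero_rpow (by linarith : s + 2 ≠ 0)]; simp

lemma time_weight_eq (hs : 0 < s) (hq : q = 2 + g1 + s) (hg1 : 0 < g1) (hρ : 0 < ρ) (hz : 0 ≤ z) :
    primitiveG g (z * max w 0 / ρ) ^ e * max w 0 ^ (s + 2) * z ^ (q - 1) =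
      ρ ^ (s + 1) * (z ^ g1 * (w * powerWeight g e (s + 1) (z * w / ρ))) := by
  by_cases h : 0 < z ∧ 0 < w
  · obtain ⟨hz0, hw0⟩ := h
    have e1 : z ^ (q - 1) = z ^ g1 * z ^ (s + 1) := by
      rw [hq, show 2 + g1 + s - 1 = g1 + (s + 1) by ring, Real.rpow_add hz0]
    have e2 : w ^ (s + 2) = w ^ (s + 1) * w := by
      rw [← Real.rpow_add_one hw0.ne']; ring_nf
    have e3 := rpow_mul_powerWeight (g := g) (e := e) (s := s) hρ hz0 hw0
    rw [max_eq_left hw0.le, e1, e2]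
    calc _ = primitiveG g (z * w / ρ) ^ e * (z ^ (s + 1) * w ^ (s + 1)) * (z ^ g1 * w) := by ring
      _ = _ := by rw [← e3]; ring
  · rw [powerWeight_eq_zero_of_degenerate hz hρ h]
    rcases hz.eq_or_lt with h0 | h0
    · rw [← h0, Real.zero_rpow (by linarith : q - 1 ≠ 0)]; simp
    · have : w ≤ 0 := not_lt.mp fun hw => h ⟨h0, hw⟩
      rw [max_eq_right this, Real.zero_rpow (by linarith : s + 2 ≠ 0)]; simp

lemma grad_weight_eq (hs : 0 < s) (hq : q = 2 + g1 + s) (hg1 : 0 < g1) (hρ : 0 < ρ) (hz : 0 ≤ z) :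
    primitiveG g (z * max w 0 / ρ) ^ e * max w 0 ^ s * z ^ q =
      ρ ^ (s + 1) * (z ^ g1 * z * (powerWeight g e (s + 1) (z * w / ρ) / w)) := by
  by_cases h : 0 < z ∧ 0 < w
  · obtain ⟨hz0, hw0⟩ := h
    have e1 : z ^ q = z ^ g1 * z * z ^ (s + 1) := by
      rw [hq, show 2 + g1 + s = g1 + 1 + (s + 1) by ring, Real.rpow_add hz0,
        Real.rpow_add_one hz0.ne']
    have e2 : w ^ s = w ^ (s + 1) / w := by
      rw [Real.rpow_add_one hw0.ne']; field_simp
    have e3 := rpow_mul_powerWeight (g := g) (e := e) (s := s) hρ hz0 hw0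
    rw [max_eq_left hw0.le, e1, e2]
    calc _ = primitiveG g (z * w / ρ) ^ e * (z ^ (s + 1) * w ^ (s + 1)) * (z ^ g1 * z / w) := by
          ring
      _ = _ := by rw [← e3]; ring
  · rw [powerWeight_eq_zero_of_degenerate hz hρ h]
    rcases hz.eq_or_lt with h0 | h0
    · rw [← h0, Real.zero_rpow (by linarith : q ≠ 0)]; simp
    · have : w ≤ 0 := not_lt.mp fun hw => h ⟨h0, hw⟩
      rw [max_eq_right this, Real.zero_rpow (by linarith : s ≠ 0)]; simp

lemma cut_weight_eq (hs : 0 < s) (hq : q = 2 + g1 + s) (hgs : g1 ≤ s) (hρ : 0 < ρ)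
    (hz : 0 ≤ z) :
    primitiveG g (z * max w 0 / ρ) ^ e * max w 0 ^ s * z ^ (q - 1 - 2 * g1) =
      ρ ^ (s + 1) * (powerWeight g e (s + 1) (z * w / ρ) / w * z ^ (-g1)) := by
  by_cases h : 0 < z ∧ 0 < w
  · obtain ⟨hz0, hw0⟩ := h
    have e1 : z ^ (q - 1 - 2 * g1) = z ^ (-g1) * z ^ (s + 1) := by
      rw [← Real.rpow_add hz0, hq]; congr 1; ring
    have e2 : w ^ s = w ^ (s + 1) / w := by
      rw [Real.rpow_add_one hw0.ne']; field_simp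
    have e3 := rpow_mul_powerWeight (g := g) (e := e) (s := s) hρ hz0 hw0
    rw [max_eq_left hw0.le, e1, e2]
    calc _ = primitiveG g (z * w / ρ) ^ e * (z ^ (s + 1) * w ^ (s + 1)) * (z ^ (-g1) / w) := by ring
      _ = _ := by rw [← e3]; ring
  · rw [powerWeight_eq_zero_of_degenerate hz hρ h]
    rcases hz.eq_or_lt with h0 | h0
    · rw [← h0, Real.zero_rpow (by linarith : q - 1 - 2 * g1 ≠ 0)]; simp
    · have : w ≤ 0 := not_lt.mp fun hw => h ⟨h0, hw⟩
      rw [max_eq_right this, Real.zero_rpow (by linarith : s ≠ 0)]; simp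

end Matching

section Truncation

variable {N : ℕ} {g0 g1 ρ k e s q C0 C1 κ : ℝ} {g : ℝ → ℝ}
  {K : Set (EuclideanSpace ℝ (Fin N))} {t0 t1 : ℝ} {u ζ : EuclideanSpace ℝ (Fin N) → ℝ → ℝ}
  {V : EuclideanSpace ℝ (Fin N) → ℝ → EuclideanSpace ℝ (Fin N)}

lemma ae_deriv_eq_of_eqOn {ζ' : EuclideanSpace ℝ (Fin N) × ℝ → ℝ} (hK : IsOpen K)
    (hζ' : IsCutoff K t0 t1 ζ') (heq : ∀ x ∈ K, ∀ t ∈ Icc t0 t1, ζ' (x, t) = ζ x t) :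
    ∀ᵐ p ∂(volume.restrict (K ×ˢ Ioo t0 t1)), p ∈ K ×ˢ Ioo t0 t1 ∧
      deriv (ζ p.1) p.2 = fderiv ℝ ζ' p (0, 1) ∧
      fderiv ℝ (fun y => ζ y p.2) p.1 =
        (fderiv ℝ ζ' p).comp (ContinuousLinearMap.inl ℝ (EuclideanSpace ℝ (Fin N)) ℝ) := by
  obtain ⟨L, hL⟩ := hζ'.lipschitz
  filter_upwards [ae_restrict_mem (hK.prod isOpen_Ioo).measurableSet,
    ae_restrict_of_ae hL.ae_differentiableAt] with p hp hd
  obtain ⟨x, t⟩ := p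
  refine ⟨hp, ?_, ?_⟩
  · rw [← deriv_slice_eq_fderiv hd]
    refine EventuallyEq.deriv_eq ?_
    filter_upwards [Ioo_mem_nhds hp.2.1 hp.2.2] with τ hτ
    exact (heq x hp.1 τ ⟨hτ.1.le, hτ.2.le⟩).symm
  · rw [← fderiv_slice_eq_comp_inl hd]
    refine EventuallyEq.fderiv_eq ?_
    filter_upwards [hK.mem_nhds hp.1] with y hy
    exact (heq y hy t ⟨hp.2.1.le, hp.2.2.le⟩).symm

/-- An iterated integral whose integrand is a.e. a multiple of an integrable function. -/
lemma intervalIntegral_setIntegral_eq_const_mul (ht : t0 ≤ t1)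
    {F : EuclideanSpace ℝ (Fin N) → ℝ → ℝ} {f : EuclideanSpace ℝ (Fin N) × ℝ → ℝ} {c : ℝ}
    (hf : IntegrableOn f (K ×ˢ Ioo t0 t1))
    (hFf : ∀ᵐ p ∂(volume.restrict (K ×ˢ Ioo t0 t1)), F p.1 p.2 = c * f p) :
    ∫ t in t0..t1, ∫ x in K, F x t = c * ∫ p in K ×ˢ Ioo t0 t1, f p := by
  have hF : IntegrableOn (fun p : EuclideanSpace ℝ (Fin N) × ℝ => F p.1 p.2) (K ×ˢ Ioo t0 t1) :=
    (hf.const_mul c).congr (hFf.mono fun p hp => hp.symm)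
  rw [intervalIntegral_setIntegral_eq ht hF, integral_congr_ae hFf, integral_const_mul]

/-- The energy estimate for the truncation from above. -/
lemma energy_estimate_above (hg : IsStructureFunction g0 g1 g) (h1 : 1 < g1) (hρ : 0 < ρ)
    (hC0 : 0 < C0) (hC1 : 0 < C1) (he : e + 1 ≤ 0) (hs : s + e * g1 = 0) (hgs : g1 ≤ s)
    (hq : q = 2 + g1 + s)
    (hκ : 0 < κ) (hκ1 : κ ≤ 1) (hκC : (1 + g1 + (s + 2)) * C1 * (κ * g1) ≤ C0 / 2)
    (hK : IsOpen K) (hKb : Bornology.IsBounded K) (ht : t0 < t1)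
    (hsol : IsWeakSolution C0 C1 g K t0 t1 u V)
    {v : EuclideanSpace ℝ (Fin N) → ℝ → ℝ}
    {Dv : EuclideanSpace ℝ (Fin N) → ℝ → EuclideanSpace ℝ (Fin N)}
    (hv : v = fun x t => max (u x t - k) 0) (hDv : Dv = fun x t => if k < u x t then V x t else 0)
    (hζ : IsLipschitzTest K t0 t1 ζ)
    (hζ01 : ∀ x ∈ closure K, ∀ t ∈ Icc t0 t1, ζ x t ∈ Icc (0 : ℝ) 1)
    (hmono : ∀ x ∈ closure K, MonotoneOn (ζ x) (Icc t0 t1)) {t : ℝ} (htt : t ∈ Icc t0 t1) :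
    (∫ x in K, primitiveG g (ζ x t * v x t / ρ) ^ e * v x t ^ (s + 2) * ζ x t ^ q)
      + C0 / 2 * (∫ τ in t0..t1, (∫ x in K,
          primitiveG g ‖Dv x τ‖ * primitiveG g (ζ x τ * v x τ / ρ) ^ e
            * v x τ ^ s * ζ x τ ^ q))
    ≤ (s + 4) * (g1 + 1) * (∫ τ in t0..t1, (∫ x in K,
          primitiveG g (ζ x τ * v x τ / ρ) ^ e * v x τ ^ (s + 2)
            * ζ x τ ^ (q - 1) * deriv (ζ x) τ))
      + (s + 4) * ((1 + g1 + (s + 2)) * C1 * (κ * g1 * (κ⁻¹) ^ g1)) *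
        (∫ τ in t0..t1, (∫ x in K,
          primitiveG g (‖fderiv ℝ (fun y => ζ y τ) x‖ * ζ x τ * v x τ)
            * primitiveG g (ζ x τ * v x τ / ρ) ^ e
            * v x τ ^ s * ζ x τ ^ (q - 1 - 2 * g1))) := by
  have hg1 : 0 < g1 := by linarith
  have hs0 : 0 < s := by linarith
  have he0 : e ≤ 0 := by linarith
  obtain ⟨ζ', hζ', heq⟩ := exists_isCutoff hK hKb hζ hζ01 hmono
  obtain ⟨w, hwc, hw⟩ := hζ'.exists_continuous_eq hsol.continuousOn
  obtain ⟨a, ha, hab⟩ := hsol.exists_distributionalSolution hg hg1 hC1 hK hKb ht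
  obtain ⟨hslice, hgrad⟩ := power_energy_estimate (k := k) hg h1 hρ hC0 hC1 he hs hs0.le hκ hκ1 hκC
    hK hKb ha hab hsol.grad_integrable hζ' hwc fun p hp h => hw p hp.2.2.le h
  have hae := ae_deriv_eq_of_eqOn hK hζ' fun x hx t ht => heq x (subset_closure hx) t ht
  have igrad := integrableOn_gradTerm (k := k) hg h1 hρ he0 hs hsol.grad_integrable hζ' hwc
  have itime := integrableOn_timeTerm (k := k) hg h1 hρ he0 hs hKb hζ' hwc
  have icut := integrableOn_cutTerm (k := k) hg h1 hρ he hs hKb hζ' hwc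
  have hzero : ∀ p, ζ' p = 0 ∨ (∀ τ ≤ t1, p.2 = τ → u p.1 τ = w p) := by
    intro p
    by_cases h : ζ' p = 0
    · exact Or.inl h
    · refine Or.inr fun τ hτ hp => ?_
      subst hp
      exact hw p hτ h
  have e2 : ∫ τ in t0..t1, (∫ x in K, primitiveG g ‖Dv x τ‖ *
      primitiveG g (ζ x τ * v x τ / ρ) ^ e * v x τ ^ s * ζ x τ ^ q) =
      ρ ^ (s + 1) * ∫ p in K ×ˢ Ioo t0 t1,
        gradTerm g g1 ρ k (powerWeight g e (s + 1)) ζ' w (fun p => V p.1 p.2) p := by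
    refine intervalIntegral_setIntegral_eq_const_mul ht.le igrad ?_
    filter_upwards [hae] with p ⟨hp, _, _⟩
    have hz : ζ p.1 p.2 = ζ' p := (heq p.1 (subset_closure hp.1) p.2 ⟨hp.2.1.le, hp.2.2.le⟩).symm
    rw [gradTerm, hz]
    rcases hzero p with h0 | h0
    · rw [h0, Real.zero_rpow (by linarith : q ≠ 0)]; simp
    · have hup := h0 _ hp.2.2.le rfl
      have hwt := grad_weight_eq (w := w p - k) (g := g) (e := e) hs0 hq hg1 hρ (hζ'.nonneg p)
      simp only [hv, hDv, hup]
      by_cases hk : k < w p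
      · rw [if_pos hk]
        linear_combination primitiveG g ‖V p.1 p.2‖ * hwt
      · have hk' : w p - k ≤ 0 := by linarith
        rw [max_eq_right hk', Real.zero_rpow hs0.ne',
          powerWeight_eq_zero_of_degenerate (hζ'.nonneg p) hρ fun h => by linarith [h.2]]
        simp
  have e3 : ∫ τ in t0..t1, (∫ x in K, primitiveG g (ζ x τ * v x τ / ρ) ^ e * v x τ ^ (s + 2)
      * ζ x τ ^ (q - 1) * deriv (ζ x) τ) =
      ρ ^ (s + 1) * ∫ p in K ×ˢ Ioo t0 t1,
        timeTerm g1 ρ k (powerWeight g e (s + 1)) ζ' w p := by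
    refine intervalIntegral_setIntegral_eq_const_mul ht.le itime ?_
    filter_upwards [hae] with p ⟨hp, hd, _⟩
    have hz : ζ p.1 p.2 = ζ' p := (heq p.1 (subset_closure hp.1) p.2 ⟨hp.2.1.le, hp.2.2.le⟩).symm
    rw [timeTerm, hz, hd]
    rcases hzero p with h0 | h0
    · rw [h0, Real.zero_rpow (by linarith : q - 1 ≠ 0), Real.zero_rpow hg1.ne']; simp
    · have hup := h0 _ hp.2.2.le rfl
      have hwt := time_weight_eq (w := w p - k) (g := g) (e := e) hs0 hq hg1 hρ (hζ'.nonneg p)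
      simp only [hv, hup]
      rw [hwt]; ring
  have e4 : ∫ τ in t0..t1, (∫ x in K, primitiveG g (‖fderiv ℝ (fun y => ζ y τ) x‖ * ζ x τ * v x τ)
      * primitiveG g (ζ x τ * v x τ / ρ) ^ e * v x τ ^ s * ζ x τ ^ (q - 1 - 2 * g1)) =
      ρ ^ (s + 1) * ∫ p in K ×ˢ Ioo t0 t1,
        cutTerm g g1 ρ k (powerWeight g e (s + 1)) ζ' w p := by
    refine intervalIntegral_setIntegral_eq_const_mul ht.le icut ?_
    filter_upwards [hae] with p ⟨hp, _, hd⟩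
    have hz : ζ p.1 p.2 = ζ' p := (heq p.1 (subset_closure hp.1) p.2 ⟨hp.2.1.le, hp.2.2.le⟩).symm
    rw [cutTerm, hz, hd]
    rcases hzero p with h0 | h0
    · rw [h0, Real.zero_rpow (by linarith : q - 1 - 2 * g1 ≠ 0),
        Real.zero_rpow (by linarith : -g1 ≠ 0)]; simp
    · have hup := h0 _ hp.2.2.le rfl
      have hwt := cut_weight_eq (w := w p - k) (g := g) (e := e) hs0 hq hgs hρ (hζ'.nonneg p)
      simp only [hv, hup]
      by_cases hk : k < w p
      · have hk' : 0 ≤ w p - k := by linarith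
        rw [max_eq_left hk'] at hwt ⊢
        linear_combination primitiveG g (‖(fderiv ℝ ζ' p).comp
          (ContinuousLinearMap.inl ℝ (EuclideanSpace ℝ (Fin N)) ℝ)‖ * ζ' p * (w p - k)) * hwt
      · have hk' : w p - k ≤ 0 := by linarith
        rw [max_eq_right hk', Real.zero_rpow hs0.ne',
          powerWeight_eq_zero_of_degenerate (hζ'.nonneg p) hρ fun h => by linarith [h.2]]
        simp
  rw [e2, e3, e4]
  set T := ∫ p in K ×ˢ Ioo t0 t1, timeTerm g1 ρ k (powerWeight g e (s + 1)) ζ' w p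
  set S := ∫ p in K ×ˢ Ioo t0 t1, cutTerm g g1 ρ k (powerWeight g e (s + 1)) ζ' w p
  set R := (g1 + 1) * T + (1 + g1 + (s + 2)) * C1 * (κ * g1 * (κ⁻¹) ^ g1) * S with hR
  have hρs : 0 < ρ ^ (s + 1) := Real.rpow_pos_of_pos hρ _
  have hR0 : 0 ≤ R := by
    refine le_trans (mul_nonneg (by linarith) (integral_nonneg fun p => ?_)) hgrad
    refine mul_nonneg (hg.primitiveG_nonneg (norm_nonneg _)) (mul_nonneg (mul_nonneg
      (Real.rpow_nonneg (hζ'.nonneg p) _) (hζ'.nonneg p)) ?_)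
    rcases le_or_gt (w p - k) 0 with h | h
    · rw [powerWeight_eq_zero_of_degenerate (hζ'.nonneg p) hρ fun h' => by linarith [h'.2]]; simp
    · exact div_nonneg (powerWeight_nonneg hg _) h.le
  have hS : ∫ x in K, primitiveG g (ζ x t * v x t / ρ) ^ e * v x t ^ (s + 2) * ζ x t ^ q
      ≤ ρ ^ (s + 1) * ((s + 3) * R) := by
    rcases htt.1.eq_or_lt with h | h
    · subst h
      refine le_trans (le_of_eq ?_) (mul_nonneg hρs.le (mul_nonneg (by linarith) hR0))
      refine setIntegral_eq_zero_of_forall_eq_zero fun x hx => ?_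
      obtain ⟨-, U, -, hU, hU0⟩ := hζ
      have : ζ x t0 = 0 := hU0 (x, t0) ⟨hU (Or.inr ⟨subset_closure hx, rfl⟩), subset_closure hx,
        htt⟩
      rw [this, Real.zero_rpow (by linarith : q ≠ 0), mul_zero]
    · refine le_trans (le_of_eq ?_) (mul_le_mul_of_nonneg_left (hslice t ⟨h, htt.2⟩) hρs.le)
      rw [← integral_const_mul]
      refine setIntegral_congr_fun hK.measurableSet fun x hx => ?_
      have hz : ζ x t = ζ' (x, t) := (heq x (subset_closure hx) t htt).symm
      simp only [hz]
      rcases hzero (x, t) with h0 | h0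
      · rw [h0, Real.zero_rpow (by linarith : q ≠ 0)]; simp
      · have hup := h0 t htt.2 rfl
        simp only [hv, hup]
        exact slice_weight_eq hs0 hq hg1 hρ (hζ'.nonneg _)
  calc _ ≤ ρ ^ (s + 1) * ((s + 3) * R) + ρ ^ (s + 1) * R := by
        refine add_le_add hS ?_
        rw [mul_left_comm]
        exact mul_le_mul_of_nonneg_left hgrad hρs.le
    _ = _ := by rw [hR]; ring

end Truncation

/-- Local energy estimate. Since `r - 1 < 0` and `0 ^ (r - 1) = 0` for the real power, every
integrand below is `0` at points where `ζ * v = 0`. -/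
theorem local_energy_estimate (N : ℕ) (hN : 1 ≤ N) (C0 C1 g0 g1 : ℝ)
    (hC0 : 0 < C0) (hC1 : 0 < C1) (hg0 : 1 < g0) (hg01 : g0 ≤ g1)
    (r s q : ℝ) (hr : r = (1 - g1) / g0) (hs : s = g1 + g1 / g0 * (g1 - 1))
    (hq : q = 2 + 2 * g1 + g1 / g0 * (g1 - 1)) :
    ∃ c0 c1 c2 : ℝ, 0 < c0 ∧ 0 < c1 ∧ 0 < c2 ∧
    ∀ g : ℝ → ℝ, IsStructureFunction g0 g1 g →
    ∀ ρ : ℝ, 0 < ρ → ∀ t0 t1 : ℝ, t0 < t1 →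
    ∀ (u : EuclideanSpace ℝ (Fin N) → ℝ → ℝ)
      (V : EuclideanSpace ℝ (Fin N) → ℝ → EuclideanSpace ℝ (Fin N)),
      IsWeakSolution C0 C1 g (cube N 0 ρ) t0 t1 u V →
    ∀ (k : ℝ) (v : EuclideanSpace ℝ (Fin N) → ℝ → ℝ)
      (Dv : EuclideanSpace ℝ (Fin N) → ℝ → EuclideanSpace ℝ (Fin N)),
      ((v = (fun x t => max (u x t - k) 0) ∧
          Dv = (fun x t => if k < u x t then V x t else 0)) ∨
       (v = (fun x t => max (k - u x t) 0) ∧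
          Dv = (fun x t => if u x t < k then -V x t else 0))) →
    ∀ ζ : EuclideanSpace ℝ (Fin N) → ℝ → ℝ,
      IsLipschitzTest (cube N 0 ρ) t0 t1 ζ →
      (∀ x ∈ closure (cube N 0 ρ), ∀ t ∈ Set.Icc t0 t1, ζ x t ∈ Set.Icc (0 : ℝ) 1) →
      (∀ x ∈ closure (cube N 0 ρ), MonotoneOn (ζ x) (Set.Icc t0 t1)) →
    ∀ t ∈ Set.Icc t0 t1,
      (∫ x in cube N 0 ρ,
          primitiveG g (ζ x t * v x t / ρ) ^ (r - 1) * v x t ^ (s + 2) * ζ x t ^ q)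
        + c0 * (∫ τ in t0..t1, (∫ x in cube N 0 ρ,
            primitiveG g ‖Dv x τ‖ * primitiveG g (ζ x τ * v x τ / ρ) ^ (r - 1)
              * v x τ ^ s * ζ x τ ^ q))
      ≤ c1 * (∫ τ in t0..t1, (∫ x in cube N 0 ρ,
            primitiveG g (ζ x τ * v x τ / ρ) ^ (r - 1) * v x τ ^ (s + 2)
              * ζ x τ ^ (q - 1) * deriv (ζ x) τ))
        + c2 * (∫ τ in t0..t1, (∫ x in cube N 0 ρ,
            primitiveG g (‖fderiv ℝ (fun y => ζ y τ) x‖ * ζ x τ * v x τ)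
              * primitiveG g (ζ x τ * v x τ / ρ) ^ (r - 1)
              * v x τ ^ s * ζ x τ ^ (q - 1 - 2 * g1))) := by
  have hg1 : 1 < g1 := hg0.trans_le hg01
  have hg0' : 0 < g0 := by linarith
  have hpos : 0 ≤ g1 / g0 * (g1 - 1) := by
    have : 0 ≤ g1 - 1 := by linarith
    positivity
  have hgs : g1 ≤ s := by linarith
  have he : r - 1 + 1 ≤ 0 := by
    rw [sub_add_cancel, hr]
    exact div_nonpos_of_nonpos_of_nonneg (by linarith) hg0'.le
  have hse : s + (r - 1) * g1 = 0 := by rw [hs, hr]; field_simp; ring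
  have hqs : q = 2 + g1 + s := by rw [hq, hs]; ring
  have hD : 0 < (1 + g1 + (s + 2)) * C1 * g1 :=
    mul_pos (mul_pos (by linarith) hC1) (by linarith)
  obtain ⟨κ, hκ, hκ1, hκC⟩ : ∃ κ : ℝ, 0 < κ ∧ κ ≤ 1 ∧
      (1 + g1 + (s + 2)) * C1 * (κ * g1) ≤ C0 / 2 := by
    refine ⟨min 1 (C0 / 2 / ((1 + g1 + (s + 2)) * C1 * g1)),
      lt_min one_pos (div_pos (by linarith) hD), min_le_left _ _, ?_⟩
    have := (le_div_iff₀ hD).mp (min_le_right 1 (C0 / 2 / ((1 + g1 + (s + 2)) * C1 * g1)))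
    linarith
  have hκg : 0 < κ * g1 * (κ⁻¹) ^ g1 :=
    mul_pos (mul_pos hκ (by linarith)) (Real.rpow_pos_of_pos (inv_pos.mpr hκ) _)
  refine ⟨C0 / 2, (s + 4) * (g1 + 1),
    (s + 4) * ((1 + g1 + (s + 2)) * C1 * (κ * g1 * (κ⁻¹) ^ g1)), by linarith,
    mul_pos (by linarith) (by linarith),
    mul_pos (by linarith) (mul_pos (mul_pos (by linarith) hC1) hκg), ?_⟩
  intro g hg ρ hρ t0 t1 ht u V hsol k v Dv hv ζ hζ hζ01 hmono t htt
  rcases hv with ⟨hv, hDv⟩ | ⟨hv, hDv⟩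
  · exact energy_estimate_above hg hg1 hρ hC0 hC1 he hse hgs hqs hκ hκ1 hκC (isOpen_cube 0 ρ)
      (isBounded_cube 0 ρ) ht hsol hv hDv hζ hζ01 hmono htt
  · refine energy_estimate_above (k := -k) hg hg1 hρ hC0 hC1 he hse hgs hqs hκ hκ1 hκC
      (isOpen_cube 0 ρ) (isBounded_cube 0 ρ) ht hsol.neg ?_ ?_ hζ hζ01 hmono htt
    · rw [hv]; funext x τ; congr 1; ring
    · rw [hDv]; funext x τ; simp only [neg_lt_neg_iff]
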